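/- arXiv:1007.2080 — 3 statements merged into one kernel-verified Lean document; each statement's English description precedes it below -/
import Mathlib

section
/- Let G = A ∗ B be a free product of residually finite groups A and B, and let u, v₁, …, vₙ ∈ G be such that u does not lie in any conjugate of A or of B, and for each i the elements u and vᵢ do not lie in conjugate cyclic subgroups (i.e., there exist no g, c ∈ G and integers k, l with u = c^k and g·vᵢ·g⁻¹ = c^l). Then there exist positive integers L, K₁, …, Kₙ such that for every positive integer m there exists a finite group H and a surjective group homomorphism φ : G → H with the order of φ(u) equal to L·m and the order of φ(vᵢ) equal to Kᵢ for each i = 1, …, n. -/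
open scoped Monoid.Coprod

section Separation

/-- Finitely many elements of a residually finite group are detected by one finite quotient. -/
lemma exists_finite_quotient_separating {A : Type*} [Group A]
    (hA : ∀ a : A, a ≠ 1 → ∃ (F : Type) (_ : Group F) (_ : Finite F) (ψ : A →* F), ψ a ≠ 1)
    {T : Set A} (hT : T.Finite) :
    ∃ (F : Type) (_ : Group F) (_ : Finite F) (ψ : A →* F), ∀ t ∈ T, ψ t = 1 → t = 1 := by
  induction T, hT using Set.Finite.induction_on with
  | empty => exact ⟨Unit, inferInstance, inferInstance, 1, by simp⟩
  | @insert a T _ _ ih =>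
    obtain ⟨F, _, _, ψ, hψ⟩ := ih
    by_cases ha : a = 1
    · refine ⟨F, _, ‹_›, ψ, ?_⟩
      rintro t (rfl | ht) h
      exacts [ha, hψ t ht h]
    · obtain ⟨F', _, _, ψ', hψ'⟩ := hA a ha
      refine ⟨F' × F, inferInstance, inferInstance, ψ'.prod ψ, ?_⟩
      rintro t (rfl | ht) h
      · exact absurd (congrArg Prod.fst h) hψ'
      · exact hψ t ht (congrArg Prod.snd h)

/-- Two embeddings of the same type in a finite type differ by a permutation. -/
lemma exists_perm_comp_eq {S X : Type*} [Finite X] {f g : S → X}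
    (hf : Function.Injective f) (hg : Function.Injective g) :
    ∃ τ : Equiv.Perm X, ∀ s, τ (f s) = g s := by
  classical
  have := Fintype.ofFinite X
  let e : {x // x ∈ Set.range f} ≃ {x // x ∈ Set.range g} :=
    (Equiv.ofInjective f hf).symm.trans (Equiv.ofInjective g hg)
  refine ⟨e.extendSubtype, fun s ↦ ?_⟩
  rw [Equiv.extendSubtype_apply_of_mem e _ ⟨s, rfl⟩]
  simp only [e, Equiv.trans_apply]
  rw [Equiv.ofInjective_symm_apply]
  rfl

/-- An integral weight vanishing on `S` and not orthogonal to finitely many integral vectors,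
none of which is supported on `S`. -/
lemma exists_weight {Ω J : Type*} [Fintype Ω] [Finite J] (S : Set Ω) (c : J → Ω → ℤ)
    (hc : ∀ j, ∃ y, y ∉ S ∧ c j y ≠ 0) :
    ∃ h : Ω → ℤ, (∀ y ∈ S, h y = 0) ∧ ∀ j, ∑ y, c j y * h y ≠ 0 := by
  classical
  have := Fintype.ofFinite J
  let idx : Ω ≃ Fin (Fintype.card Ω) := Fintype.equivFin Ω
  let p : J → Polynomial ℤ := fun j ↦
    ∑ y, Polynomial.monomial (idx y) (if y ∈ S then 0 else c j y)
  have hp : ∀ j, p j ≠ 0 := by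
    intro j hj
    obtain ⟨y, hy, hcy⟩ := hc j
    apply hcy
    have h1 : (p j).coeff (idx y) = c j y := by
      simp only [p, Polynomial.finsetSum_coeff, Polynomial.coeff_monomial]
      rw [Finset.sum_eq_single y]
      · simp [hy]
      · intro z _ hz
        rw [if_neg]
        exact fun h ↦ hz (idx.injective (Fin.ext h))
      · simp
    rw [← h1, hj, Polynomial.coeff_zero]
  have hprod : ∏ j, p j ≠ 0 := Finset.prod_ne_zero_iff.2 fun j _ ↦ hp j
  obtain ⟨x, hx⟩ : ∃ x : ℤ, (∏ j, p j).eval x ≠ 0 := by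
    by_contra! h
    exact hprod (Polynomial.funext fun r ↦ by simpa using h r)
  refine ⟨fun y ↦ if y ∈ S then 0 else x ^ (idx y : ℕ), fun y hy ↦ if_pos hy, fun j ↦ ?_⟩
  rw [Polynomial.eval_prod] at hx
  have := Finset.prod_ne_zero_iff.1 hx j (Finset.mem_univ j)
  convert this using 1
  simp only [p, Polynomial.eval_finsetSum, Polynomial.eval_monomial]
  refine Finset.sum_congr rfl fun y _ ↦ ?_
  split_ifs <;> simp

end Separation

/-- A cyclically reduced word of even positive length in the free product of `A` and `B`. -/
structure CyclicWord (A B : Type*) [Group A] [Group B] where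
  len : ℕ
  len_pos : 0 < len
  a : ZMod len → A
  b : ZMod len → B
  a_ne_one : ∀ j, a j ≠ 1
  b_ne_one : ∀ j, b j ≠ 1

namespace CyclicWord

variable {A B : Type*} [Group A] [Group B]

instance (W : CyclicWord A B) : NeZero W.len := ⟨W.len_pos.ne'⟩

/-- The vertices of even index on the axis of the word: its suffixes of even length. -/
def even (W : CyclicWord A B) : ℕ → A ∗ B
  | 0 => 1
  | m + 1 => .inl (W.a m) * (.inr (W.b m) * W.even m)

/-- The vertices of odd index on the axis of the word. -/
def odd (W : CyclicWord A B) (m : ℕ) : A ∗ B := .inr (W.b m) * W.even m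

/-- The element of the free product represented by the word. -/
def elt (W : CyclicWord A B) : A ∗ B := W.even W.len

variable (W U V : CyclicWord A B)

@[simp] lemma even_zero : W.even 0 = 1 := rfl

lemma even_succ (m : ℕ) : W.even (m + 1) = .inl (W.a m) * W.odd m := rfl

lemma even_add {d : ℕ} (ha : ∀ j, W.a (j + d) = W.a j) (hb : ∀ j, W.b (j + d) = W.b j) (m : ℕ) :
    W.even (m + d) = W.even m * W.even d := by
  induction m with
  | zero => simp
  | succ m ih =>
    rw [show m + 1 + d = (m + d) + 1 by ring, even_succ, even_succ, odd, odd, ih]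
    push_cast
    rw [ha, hb]
    simp only [mul_assoc]

lemma even_mul {d : ℕ} (ha : ∀ j, W.a (j + d) = W.a j) (hb : ∀ j, W.b (j + d) = W.b j) (k : ℕ) :
    W.even (k * d) = W.even d ^ k := by
  induction k with
  | zero => simp
  | succ k ih => rw [add_mul, one_mul, W.even_add ha hb, ih, pow_succ]

lemma even_len_mul (k : ℕ) : W.even (k * W.len) = W.elt ^ k :=
  W.even_mul (by simp) (by simp) k

lemma even_add_len_mul (m k : ℕ) : W.even (m + k * W.len) = W.even m * W.elt ^ k := by
  rw [W.even_add (by simp) (by simp), even_len_mul]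

/-- The periods of a word that has `r` among its periods have a common generator. -/
lemma exists_common_power {r : ℕ} (ha : ∀ j, U.a (j + r) = U.a j)
    (hb : ∀ j, U.b (j + r) = U.b j) :
    ∃ (c : A ∗ B) (k l : ℕ), U.elt = c ^ k ∧ U.even r = c ^ l := by
  have hz : ∀ z : ℤ, (∀ j, U.a (j + z * r) = U.a j) ∧ ∀ j, U.b (j + z * r) = U.b j := by
    intro z
    constructor <;> intro j
    · have : Function.Periodic U.a (r : ZMod U.len) := ha
      simpa using this.zsmul z j
    · have : Function.Periodic U.b (r : ZMod U.len) := hb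
      simpa using this.zsmul z j
  set d := Nat.gcd U.len r with hd
  have hdz : (d : ZMod U.len) = (Nat.gcdB U.len r : ℤ) * r := by
    have := congrArg (Int.cast : ℤ → ZMod U.len) (Nat.gcd_eq_gcd_ab U.len r)
    push_cast at this
    rw [this]
    simp [mul_comm]
  obtain ⟨k, hk⟩ := Nat.gcd_dvd_left U.len r
  obtain ⟨l, hl⟩ := Nat.gcd_dvd_right U.len r
  have ha' : ∀ j, U.a (j + d) = U.a j := by rw [hdz]; exact (hz _).1
  have hb' : ∀ j, U.b (j + d) = U.b j := by rw [hdz]; exact (hz _).2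
  refine ⟨U.even d, k, l, ?_, ?_⟩
  · rw [← U.even_mul ha' hb', mul_comm k, ← hk, elt]
  · rw [← U.even_mul ha' hb', mul_comm l, ← hl]

/-- `u` and `v` lie in conjugate cyclic subgroups. -/
def ConjCyclic {G : Type*} [Group G] (u v : G) : Prop :=
  ∃ (g c : G) (k l : ℤ), u = c ^ k ∧ g * v * g⁻¹ = c ^ l

lemma conjCyclic_of_forward (μ : ℕ) (ha : ∀ m : ℕ, V.a m = U.a (m + μ))
    (hb : ∀ m : ℕ, V.b m = U.b (m + μ)) : ConjCyclic U.elt V.elt := by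
  have key : ∀ j : ZMod U.len, ∃ m : ℕ, j = m + μ := fun j ↦
    ⟨(j - μ).val, by simp⟩
  have ha' : ∀ j, U.a (j + V.len) = U.a j := by
    intro j
    obtain ⟨m, rfl⟩ := key j
    rw [← ha m, show (m + μ + V.len : ZMod U.len) = ((m + V.len : ℕ) : ZMod U.len) + μ by
      push_cast; ring, ← ha]
    simp
  have hb' : ∀ j, U.b (j + V.len) = U.b j := by
    intro j
    obtain ⟨m, rfl⟩ := key j
    rw [← hb m, show (m + μ + V.len : ZMod U.len) = ((m + V.len : ℕ) : ZMod U.len) + μ by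
      push_cast; ring, ← hb]
    simp
  have hE : ∀ m, V.even m * U.even μ = U.even (m + μ) := by
    intro m
    induction m with
    | zero => simp
    | succ m ih =>
      rw [show m + 1 + μ = (m + μ) + 1 by ring, even_succ, even_succ, odd, odd, ← ih, ha, hb]
      push_cast
      simp only [mul_assoc]
  obtain ⟨c, k, l, hk, hl⟩ := U.exists_common_power ha' hb'
  refine ⟨(U.even μ)⁻¹, c, k, l, by simpa using hk, ?_⟩
  have := hE V.len
  rw [add_comm, U.even_add ha' hb', hl] at this
  rw [inv_inv, mul_assoc, elt, this]
  simp

lemma conjCyclic_of_backward (μ : ZMod U.len) (ha : ∀ m : ℕ, V.a m = (U.a (μ - 1 - m))⁻¹)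
    (hb : ∀ m : ℕ, V.b m = (U.b (μ - m))⁻¹) : ConjCyclic U.elt V.elt := by
  have ha' : ∀ j, U.a (j + V.len) = U.a j := by
    intro j
    have h1 := ha (μ - 1 - j - V.len).val
    have h2 := ha ((μ - 1 - j - V.len).val + V.len)
    simp only [Nat.cast_add, ZMod.natCast_val, ZMod.cast_id', id, CharP.cast_eq_zero, add_zero]
      at h1 h2
    rw [h1, inv_inj] at h2
    convert h2 using 2 <;> ring
  have hb' : ∀ j, U.b (j + V.len) = U.b j := by
    intro j
    have h1 := hb (μ - j - V.len).val
    have h2 := hb ((μ - j - V.len).val + V.len)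
    simp only [Nat.cast_add, ZMod.natCast_val, ZMod.cast_id', id, CharP.cast_eq_zero, add_zero]
      at h1 h2
    rw [h1, inv_inj] at h2
    convert h2 using 2 <;> ring
  obtain ⟨ν, hν, hle⟩ : ∃ ν : ℕ, (ν : ZMod U.len) = μ ∧ V.len ≤ ν :=
    ⟨μ.val + V.len * U.len, by simp, le_add_left (Nat.le_mul_of_pos_right _ U.len_pos)⟩
  have hE : ∀ m k, m + k = ν → V.even m * U.odd ν = U.odd k := by
    intro m
    induction m with
    | zero => rintro k rfl; simp
    | succ m ih =>
      intro k hk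
      have := ih (k + 1) (by omega)
      rw [even_succ, odd, mul_assoc, mul_assoc, this, ha, hb, ← hν, ← hk, odd, even_succ]
      push_cast
      rw [show (m + 1 + k - 1 - m : ZMod U.len) = k by ring,
        show (m + 1 + k - m : ZMod U.len) = k + 1 by ring]
      simp
  obtain ⟨c, k, l, hk, hl⟩ := U.exists_common_power ha' hb'
  refine ⟨(U.odd ν)⁻¹, c, k, -l, by simpa using hk, ?_⟩
  obtain ⟨κ, rfl⟩ := Nat.exists_eq_add_of_le hle
  have h1 := hE V.len κ rfl
  have h2 : U.odd (V.len + κ) = U.odd κ * c ^ l := by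
    rw [odd, odd, add_comm, U.even_add ha' hb', hl]
    push_cast
    rw [hb', mul_assoc]
  rw [inv_inv, mul_assoc, elt, h1, h2]
  simp

/-- Every element of the free product is conjugate into a factor or to a cyclically reduced word
of positive even length. -/
lemma exists_conj_eq_elt (g : A ∗ B) :
    (∃ h : A ∗ B, h * g * h⁻¹ ∈ (Monoid.Coprod.inl : A →* A ∗ B).range ∨
      h * g * h⁻¹ ∈ (Monoid.Coprod.inr : B →* A ∗ B).range) ∨
    ∃ (W : CyclicWord A B) (h : A ∗ B), h * g * h⁻¹ = W.elt := by
  classical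
  let P : List (A × B) → A ∗ B := fun l ↦ (l.map fun p ↦ .inl p.1 * .inr p.2).prod
  have P_append : ∀ l l', P (l ++ l') = P l * P l' := by simp [P]
  have P_cons : ∀ p l, P (p :: l) = .inl p.1 * .inr p.2 * P l := by simp [P]
  have hsurj : ∃ l, P l = g := by
    induction g using Monoid.Coprod.induction_on with
    | inl a => exact ⟨[(a, 1)], by simp [P]⟩
    | inr b => exact ⟨[(1, b)], by simp [P]⟩
    | mul x y hx hy =>
      obtain ⟨l, rfl⟩ := hx
      obtain ⟨l', rfl⟩ := hy
      exact ⟨l ++ l', P_append _ _⟩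
  have hex : ∃ n, ∃ l : List (A × B), l.length = n ∧ ∃ h, h * g * h⁻¹ = P l := by
    obtain ⟨l, hl⟩ := hsurj
    exact ⟨_, l, rfl, 1, by simp [hl]⟩
  obtain ⟨l, hlen, h, hl⟩ := Nat.find_spec hex
  have hmin : ∀ l' : List (A × B), (∃ h, h * g * h⁻¹ = P l') → l.length ≤ l'.length := by
    intro l' hl'
    rw [hlen]
    exact Nat.find_min' hex ⟨l', rfl, hl'⟩
  by_cases hell : ∃ h : A ∗ B, h * g * h⁻¹ ∈ (Monoid.Coprod.inl : A →* A ∗ B).range ∨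
      h * g * h⁻¹ ∈ (Monoid.Coprod.inr : B →* A ∗ B).range
  · exact Or.inl hell
  right
  have hne : l ≠ [] := by
    rintro rfl
    exact hell ⟨h, Or.inl ⟨1, by simp [hl, P]⟩⟩
  have hred : ∀ p ∈ l, p.1 ≠ 1 ∧ p.2 ≠ 1 := by
    intro p hp
    obtain ⟨l₁, l₂, rfl⟩ := List.append_of_mem hp
    have hrot : (P l₁)⁻¹ * h * g * ((P l₁)⁻¹ * h)⁻¹ = P (p :: (l₂ ++ l₁)) := by
      rw [show (P l₁)⁻¹ * h * g * ((P l₁)⁻¹ * h)⁻¹ = (P l₁)⁻¹ * (h * g * h⁻¹) * P l₁ by group, hl]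
      simp only [P_append, P_cons]
      group
    have hlen' : (l₁ ++ p :: l₂).length = (l₂ ++ l₁).length + 1 := by
      simp only [List.length_append, List.length_cons]; omega
    generalize l₂ ++ l₁ = r at hrot hlen'
    rw [P_cons] at hrot
    constructor
    · intro h1
      rw [h1, map_one, one_mul] at hrot
      obtain rfl | ⟨r', q, rfl⟩ := r.eq_nil_or_concat'
      · exact hell ⟨_, Or.inr ⟨p.2, by rw [hrot]; simp [P]⟩⟩
      · have := hmin (r' ++ [(q.1, q.2 * p.2)]) ⟨(.inr p.2)⁻¹ * ((P l₁)⁻¹ * h), by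
          rw [show (.inr p.2)⁻¹ * ((P l₁)⁻¹ * h) * g * ((.inr p.2)⁻¹ * ((P l₁)⁻¹ * h))⁻¹ =
            (.inr p.2)⁻¹ * ((P l₁)⁻¹ * h * g * ((P l₁)⁻¹ * h)⁻¹) * .inr p.2 by group, hrot]
          simp [P, mul_assoc]⟩
        simp only [List.length_append, List.length_cons, List.length_nil] at this hlen'
        omega
    · intro h1
      rw [h1, map_one, mul_one] at hrot
      rcases r with _ | ⟨q, r'⟩
      · exact hell ⟨_, Or.inl ⟨p.1, by rw [hrot]; simp [P]⟩⟩
      · have := hmin ((p.1 * q.1, q.2) :: r') ⟨_, by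
          rw [hrot]
          simp [P, mul_assoc]⟩
        simp only [List.length_cons] at this hlen'
        omega
  have hpos : 0 < l.reverse.length := by simpa [List.length_pos_iff] using hne
  have : NeZero l.reverse.length := ⟨hpos.ne'⟩
  let c : ZMod l.reverse.length → A × B := fun j ↦ l.reverse[j.val]'(ZMod.val_lt j)
  have hc : ∀ j, (c j).1 ≠ 1 ∧ (c j).2 ≠ 1 := fun j ↦
    hred _ (List.mem_reverse.1 (List.getElem_mem _))
  let W : CyclicWord A B :=
    ⟨l.reverse.length, hpos, fun j ↦ (c j).1, fun j ↦ (c j).2, fun j ↦ (hc j).1, fun j ↦ (hc j).2⟩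
  have hW : ∀ m, m ≤ l.reverse.length → W.even m = P (l.reverse.take m).reverse := by
    intro m
    induction m with
    | zero => simp [P]
    | succ m ih =>
      intro hm
      rw [List.take_succ_eq_append_getElem (by omega), List.reverse_append, P_append, ← ih (by omega),
        even_succ, odd]
      have hcm : c (m : ZMod l.reverse.length) = l.reverse[m] := by
        simp only [c]
        congr 1
        exact ZMod.val_cast_of_lt (by omega)
      have h1 : W.a m = l.reverse[m].1 := by rw [← hcm]
      have h2 : W.b m = l.reverse[m].2 := by rw [← hcm]
      rw [h1, h2]
      simp [P, mul_assoc]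
  refine ⟨W, h, ?_⟩
  rw [hl, elt, hW _ le_rfl]
  rw [List.take_length, List.reverse_reverse]

/-- A finite permutation representation in which the word follows an embedded cycle, and in which
a letter maps a vertex of that cycle to another one only along the cycle. -/
lemma exists_perm_cycle {A' B' : Type} [Group A'] [Group B'] [Finite A'] [Finite B']
    (α : A →* A') (β : B →* B') (hα : ∀ j, α (W.a j) ≠ 1) (hβ : ∀ j, β (W.b j) ≠ 1) :
    ∃ (X : Type) (_ : Finite X) (θ : A ∗ B →* Equiv.Perm X) (e o : ZMod W.len → X),
      (∀ j, θ (.inr (W.b j)) (e j) = o j) ∧ (∀ j, θ (.inl (W.a j)) (o j) = e (j + 1)) ∧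
      (∀ i j, e i ≠ o j) ∧
      (∀ b i j, θ (.inr b) (e i) = e j → β b = 1) ∧
      (∀ b i j, θ (.inr b) (o i) = o j → β b = 1) ∧
      (∀ b i j, θ (.inr b) (e i) = o j → j = i ∧ β b = β (W.b i)) ∧
      (∀ b i j, θ (.inr b) (o i) = e j → j = i ∧ β b * β (W.b i) = 1) ∧
      (∀ a i j, θ (.inl a) (e i) = e j → α a = 1) ∧
      (∀ a i j, θ (.inl a) (o i) = o j → α a = 1) ∧
      (∀ a i j, θ (.inl a) (o i) = e j → j = i + 1 ∧ α a = α (W.a i)) ∧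
      (∀ a i j, θ (.inl a) (e i) = o j → j = i - 1 ∧ α a * α (W.a (i - 1)) = 1) := by
  let cA : ZMod W.len × Bool → ZMod W.len × A' × B' := fun s ↦
    bif s.2 then (s.1, 1, 1) else (s.1 - 1, α (W.a (s.1 - 1)), 1)
  let cB : ZMod W.len × Bool → ZMod W.len × A' × B' := fun s ↦
    bif s.2 then (s.1, 1, β (W.b s.1)) else (s.1, 1, 1)
  have hcA : Function.Injective cA := by
    rintro ⟨i, _ | _⟩ ⟨j, _ | _⟩ h <;> simp [cA] at h
    · simp [h.1]
    · exact absurd h.2 (hα _)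
    · exact absurd (h.1 ▸ h.2.symm) (hα _)
    · simp [h]
  have hcB : Function.Injective cB := by
    rintro ⟨i, _ | _⟩ ⟨j, _ | _⟩ h <;> simp [cB] at h
    · simp [h]
    · exact absurd (h.1 ▸ h.2.symm) (hβ _)
    · exact absurd h.2 (hβ _)
    · simp [h.1]
  obtain ⟨τ, hτ⟩ := exists_perm_comp_eq hcA hcB
  let θA : A →* Equiv.Perm (ZMod W.len × A' × B') :=
    { toFun a := Equiv.prodCongr (Equiv.refl _) (Equiv.prodCongr (Equiv.mulLeft (α a)) (Equiv.refl _))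
      map_one' := by ext1 ⟨_, _, _⟩; simp
      map_mul' a a' := by ext1 ⟨_, _, _⟩; simp [mul_assoc] }
  let θB : B →* Equiv.Perm (ZMod W.len × A' × B') :=
    { toFun b := Equiv.prodCongr (Equiv.refl _) (Equiv.prodCongr (Equiv.refl _) (Equiv.mulLeft (β b)))
      map_one' := by ext1 ⟨_, _, _⟩; simp
      map_mul' b b' := by ext1 ⟨_, _, _⟩; simp [mul_assoc] }
  let θ : A ∗ B →* Equiv.Perm (ZMod W.len × A' × B') :=
    Monoid.Coprod.lift θA ((MulAut.conj τ⁻¹).toMonoidHom.comp θB)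
  have hA : ∀ a s t, θ (.inl a) (cA s) = cA t ↔ θA a (cA s) = cA t := by
    intro a s t
    simp [θ]
  have hB : ∀ b s t, θ (.inr b) (cA s) = cA t ↔ θB b (cB s) = cB t := by
    intro b s t
    rw [← hτ t, ← hτ s]
    simp [θ, Equiv.symm_apply_eq]
  refine ⟨ZMod W.len × A' × B', inferInstance, θ, fun j ↦ cA (j, false), fun j ↦ cA (j, true), ?_,
    ?_, ?_, ?_, ?_, ?_, ?_, ?_, ?_, ?_, ?_⟩
  · intro j
    rw [hB]
    simp [cB, θB]
  · intro j
    rw [hA]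
    simp [cA, θA]
  · intro i j h
    simpa using hcA h
  · intro b i j h
    rw [hB] at h
    simp [cB, θB] at h
    exact h.2
  · intro b i j h
    rw [hB] at h
    simp [cB, θB] at h
    obtain ⟨rfl, h⟩ := h
    simpa using h
  · intro b i j h
    rw [hB] at h
    simp [cB, θB] at h
    obtain ⟨rfl, h⟩ := h
    exact ⟨rfl, h⟩
  · intro b i j h
    rw [hB] at h
    simp [cB, θB] at h
    exact ⟨h.1.symm, h.2⟩
  · intro a i j h
    rw [hA] at h
    simp [cA, θA] at h
    obtain ⟨rfl, h⟩ := h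
    simpa using h
  · intro a i j h
    rw [hA] at h
    simp [cA, θA] at h
    exact h.2
  · intro a i j h
    rw [hA] at h
    simp [cA, θA] at h
    obtain ⟨rfl, h⟩ := h
    exact ⟨by ring, h⟩
  · intro a i j h
    rw [hA] at h
    simp [cA, θA] at h
    exact ⟨h.1.symm, h.2⟩

/-- The vertices of the axis of the word in a quotient of the free product. -/
def axis {Q : Type*} [Group Q] (π : A ∗ B →* Q) : Set Q :=
  {x | ∃ k, x = π (W.even k) ∨ x = π (W.odd k)}

/-- A finite quotient in which the even and odd vertices of the axes stay apart, and no translated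
axis of a word `W i` lies in the axis of `U`. -/
lemma exists_finite_quotient {ι : Type} [Finite ι]
    (hA : ∀ a : A, a ≠ 1 → ∃ (F : Type) (_ : Group F) (_ : Finite F) (ψ : A →* F), ψ a ≠ 1)
    (hB : ∀ b : B, b ≠ 1 → ∃ (F : Type) (_ : Group F) (_ : Finite F) (ψ : B →* F), ψ b ≠ 1)
    (U : CyclicWord A B) (W : ι → CyclicWord A B) (hUW : ∀ i, ¬ ConjCyclic U.elt (W i).elt) :
    ∃ (Q : Type) (_ : Group Q) (_ : Finite Q) (π : A ∗ B →* Q),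
      (∀ m k, π (U.even m) ≠ π (U.odd k)) ∧
      (∀ i m k, π ((W i).even m) ≠ π ((W i).odd k)) ∧
      ∀ i ω, ∃ m : ℕ, π ((W i).even m) * ω ∉ U.axis π ∨ π ((W i).odd m) * ω ∉ U.axis π := by
  obtain ⟨A', _, _, α, hα⟩ := exists_finite_quotient_separating hA
    (T := Set.range U.a ∪ ⋃ i, (Set.range (W i).a ∪
      (Set.range (fun p : _ × _ ↦ (W i).a p.1 * U.a p.2) ∪
      Set.range (fun p : _ × _ ↦ (W i).a p.1 * (U.a p.2)⁻¹))))
    ((Set.finite_range _).union (Set.finite_iUnion fun i ↦ (Set.finite_range _).union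
      ((Set.finite_range _).union (Set.finite_range _))))
  obtain ⟨B', _, _, β, hβ⟩ := exists_finite_quotient_separating hB
    (T := Set.range U.b ∪ ⋃ i, (Set.range (W i).b ∪
      (Set.range (fun p : _ × _ ↦ (W i).b p.1 * U.b p.2) ∪
      Set.range (fun p : _ × _ ↦ (W i).b p.1 * (U.b p.2)⁻¹))))
    ((Set.finite_range _).union (Set.finite_iUnion fun i ↦ (Set.finite_range _).union
      ((Set.finite_range _).union (Set.finite_range _))))
  have hαU : ∀ j, α (U.a j) ≠ 1 := fun j h ↦ U.a_ne_one j (hα _ (by simp) h)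
  have hβU : ∀ j, β (U.b j) ≠ 1 := fun j h ↦ U.b_ne_one j (hβ _ (by simp) h)
  have hαW : ∀ i j, α ((W i).a j) ≠ 1 := fun i j h ↦ (W i).a_ne_one j
    (hα _ (Or.inr (Set.mem_iUnion.2 ⟨i, by simp⟩)) h)
  have hβW : ∀ i j, β ((W i).b j) ≠ 1 := fun i j h ↦ (W i).b_ne_one j
    (hβ _ (Or.inr (Set.mem_iUnion.2 ⟨i, by simp⟩)) h)
  have hα_inv : ∀ i j k, α ((W i).a j) * α (U.a k) = 1 → (W i).a j = (U.a k)⁻¹ := fun i j k h ↦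
    eq_inv_of_mul_eq_one_left (hα _ (Or.inr (Set.mem_iUnion.2
      ⟨i, Or.inr (Or.inl ⟨(j, k), rfl⟩)⟩)) (by simpa using h))
  have hβ_inv : ∀ i j k, β ((W i).b j) * β (U.b k) = 1 → (W i).b j = (U.b k)⁻¹ := fun i j k h ↦
    eq_inv_of_mul_eq_one_left (hβ _ (Or.inr (Set.mem_iUnion.2
      ⟨i, Or.inr (Or.inl ⟨(j, k), rfl⟩)⟩)) (by simpa using h))
  have hα_eq : ∀ i j k, α ((W i).a j) = α (U.a k) → (W i).a j = U.a k := fun i j k h ↦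
    mul_inv_eq_one.1 (hα _ (Or.inr (Set.mem_iUnion.2
      ⟨i, Or.inr (Or.inr ⟨(j, k), rfl⟩)⟩)) (by simp [h]))
  have hβ_eq : ∀ i j k, β ((W i).b j) = β (U.b k) → (W i).b j = U.b k := fun i j k h ↦
    mul_inv_eq_one.1 (hβ _ (Or.inr (Set.mem_iUnion.2
      ⟨i, Or.inr (Or.inr ⟨(j, k), rfl⟩)⟩)) (by simp [h]))
  have walk : ∀ (V : CyclicWord A B) {X : Type} (θ : A ∗ B →* Equiv.Perm X)
      (e o : ZMod V.len → X), (∀ j, θ (.inr (V.b j)) (e j) = o j) →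
      (∀ j, θ (.inl (V.a j)) (o j) = e (j + 1)) →
      ∀ m : ℕ, θ (V.even m) (e 0) = e m ∧ θ (V.odd m) (e 0) = o m := by
    intro V X θ e o h1 h2 m
    have h3 : ∀ m : ℕ, θ (V.even m) (e 0) = e m → θ (V.odd m) (e 0) = o m := by
      intro m hm
      rw [odd, map_mul, Equiv.Perm.mul_apply, hm, h1]
    induction m with
    | zero => exact ⟨by simp, h3 0 (by simp)⟩
    | succ m ih =>
      have : θ (V.even (m + 1)) (e 0) = e (m + 1 : ℕ) := by
        rw [even_succ, map_mul, Equiv.Perm.mul_apply, ih.2, h2]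
        push_cast
        rfl
      exact ⟨this, h3 _ this⟩
  obtain ⟨X, _, θ, e, o, hb, ha, heo, hbee, hboo, hbeo, hboe, haee, haoo, haoe, haeo⟩ :=
    U.exists_perm_cycle α β hαU hβU
  have hX := fun i ↦ (W i).exists_perm_cycle α β (hαW i) (hβW i)
  choose Y hY ϑ e' o' hb' ha' heo' _ using hX
  have walkU := walk U θ e o hb ha
  have walkW := fun i ↦ walk (W i) (ϑ i) (e' i) (o' i) (hb' i) (ha' i)
  refine ⟨Equiv.Perm X × ∀ i, Equiv.Perm (Y i), inferInstance, inferInstance,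
    θ.prod (MonoidHom.pi ϑ), ?_, ?_, ?_⟩
  · intro m k h
    have h1 : θ (U.even m) (e 0) = θ (U.odd k) (e 0) := by
      rw [show θ (U.even m) = θ (U.odd k) from congrArg Prod.fst h]
    rw [(walkU m).1, (walkU k).2] at h1
    exact heo _ _ h1
  · intro i m k h
    have h1 : ϑ i ((W i).even m) (e' i 0) = ϑ i ((W i).odd k) (e' i 0) := by
      rw [show ϑ i ((W i).even m) = ϑ i ((W i).odd k) from
        congrFun (congrArg Prod.snd h) i]
    rw [(walkW i m).1, (walkW i k).2] at h1
    exact heo' _ _ _ h1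
  · rintro i ⟨ω, ω'⟩
    by_contra! hcon
    have hax : ∀ g : A ∗ B, (θ.prod (MonoidHom.pi ϑ)) g * (ω, ω') ∈
        U.axis (θ.prod (MonoidHom.pi ϑ)) → ∃ j, θ g (ω (e 0)) = e j ∨ θ g (ω (e 0)) = o j := by
      rintro g ⟨k, hk | hk⟩
      · refine ⟨k, Or.inl ?_⟩
        rw [← (walkU k).1, ← Equiv.Perm.mul_apply]
        exact congrArg (fun q ↦ q.1 (e 0)) hk
      · refine ⟨k, Or.inr ?_⟩
        rw [← (walkU k).2, ← Equiv.Perm.mul_apply]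
        exact congrArg (fun q ↦ q.1 (e 0)) hk
    have hev : ∀ m : ℕ, ∃ j, θ ((W i).even m) (ω (e 0)) = e j ∨ θ ((W i).even m) (ω (e 0)) = o j :=
      fun m ↦ hax _ (hcon m).1
    have hod : ∀ m : ℕ, ∃ j, θ (.inr ((W i).b m)) (θ ((W i).even m) (ω (e 0))) = e j ∨
        θ (.inr ((W i).b m)) (θ ((W i).even m) (ω (e 0))) = o j := by
      intro m
      rw [← Equiv.Perm.mul_apply, ← map_mul]
      exact hax _ (hcon m).2
    have hstep : ∀ m : ℕ, θ ((W i).even (m + 1)) (ω (e 0)) =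
        θ (.inl ((W i).a m)) (θ (.inr ((W i).b m)) (θ ((W i).even m) (ω (e 0)))) := by
      intro m
      simp only [even_succ, odd, map_mul, Equiv.Perm.mul_apply]
    generalize ω (e 0) = x at hev hod hstep
    obtain ⟨μ, hμ | hμ⟩ := hev 0
    · obtain ⟨ν, rfl⟩ : ∃ ν : ℕ, (ν : ZMod U.len) = μ := ⟨μ.val, by simp⟩
      have next : ∀ m : ℕ, θ ((W i).even m) x = e (m + ν) →
          θ ((W i).even (m + 1)) x = e ((m + 1 : ℕ) + ν) ∧ (W i).a m = U.a (m + ν) ∧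
            (W i).b m = U.b (m + ν) := by
        intro m hm
        obtain ⟨j, hj⟩ := hod m
        rw [hm] at hj
        obtain ⟨j', hj'⟩ := hev (m + 1)
        rw [hstep, hm] at hj'
        rcases hj with hj | hj
        · exact absurd (hbee _ _ _ hj) (hβW _ _)
        obtain ⟨rfl, hj1⟩ := hbeo _ _ _ hj
        rw [hj] at hj'
        rcases hj' with hj' | hj'
        swap
        · exact absurd (haoo _ _ _ hj') (hαW _ _)
        obtain ⟨rfl, hj2⟩ := haoe _ _ _ hj'
        refine ⟨?_, hα_eq _ _ _ hj2, hβ_eq _ _ _ hj1⟩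
        rw [hstep, hm, hj, hj']
        push_cast
        congr 1
        ring
      have all : ∀ m : ℕ, θ ((W i).even m) x = e (m + ν) := by
        intro m
        induction m with
        | zero => simpa using hμ
        | succ m ih => exact (next m ih).1
      exact hUW i (U.conjCyclic_of_forward (W i) ν (fun m ↦ (next m (all m)).2.1)
        fun m ↦ (next m (all m)).2.2)
    · have next : ∀ m : ℕ, θ ((W i).even m) x = o (μ - m) →
          θ ((W i).even (m + 1)) x = o (μ - (m + 1 : ℕ)) ∧ (W i).a m = (U.a (μ - 1 - m))⁻¹ ∧
            (W i).b m = (U.b (μ - m))⁻¹ := by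
        intro m hm
        obtain ⟨j, hj⟩ := hod m
        rw [hm] at hj
        obtain ⟨j', hj'⟩ := hev (m + 1)
        rw [hstep, hm] at hj'
        rcases hj with hj | hj
        swap
        · exact absurd (hboo _ _ _ hj) (hβW _ _)
        obtain ⟨rfl, hj1⟩ := hboe _ _ _ hj
        rw [hj] at hj'
        rcases hj' with hj' | hj'
        · exact absurd (haee _ _ _ hj') (hαW _ _)
        obtain ⟨rfl, hj2⟩ := haeo _ _ _ hj'
        refine ⟨?_, ?_, hβ_inv _ _ _ hj1⟩
        · rw [hstep, hm, hj, hj']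
          push_cast
          congr 1
          ring
        · rw [sub_right_comm]
          exact hα_inv _ _ _ hj2
      have all : ∀ m : ℕ, θ ((W i).even m) x = o (μ - m) := by
        intro m
        induction m with
        | zero => simpa using hμ
        | succ m ih => exact (next m ih).1
      exact hUW i (U.conjCyclic_of_backward (W i) μ (fun m ↦ (next m (all m)).2.1)
        fun m ↦ (next m (all m)).2.2)

end CyclicWord

section Twist

variable {A B Q : Type*} [Group A] [Group B] [Group Q]

/-- Left translation on the first coordinate. -/
def translation (Q Y : Type*) [Group Q] : Q →* Equiv.Perm (Q × Y) where
  toFun q := Equiv.prodCongr (Equiv.mulLeft q) (Equiv.refl Y)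
  map_one' := by ext1 ⟨_, _⟩; simp
  map_mul' q q' := by ext1 ⟨_, _⟩; simp [mul_assoc]

@[simp] lemma translation_apply {Y : Type*} (q : Q) (x : Q × Y) :
    translation Q Y q x = (q * x.1, x.2) := rfl

lemma translation_injective (Y : Type*) [Nonempty Y] :
    Function.Injective (translation Q Y) := by
  intro q q' h
  obtain ⟨y⟩ := ‹Nonempty Y›
  simpa using congrArg (fun f : Equiv.Perm (Q × Y) ↦ (f (1, y)).1) h

/-- The shear of `Q × ℤ/M × ℤ/n` defined by two weight functions. -/
def shear {M : ℕ} (h : Q → ℤ) (P : Q → ZMod M → ℤ) (n : ℕ) :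
    Equiv.Perm (Q × ZMod M × ZMod n) where
  toFun x := (x.1, x.2.1 + h x.1, x.2.2 + P x.1 x.2.1)
  invFun x := (x.1, x.2.1 - h x.1, x.2.2 - P x.1 (x.2.1 - h x.1))
  left_inv x := by simp
  right_inv x := by simp

/-- The action of the free product on `Q × ℤ/M × ℤ/n` in which the first factor acts by
translation through `π`, and the second one by translation conjugated by a shear. -/
def twist {M : ℕ} (π : A ∗ B →* Q) (h : Q → ℤ) (P : Q → ZMod M → ℤ) (n : ℕ) :
    A ∗ B →* Equiv.Perm (Q × ZMod M × ZMod n) :=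
  Monoid.Coprod.lift ((translation Q _).comp (π.comp Monoid.Coprod.inl))
    ((MulAut.conj (shear h P n)⁻¹).toMonoidHom.comp ((translation Q _).comp (π.comp Monoid.Coprod.inr)))

variable {M : ℕ} (π : A ∗ B →* Q) (h : Q → ℤ) (P : Q → ZMod M → ℤ) (n : ℕ)

lemma twist_inl_apply (a : A) (x : Q × ZMod M × ZMod n) :
    twist π h P n (.inl a) x = (π (.inl a) * x.1, x.2) := by
  simp [twist]

lemma twist_inr_apply (b : B) (x : Q × ZMod M × ZMod n) :
    twist π h P n (.inr b) x = (π (.inr b) * x.1, x.2.1 + h x.1 - h (π (.inr b) * x.1),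
      x.2.2 + P x.1 x.2.1 -
        P (π (.inr b) * x.1) (x.2.1 + h x.1 - h (π (.inr b) * x.1))) := by
  simp only [twist, Monoid.Coprod.lift_apply_inr]
  rfl

lemma orderOf_twist_inl (a : A) : orderOf (twist π h P n (.inl a)) = orderOf (π (.inl a)) := by
  rw [← orderOf_injective _ (translation_injective (ZMod M × ZMod n)) (π (.inl a))]
  simp [twist]

lemma orderOf_twist_inr (b : B) : orderOf (twist π h P n (.inr b)) = orderOf (π (.inr b)) := by
  rw [← orderOf_injective _ (translation_injective (ZMod M × ZMod n)) (π (.inr b)),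
    ← MulEquiv.orderOf_eq (MulAut.conj (shear h P n)⁻¹) (translation Q _ _)]
  simp only [twist, Monoid.Coprod.lift_apply_inr]
  rfl

variable {P} in
/-- The twisted action is a two-step extension by cocycles that do not depend on `n`. -/
lemma exists_twist_apply [NeZero M] (hP : ∀ ω, ∑ c, P ω c = 0) (g : A ∗ B) :
    ∃ (H : Q → ZMod M) (F : Q → ZMod M → ℤ), (∀ ω, ∑ c, F ω c = 0) ∧
      ∀ n ω c k, twist π h P n g (ω, c, k) = (π g * ω, c + H ω, k + F ω c) := by
  have hshift : ∀ (f : ZMod M → ℤ) d, ∑ c, f (c + d) = ∑ c, f c := fun f d ↦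
    Equiv.sum_comp (Equiv.addRight d) f
  induction g using Monoid.Coprod.induction_on with
  | inl a => exact ⟨0, 0, by simp, by simp [twist_inl_apply]⟩
  | inr b =>
    refine ⟨fun ω ↦ h ω - h (π (.inr b) * ω), fun ω c ↦ P ω c - P (π (.inr b) * ω)
      (c + (h ω - h (π (.inr b) * ω))), fun ω ↦ ?_, fun n ω c k ↦ ?_⟩
    · rw [Finset.sum_sub_distrib, hshift, hP, hP, sub_zero]
    · simp [twist_inr_apply, add_sub_assoc]
  | mul x y hx hy =>
    obtain ⟨H, F, hF, hx⟩ := hx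
    obtain ⟨H', F', hF', hy⟩ := hy
    refine ⟨fun ω ↦ H' ω + H (π y * ω), fun ω c ↦ F' ω c + F (π y * ω) (c + H' ω),
      fun ω ↦ ?_, fun n ω c k ↦ ?_⟩
    · rw [Finset.sum_add_distrib, hshift, hF, hF', add_zero]
    · simp [hx, hy, mul_assoc, add_assoc]

lemma twist_apply_fst (g : A ∗ B) (x : Q × ZMod M × ZMod n) :
    (twist π h P n g x).1 = π g * x.1 := by
  induction g using Monoid.Coprod.induction_on generalizing x with
  | inl a => simp [twist_inl_apply]
  | inr b => simp [twist_inr_apply]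
  | mul y z hy hz => simp [hy, hz, mul_assoc]

lemma twist_even_apply_snd_fst (V : CyclicWord A B) (m : ℕ) (x : Q × ZMod M × ZMod n) :
    (twist π h P n (V.even m) x).2.1 = x.2.1 +
      ((∑ i ∈ Finset.range m, (h (π (V.even i) * x.1) - h (π (V.odd i) * x.1)) : ℤ) : ZMod M) := by
  induction m with
  | zero => simp
  | succ m ih =>
    rw [Finset.sum_range_succ, V.even_succ, CyclicWord.odd]
    simp only [map_mul, Equiv.Perm.mul_apply, twist_inl_apply, twist_inr_apply, ih,
      twist_apply_fst]
    push_cast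
    simp only [mul_assoc]
    ring

lemma twist_even_apply_snd_snd (U : CyclicWord A B) (hU : ∀ y ∈ U.axis π, h y = 0) (m : ℕ)
    (k : ZMod n) :
    (twist π h P n (U.even m) (1, 0, k)).2.2 = k +
      ((∑ i ∈ Finset.range m, (P (π (U.even i)) 0 - P (π (U.odd i)) 0) : ℤ) : ZMod n) := by
  have hev : ∀ i, h (π (U.even i)) = 0 := fun i ↦ hU _ ⟨i, Or.inl rfl⟩
  have hod : ∀ i, h (π (U.odd i)) = 0 := fun i ↦ hU _ ⟨i, Or.inr rfl⟩
  have hstep : ∀ i : ℕ, π (.inr (U.b i)) * π (U.even i) = π (U.odd i) := fun i ↦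
    (map_mul π _ _).symm
  induction m with
  | zero => simp
  | succ m ih =>
    have h1 : (twist π h P n (U.even m) (1, 0, k)).2.1 = 0 := by
      simp [twist_even_apply_snd_fst, hev, hod]
    rw [U.even_succ, CyclicWord.odd, Finset.sum_range_succ]
    simp only [map_mul (twist π h P n), Equiv.Perm.mul_apply, twist_inl_apply, twist_inr_apply,
      ih, twist_apply_fst, h1, mul_one, hstep, hev, hod]
    push_cast
    simp
    ring

lemma dvd_orderOf_twist (g : A ∗ B) : orderOf (π g) ∣ orderOf (twist π h P n g) := by
  rw [orderOf_dvd_iff_pow_eq_one, ← map_pow]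
  have := twist_apply_fst π h P n (g ^ orderOf (twist π h P n g)) (1, 0, 0)
  rw [map_pow, pow_orderOf_eq_one] at this
  simpa using this.symm

lemma sum_range_natCast_zmod {M : ℕ} [NeZero M] (f : ZMod M → ℤ) :
    ∑ i ∈ Finset.range M, f i = ∑ c, f c :=
  Finset.sum_nbij' (fun i ↦ (i : ZMod M)) (fun c ↦ c.val) (by simp)
    (by simp [ZMod.val_lt]) (fun i hi ↦ ZMod.val_cast_of_lt (Finset.mem_range.1 hi)) (by simp)
    (by simp)

variable {P} in
lemma orderOf_twist_of_forall_ne [Fact M.Prime] [Finite Q] (hP : ∀ ω, ∑ c, P ω c = 0)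
    {g : A ∗ B}
    (hg : ∀ ω, (twist π h P n (g ^ orderOf (π g)) (ω, 0, 0)).2.1 ≠ 0) :
    orderOf (twist π h P n g) = orderOf (π g) * M := by
  obtain ⟨H, F, hF, hHF⟩ := exists_twist_apply π h hP (g ^ orderOf (π g))
  have hH : ∀ ω, H ω ≠ 0 := fun ω ↦ by simpa only [hHF, zero_add] using hg ω
  have hpow : ∀ j : ℕ, ∀ ω c k, (twist π h P n (g ^ orderOf (π g)) ^ j) (ω, c, k) =
      (ω, c + j * H ω, k + ((∑ i ∈ Finset.range j, F ω (c + i * H ω) : ℤ) : ZMod n)) := by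
    intro j ω c k
    induction j with
    | zero => simp
    | succ j ih =>
      rw [pow_succ', Equiv.Perm.mul_apply, ih, hHF, map_pow, pow_orderOf_eq_one,
        Finset.sum_range_succ]
      push_cast
      simp only [one_mul, add_mul, add_assoc]
  have hord : orderOf (twist π h P n (g ^ orderOf (π g))) = M := by
    apply orderOf_eq_prime
    · ext1 ⟨ω, c, k⟩
      rw [hpow]
      have : ∑ i ∈ Finset.range M, F ω (c + i * H ω) = 0 := by
        rw [sum_range_natCast_zmod fun i ↦ F ω (c + i * H ω), ← hF ω]
        exact Equiv.sum_comp ((Equiv.mulRight₀ (H ω) (hH ω)).trans (Equiv.addLeft c)) (F ω)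
      simp [this]
    · intro h1
      apply hg 1
      rw [h1]
      rfl
  have hdvd := dvd_orderOf_twist π h P n g
  rw [map_pow, orderOf_pow_of_dvd (orderOf_pos _).ne' hdvd] at hord
  exact (Nat.mul_div_cancel' hdvd).symm.trans (congrArg _ hord)

variable {P} in
lemma exists_orderOf_twist_eq_mul [NeZero M] [Finite Q] (hP : ∀ ω, ∑ c, P ω c = 0)
    {g : A ∗ B} (hg : ∀ j : ℕ, 0 < j → (twist π h P 0 (g ^ j) (1, 0, 0)).2.2 ≠ 0) :
    ∃ L d : ℕ, 0 < L ∧ 0 < d ∧ ∀ m, 0 < m → orderOf (twist π h P (d * m) g) = L * m := by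
  classical
  have := Fintype.ofFinite Q
  have hL : 0 < orderOf (twist π h P 1 g) := orderOf_pos _
  set L := orderOf (twist π h P 1 g) with hLdef
  obtain ⟨H, F, -, hHF⟩ := exists_twist_apply π h hP (g ^ L)
  have htriv : ∀ ω c, π (g ^ L) * ω = ω ∧ c + H ω = c := by
    intro ω c
    have h1 := hHF 1 ω c 0
    rw [map_pow, pow_orderOf_eq_one, Equiv.Perm.one_apply, Prod.mk.injEq, Prod.mk.injEq] at h1
    exact ⟨h1.1.symm, h1.2.1.symm⟩
  have hF : F 1 0 ≠ 0 := by
    intro h0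
    apply hg L hL
    simp only [hHF, h0, Int.cast_zero, add_zero]
  have hpow : ∀ n (j : ℕ) ω c k,
      (twist π h P n (g ^ L) ^ j) (ω, c, k) = (ω, c, k + ((j * F ω c : ℤ) : ZMod n)) := by
    intro n j ω c k
    induction j with
    | zero => simp
    | succ j ih =>
      rw [pow_succ', Equiv.Perm.mul_apply, ih, hHF, (htriv ω c).1, (htriv ω c).2]
      push_cast
      rw [add_mul, one_mul, add_assoc]
  set d := Finset.univ.gcd fun p : Q × ZMod M ↦ (F p.1 p.2).natAbs with hd
  have hd0 : d ≠ 0 := by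
    intro h0
    have := Finset.gcd_eq_zero_iff.1 h0 (1, 0) (Finset.mem_univ _)
    exact hF (Int.natAbs_eq_zero.1 this)
  refine ⟨L, d, hL, Nat.pos_of_ne_zero hd0, fun m hm ↦ ?_⟩
  have : NeZero (d * m) := ⟨mul_ne_zero hd0 hm.ne'⟩
  have hdvd : L ∣ orderOf (twist π h P (d * m) g) := by
    obtain ⟨H', F', -, hHF'⟩ :=
      exists_twist_apply π h hP (g ^ orderOf (twist π h P (d * m) g))
    rw [hLdef, orderOf_dvd_iff_pow_eq_one, ← map_pow]
    ext1 ⟨ω, c, k⟩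
    have h1 := hHF' (d * m) ω c 0
    rw [map_pow, pow_orderOf_eq_one, Equiv.Perm.one_apply, Prod.mk.injEq, Prod.mk.injEq] at h1
    rw [hHF', ← h1.1, ← h1.2.1]
    exact congrArg (fun z ↦ (ω, c, z)) (Subsingleton.elim _ _)
  have hord : orderOf (twist π h P (d * m) (g ^ L)) = m := by
    refine Nat.dvd_right_iff_eq.1 fun j ↦ ?_
    rw [orderOf_dvd_iff_pow_eq_one, ← mul_dvd_mul_iff_left hd0, mul_comm d j]
    have : j * d = Finset.univ.gcd fun p : Q × ZMod M ↦ j * (F p.1 p.2).natAbs := by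
      rw [Finset.gcd_mul_left, normalize_eq]
    rw [this, Finset.dvd_gcd_iff]
    have key : ∀ ω c, d * m ∣ j * (F ω c).natAbs ↔ ((j * F ω c : ℤ) : ZMod (d * m)) = 0 := by
      intro ω c
      rw [ZMod.intCast_zmod_eq_zero_iff_dvd, Int.natCast_dvd, Int.natAbs_mul, Int.natAbs_natCast]
    constructor
    · intro h1 p _
      rw [key]
      have := hpow (d * m) j p.1 p.2 0
      rw [h1] at this
      simpa using this.symm
    · intro h1
      ext1 ⟨ω, c, k⟩
      rw [hpow, (key ω c).1 (h1 (ω, c) (Finset.mem_univ _))]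
      simp
  rw [map_pow, orderOf_pow_of_dvd hL.ne' hdvd] at hord
  exact (Nat.mul_div_cancel' hdvd).symm.trans (congrArg _ hord)

end Twist

section Orders

variable {A B : Type*} [Group A] [Group B] {Q : Type} [Group Q] [Finite Q] (π : A ∗ B →* Q)

/-- A weight function vanishing on `S` whose alternating sums along all translated axes of the
given words are nonzero. -/
lemma exists_weight_of_not_mem_axis {ι : Type*} [Finite ι] (S : Set Q) (W : ι → CyclicWord A B)
    (hW : ∀ i m k, π ((W i).even m) ≠ π ((W i).odd k))
    (hS : ∀ i ω, ∃ m : ℕ, π ((W i).even m) * ω ∉ S ∨ π ((W i).odd m) * ω ∉ S) :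
    ∃ h : Q → ℤ, (∀ y ∈ S, h y = 0) ∧
      ∀ i ω, ∑ m ∈ Finset.range (orderOf (π (W i).elt) * (W i).len),
        (h (π ((W i).even m) * ω) - h (π ((W i).odd m) * ω)) ≠ 0 := by
  classical
  have := Fintype.ofFinite Q
  let N : ι → ℕ := fun i ↦ orderOf (π (W i).elt) * (W i).len
  have hN : ∀ i, 0 < N i := fun i ↦ Nat.mul_pos (orderOf_pos _) (W i).len_pos
  have hmod : ∀ i m, π ((W i).even m) = π ((W i).even (m % N i)) ∧
      π ((W i).odd m) = π ((W i).odd (m % N i)) := by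
    intro i m
    obtain ⟨r, q, hr, rfl⟩ : ∃ r q, r = m % N i ∧ m = r + q * orderOf (π (W i).elt) * (W i).len :=
      ⟨_, m / N i, rfl, by rw [mul_assoc]; exact (Nat.mod_add_div' m (N i)).symm⟩
    have he : π ((W i).even (r + q * orderOf (π (W i).elt) * (W i).len)) = π ((W i).even r) := by
      rw [CyclicWord.even_add_len_mul, map_mul, map_pow, mul_comm q, pow_mul, pow_orderOf_eq_one,
        one_pow, mul_one]
    rw [← hr]
    refine ⟨he, ?_⟩
    rw [CyclicWord.odd, CyclicWord.odd, map_mul, he, map_mul]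
    simp
  let c : ι × Q → Q → ℤ := fun p y ↦ ∑ m ∈ Finset.range (N p.1),
    ((if π ((W p.1).even m) * p.2 = y then 1 else 0) -
      if π ((W p.1).odd m) * p.2 = y then 1 else 0)
  have hc : ∀ p, ∃ y, y ∉ S ∧ c p y ≠ 0 := by
    rintro ⟨i, ω⟩
    obtain ⟨m, hm⟩ := hS i ω
    have hlt : m % N i ∈ Finset.range (N i) := Finset.mem_range.2 (Nat.mod_lt _ (hN i))
    rw [(hmod i m).1, (hmod i m).2] at hm
    generalize m % N i = r at hm hlt
    rcases hm with hm | hm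
    · refine ⟨_, hm, ne_of_gt (Finset.sum_pos' (fun k _ ↦ ?_) ⟨r, hlt, ?_⟩)⟩
      · rw [if_neg (fun h ↦ hW i r k (mul_right_cancel h).symm), sub_zero]
        split_ifs <;> simp
      · rw [if_neg (fun h ↦ hW i r r (mul_right_cancel h).symm), if_pos rfl]
        simp
    · refine ⟨_, hm, ne_of_lt (Finset.sum_neg' (fun k _ ↦ ?_) ⟨r, hlt, ?_⟩)⟩
      · rw [if_neg (fun h ↦ hW i k r (mul_right_cancel h)), zero_sub]
        split_ifs <;> simp
      · rw [if_neg (fun h ↦ hW i r r (mul_right_cancel h)), if_pos rfl]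
        simp
  obtain ⟨h, hS, hh⟩ := exists_weight S c hc
  refine ⟨h, hS, fun i ω ↦ ?_⟩
  convert hh (i, ω) using 1
  simp only [c, Finset.sum_mul]
  rw [Finset.sum_comm]
  refine Finset.sum_congr rfl fun m _ ↦ ?_
  simp [sub_mul, Finset.sum_sub_distrib]

/-- Twisting a suitable finite quotient gives `U` all multiples of some order, without changing
the orders of elliptic elements, while those of the other words are multiplied by a constant. -/
lemma exists_orderOf_eq {ι : Type*} [Finite ι] (U : CyclicWord A B) (W : ι → CyclicWord A B)
    (hU : ∀ m k, π (U.even m) ≠ π (U.odd k))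
    (hW : ∀ i m k, π ((W i).even m) ≠ π ((W i).odd k))
    (hUW : ∀ i ω, ∃ m : ℕ, π ((W i).even m) * ω ∉ U.axis π ∨ π ((W i).odd m) * ω ∉ U.axis π) :
    ∃ (L M : ℕ), 0 < L ∧ 0 < M ∧ ∀ m : ℕ, 0 < m →
      ∃ (X : Type) (_ : Finite X) (φ : A ∗ B →* Equiv.Perm X), orderOf (φ U.elt) = L * m ∧
        (∀ i, orderOf (φ (W i).elt) = orderOf (π (W i).elt) * M) ∧
        (∀ a, orderOf (φ (.inl a)) = orderOf (π (.inl a))) ∧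
        ∀ b, orderOf (φ (.inr b)) = orderOf (π (.inr b)) := by
  classical
  have := Fintype.ofFinite Q
  have := Fintype.ofFinite ι
  obtain ⟨h, hax, hh⟩ := exists_weight_of_not_mem_axis π (U.axis π) W hW hUW
  let s : ι × Q → ℤ := fun p ↦ ∑ m ∈ Finset.range (orderOf (π (W p.1).elt) * (W p.1).len),
    (h (π ((W p.1).even m) * p.2) - h (π ((W p.1).odd m) * p.2))
  obtain ⟨M, hM, hMprime⟩ := Nat.exists_infinite_primes (∑ p, (s p).natAbs + 1)
  have : Fact M.Prime := ⟨hMprime⟩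
  have hs : ∀ p, (s p : ZMod M) ≠ 0 := by
    intro p hp
    rw [ZMod.intCast_zmod_eq_zero_iff_dvd, Int.natCast_dvd] at hp
    have h1 : 0 < (s p).natAbs := Int.natAbs_pos.2 (hh p.1 p.2)
    have h2 := Nat.le_of_dvd h1 hp
    have h3 := Finset.single_le_sum (f := fun p ↦ (s p).natAbs) (fun _ _ ↦ Nat.zero_le _)
      (Finset.mem_univ p)
    omega
  let P : Q → ZMod M → ℤ := fun ω c ↦
    if ω = 1 then (if c = 0 then 1 else 0) - if c = 1 then 1 else 0 else 0
  have hP : ∀ ω, ∑ c, P ω c = 0 := by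
    intro ω
    by_cases hω : ω = 1 <;> simp [P, hω]
  have hUpos : ∀ j : ℕ, 0 < j → (twist π h P 0 (U.elt ^ j) (1, 0, 0)).2.2 ≠ 0 := by
    intro j hj h0
    rw [← U.even_len_mul, twist_even_apply_snd_snd π h P 0 U hax, zero_add] at h0
    refine (Finset.sum_pos' (s := Finset.range (j * U.len)) (fun i _ ↦ ?_) ⟨0, ?_, ?_⟩).ne'
      (Int.cast_injective (α := ZMod 0) (h0.trans Int.cast_zero.symm))
    · have : π (U.odd i) ≠ 1 := fun h1 ↦ hU 0 i (by simp [h1])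
      simp only [P, this, if_false, if_true]
      split_ifs <;> simp_all
    · exact Finset.mem_range.2 (Nat.mul_pos hj U.len_pos)
    · have : π (U.odd 0) ≠ 1 := fun h1 ↦ hU 0 0 (by simp [h1])
      simp [P, this]
  obtain ⟨L, d, hL, hd, hLd⟩ := exists_orderOf_twist_eq_mul π h hP hUpos
  refine ⟨L, M, hL, hMprime.pos, fun m hm ↦ ?_⟩
  have : NeZero (d * m) := ⟨(Nat.mul_pos hd hm).ne'⟩
  refine ⟨Q × ZMod M × ZMod (d * m), inferInstance, twist π h P (d * m), hLd m hm, fun i ↦ ?_,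
    orderOf_twist_inl π h P _, orderOf_twist_inr π h P _⟩
  refine orderOf_twist_of_forall_ne π h _ hP fun ω ↦ ?_
  rw [← (W i).even_len_mul, twist_even_apply_snd_fst, zero_add]
  exact hs (i, ω)

end Orders

lemma orderOf_map_conj {G H : Type*} [Group G] [Group H] (φ : G →* H) (g x : G) :
    orderOf (φ (g * x * g⁻¹)) = orderOf (φ x) := by
  rw [map_mul, map_mul, map_inv]
  exact (MulAut.conj (φ g)).orderOf_eq (φ x)

/-- Let `G = A ∗ B` be a free product of residually finite groups and
`u, v₁, …, vₙ ∈ G` with `u` in no conjugate of `A` or `B` and, for each `i`, `u` and `vᵢ`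
not lying in conjugate cyclic subgroups. Then there are positive integers `L, K₁, …, Kₙ`
such that for every positive integer `m` there is a surjection `φ` of `G` onto a finite
group with `orderOf (φ u) = L * m` and `orderOf (φ vᵢ) = Kᵢ` for all `i`. -/
theorem freeProduct_order_proposition
    {A B : Type*} [Group A] [Group B]
    (hA : ∀ a : A, a ≠ 1 → ∃ (F : Type) (_ : Group F) (_ : Finite F) (ψ : A →* F), ψ a ≠ 1)
    (hB : ∀ b : B, b ≠ 1 → ∃ (F : Type) (_ : Group F) (_ : Finite F) (ψ : B →* F), ψ b ≠ 1)
    (n : ℕ) (u : A ∗ B) (v : Fin n → A ∗ B)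
    (hu : ¬ ∃ g : A ∗ B,
        g * u * g⁻¹ ∈ (Monoid.Coprod.inl : A →* A ∗ B).range ∨
        g * u * g⁻¹ ∈ (Monoid.Coprod.inr : B →* A ∗ B).range)
    (hcyc : ∀ i, ¬ ∃ (g c : A ∗ B) (k l : ℤ), u = c ^ k ∧ g * v i * g⁻¹ = c ^ l) :
    ∃ (L : ℕ) (K : Fin n → ℕ), 0 < L ∧ (∀ i, 0 < K i) ∧
      ∀ m : ℕ, 0 < m →
        ∃ (H : Type) (_ : Group H) (_ : Finite H) (φ : A ∗ B →* H),
          Function.Surjective φ ∧ orderOf (φ u) = L * m ∧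
            ∀ i, orderOf (φ (v i)) = K i := by
  classical
  let ι := {i // ∃ (W : CyclicWord A B) (h : A ∗ B), h * v i * h⁻¹ = W.elt}
  obtain ⟨U, g, hg⟩ := (CyclicWord.exists_conj_eq_elt u).resolve_left hu
  choose W w hw using fun i : ι ↦ i.2
  have hUW : ∀ i, ¬ CyclicWord.ConjCyclic U.elt (W i).elt := by
    rintro i ⟨x, c, k, l, hk, hl⟩
    refine hcyc i ⟨g⁻¹ * x * w i, g⁻¹ * c * g, k, l, ?_, ?_⟩
    · have := conj_zpow (i := k) (a := g⁻¹) (b := c)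
      rw [inv_inv] at this
      rw [this, ← hk, ← hg]
      group
    · have := conj_zpow (i := l) (a := g⁻¹) (b := c)
      rw [inv_inv] at this
      rw [this, ← hl, ← hw]
      group
  obtain ⟨Q, _, _, π, h1, h2, h3⟩ := CyclicWord.exists_finite_quotient hA hB U W hUW
  obtain ⟨L, M, hL, hM, hφ⟩ := exists_orderOf_eq π U W h1 h2 h3
  refine ⟨L, fun i ↦ if ∃ (W : CyclicWord A B) (h : A ∗ B), h * v i * h⁻¹ = W.elt then
    orderOf (π (v i)) * M else orderOf (π (v i)), hL, fun i ↦ ?_, fun m hm ↦ ?_⟩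
  · dsimp only
    split_ifs
    exacts [Nat.mul_pos (orderOf_pos _) hM, orderOf_pos _]
  obtain ⟨X, _, φ, hu', hv, hinl, hinr⟩ := hφ m hm
  have hrange : ∀ x, orderOf (φ.rangeRestrict x) = orderOf (φ x) := fun x ↦
    (orderOf_injective φ.range.subtype Subtype.val_injective _).symm
  refine ⟨φ.range, inferInstance, inferInstance, φ.rangeRestrict, φ.rangeRestrict_surjective, ?_,
    fun i ↦ ?_⟩
  · rw [hrange, ← orderOf_map_conj φ g, hg, hu']
  · rw [hrange]
    dsimp only
    split_ifs with hi
    · rw [← orderOf_map_conj φ (w ⟨i, hi⟩), ← orderOf_map_conj π (w ⟨i, hi⟩), hw ⟨i, hi⟩, hv]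
    · obtain ⟨x, ⟨a, ha⟩ | ⟨b, hb⟩⟩ := (CyclicWord.exists_conj_eq_elt (v i)).resolve_right hi
      · rw [← orderOf_map_conj φ x, ← orderOf_map_conj π x, ← ha, hinl]
      · rw [← orderOf_map_conj φ x, ← orderOf_map_conj π x, ← hb, hinr]
end

section
/- Let G = A ∗ B be a free product of finite groups A and B, and let u, v₁, …, vₙ ∈ G be such that u does not lie in any conjugate of A or of B, and for each i the elements u and vᵢ do not lie in conjugate cyclic subgroups (i.e., there exist no g, c ∈ G and integers k, l with u = c^k and g·vᵢ·g⁻¹ = c^l). Then there exist positive integers L, K₁, …, Kₙ such that for every positive integer m there exists a finite group H and a surjective group homomorphism φ : G → H with the order of φ(u) equal to L·m and the order of φ(vᵢ) equal to Kᵢ for each i = 1, …, n. -/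
open scoped Monoid.Coprod

namespace FreeProductOrder

open Monoid

section Axis

variable {A B : Type*} [Group A] [Group B]

/-- The two free factors of `A ∗ B`, as subgroups. -/
def factor (A B : Type*) [Group A] [Group B] (i : Bool) : Subgroup (A ∗ B) :=
  if i then (Coprod.inl : A →* A ∗ B).range else (Coprod.inr : B →* A ∗ B).range

lemma inl_mem_factor (a : A) : (Coprod.inl a : A ∗ B) ∈ factor A B true := ⟨a, rfl⟩

lemma inr_mem_factor (b : B) : (Coprod.inr b : A ∗ B) ∈ factor A B false := ⟨b, rfl⟩

/-- A free product as an indexed free product of its factors. -/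
def toIndexed (A B : Type*) [Group A] [Group B] : A ∗ B →* CoprodI fun i => factor A B i :=
  Coprod.lift
    ((CoprodI.of (M := fun i => factor A B i) (i := true)).comp
      (Coprod.inl : A →* A ∗ B).rangeRestrict)
    ((CoprodI.of (M := fun i => factor A B i) (i := false)).comp
      (Coprod.inr : B →* A ∗ B).rangeRestrict)

lemma toIndexed_of_mem {i : Bool} {x : A ∗ B} (hx : x ∈ factor A B i) :
    toIndexed A B x = CoprodI.of (M := fun i => factor A B i) (i := i) ⟨x, hx⟩ := by
  cases i
  · obtain ⟨b, rfl⟩ := hx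
    exact Coprod.lift_apply_inr _ _ b
  · obtain ⟨a, rfl⟩ := hx
    exact Coprod.lift_apply_inl _ _ a

/-- `E` enumerates the edges along an axis of translation of `u` in the Bass–Serre tree of `A ∗ B`
(edges are identified with elements of the group), with translation length `2 * r`. -/
structure IsAxis (u : A ∗ B) (r : ℕ) (E : ℤ → A ∗ B) : Prop where
  pos : 0 < r
  zero : E 0 = 1
  add_period : ∀ n, E (n + 2 * r) = u * E n
  step_mem : ∀ n, (E n)⁻¹ * E (n + 1) ∈ factor A B (decide (Even n))
  step_ne : ∀ n, E (n + 1) ≠ E n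

namespace IsAxis

variable {u v : A ∗ B} {r s : ℕ} {E F : ℤ → A ∗ B}

lemma add_mul_period (h : IsAxis u r E) (n k : ℤ) : E (n + k * (2 * r)) = u ^ k * E n := by
  induction k with
  | zero => simp
  | succ k ih =>
    rw [add_mul, one_mul, ← add_assoc, h.add_period, ih, ← mul_assoc, ← zpow_one_add, add_comm]
  | pred k ih =>
    have := h.add_period (n + (-k - 1) * (2 * r))
    rw [show n + (-(k : ℤ) - 1) * (2 * r) + 2 * r = n + -k * (2 * r) by ring, ih] at this
    rw [eq_inv_mul_of_mul_eq this.symm, ← mul_assoc, zpow_sub_one, ← zpow_neg_one,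
      ← zpow_add, ← zpow_add, add_comm]

lemma mul_period (h : IsAxis u r E) (k : ℤ) : E (k * (2 * r)) = u ^ k := by
  simpa [h.zero] using h.add_mul_period 0 k

lemma eq_zpow_mul (h : IsAxis u r E) (n : ℤ) :
    E n = u ^ (n / (2 * r)) * E (n % (2 * r)) := by
  rw [← h.add_mul_period]
  congr 1
  linarith [Int.emod_add_mul_ediv n (2 * r)]

lemma emod_mem_Ico (h : IsAxis u r E) (n : ℤ) : n % (2 * r) ∈ Set.Ico (0 : ℤ) (2 * r) := by
  have := h.pos
  exact ⟨Int.emod_nonneg n (by omega), Int.emod_lt_of_pos n (by omega)⟩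

lemma exists_word (h : IsAxis u r E) (m : ℤ) (n : ℕ) :
    ∃ w : CoprodI.Word fun i => factor A B i, w.toList.length = n ∧
      w.prod = toIndexed A B ((E m)⁻¹ * E (m + n)) ∧
      (∀ l ∈ w.toList.head?, l.1 = decide (Even m)) := by
  induction n generalizing m with
  | zero => exact ⟨CoprodI.Word.empty, rfl, by simp, by simp [CoprodI.Word.empty]⟩
  | succ n ih =>
    obtain ⟨w, hw, hp, hh⟩ := ih (m + 1)
    have hne : (⟨(E m)⁻¹ * E (m + 1), h.step_mem m⟩ : factor A B (decide (Even m))) ≠ 1 := by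
      intro h1
      rw [Subtype.ext_iff] at h1
      exact h.step_ne m (inv_mul_eq_one.mp h1).symm
    have hidx : w.fstIdx ≠ some (decide (Even m)) := by
      rw [CoprodI.Word.fstIdx_ne_iff]
      intro l hl
      rw [hh l hl]
      simp [← Int.not_even_iff_odd]
    refine ⟨CoprodI.Word.cons _ w hidx hne, by simp [CoprodI.Word.cons, hw], ?_, ?_⟩
    · rw [CoprodI.Word.prod_cons, hp, ← toIndexed_of_mem, ← map_mul]
      congr 1
      push_cast
      rw [add_right_comm, ← add_assoc]
      group
    · simp [CoprodI.Word.cons]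

lemma length_le_one_of_mem (h : IsAxis u r E) {i : Bool} {m : ℤ} {n : ℕ}
    (hmem : (E m)⁻¹ * E (m + n) ∈ factor A B i) :
    n ≤ 1 ∧ (E (m + n) = E m → n = 0) := by
  classical
  obtain ⟨w, hw, hp, -⟩ := h.exists_word m n
  by_cases h1 : (E m)⁻¹ * E (m + n) = 1
  · have : w = CoprodI.Word.empty := CoprodI.Word.equiv.symm.injective
      (by change w.prod = CoprodI.Word.prod _; rw [hp, h1]; simp)
    subst this
    have : n = 0 := by simpa using hw.symm
    omega
  · have hne : (⟨_, hmem⟩ : factor A B i) ≠ 1 := fun h2 => h1 (congrArg Subtype.val h2)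
    have : w = CoprodI.Word.cons _ CoprodI.Word.empty (by simp [CoprodI.Word.fstIdx]) hne :=
      CoprodI.Word.equiv.symm.injective (by
        change w.prod = CoprodI.Word.prod _
        rw [hp, toIndexed_of_mem hmem, CoprodI.Word.prod_cons]; simp)
    subst this
    refine ⟨by simp [CoprodI.Word.cons] at hw; omega, fun h2 => (h1 ?_).elim⟩
    rw [h2, inv_mul_cancel]

lemma injective (h : IsAxis u r E) : Function.Injective E := by
  have key : ∀ (m : ℤ) (n : ℕ), E (m + n) = E m → n = 0 := fun m n hmn =>
    (h.length_le_one_of_mem (i := true) (by rw [hmn, inv_mul_cancel]; exact one_mem _)).2 hmn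
  intro a b hab
  rcases le_total a b with hle | hle
  · obtain ⟨n, rfl⟩ := Int.le.dest hle
    simp [key a n hab.symm]
  · obtain ⟨n, rfl⟩ := Int.le.dest hle
    simp [key b n hab]

lemma abs_sub_le_one_of_mem (h : IsAxis u r E) {i : Bool} {a b : ℤ}
    (hmem : (E a)⁻¹ * E b ∈ factor A B i) : |b - a| ≤ 1 := by
  rcases le_total a b with hle | hle
  · obtain ⟨n, rfl⟩ := Int.le.dest hle
    have := (h.length_le_one_of_mem hmem).1
    simpa using this
  · obtain ⟨n, rfl⟩ := Int.le.dest hle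
    have := (h.length_le_one_of_mem (i := i) (m := b) (n := n) (by simpa using inv_mem hmem)).1
    simpa using this

/-- Two hyperbolic elements sharing an axis lie in a common cyclic group. -/
lemma exists_common_root (h : IsAxis u r E) {g : A ∗ B} {ε j : ℤ} (hε : |ε| = 1)
    (hF : IsAxis v s F) (hj : ∀ n, g * F n = E (j + ε * n)) :
    ∃ (c : A ∗ B) (k l : ℤ), u = c ^ k ∧ g * v * g⁻¹ = c ^ l := by
  let D : AddSubgroup ℤ :=
    { carrier := {d | ∃ c, ∀ n, c * E n = E (n + d)}
      zero_mem' := ⟨1, by simp⟩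
      add_mem' := by
        rintro d d' ⟨c, hc⟩ ⟨c', hc'⟩
        exact ⟨c * c', fun n => by rw [mul_assoc, hc', hc, add_assoc, add_comm d']⟩
      neg_mem' := by
        rintro d ⟨c, hc⟩
        exact ⟨c⁻¹, fun n => by rw [inv_mul_eq_iff_eq_mul, hc]; simp⟩ }
  obtain ⟨d, hd⟩ := Int.subgroup_cyclic D
  obtain ⟨c, hc⟩ : d ∈ D := by rw [hd]; exact AddSubgroup.subset_closure rfl
  have hpow : ∀ k n : ℤ, c ^ k * E n = E (n + k * d) := by
    intro k n
    induction k generalizing n with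
    | zero => simp
    | succ k ih => rw [zpow_add_one, mul_assoc, hc, ih]; congr 1; ring
    | pred k ih =>
      rw [zpow_sub_one, mul_assoc,
        show c⁻¹ * E n = E (n - d) by rw [inv_mul_eq_iff_eq_mul, hc]; simp, ih]
      congr 1; ring
  have key : ∀ (x : A ∗ B) (e : ℤ), (∀ n, x * E n = E (n + e)) → ∃ k : ℤ, x = c ^ k := by
    intro x e hx
    have he : e ∈ D := ⟨x, hx⟩
    rw [hd, AddSubgroup.mem_closure_singleton] at he
    obtain ⟨k, rfl⟩ := he
    refine ⟨k, mul_right_cancel (b := E 0) ?_⟩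
    rw [hx, hpow, smul_eq_mul]
  obtain ⟨k, hk⟩ := key u (2 * r) fun n => (h.add_period n).symm
  obtain ⟨l, hl⟩ := key (g * v * g⁻¹) (ε * (2 * s)) fun n => by
    have hεε : ε * ε = 1 := by rw [← abs_mul_abs_self, hε, one_mul]
    have h1 := hj (ε * (n - j))
    rw [← mul_assoc, hεε, one_mul, add_sub_cancel] at h1
    rw [← h1, show g * v * g⁻¹ * (g * F (ε * (n - j))) = g * (v * F (ε * (n - j))) by group,
      ← hF.add_period, hj]
    congr 1
    linear_combination (n - j) * hεε
  exact ⟨c, k, l, hk, hl⟩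

lemma exists_common_root_of_subset (h : IsAxis u r E) (hF : IsAxis v s F) {g : A ∗ B}
    (hsub : ∀ n, ∃ m, g * F n = E m) :
    ∃ (c : A ∗ B) (k l : ℤ), u = c ^ k ∧ g * v * g⁻¹ = c ^ l := by
  choose j hj using hsub
  have hinj : Function.Injective j := fun a b hab =>
    hF.injective (mul_left_cancel (a := g) (by rw [hj, hj, hab]))
  have hstep : ∀ n, |j (n + 1) - j n| = 1 := by
    intro n
    have h1 : |j (n + 1) - j n| ≤ 1 := h.abs_sub_le_one_of_mem (i := decide (Even n)) (by
      rw [← hj, ← hj, show (g * F n)⁻¹ * (g * F (n + 1)) = (F n)⁻¹ * F (n + 1) by group]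
      exact hF.step_mem n)
    have h2 : j (n + 1) ≠ j n := fun h => by simpa using hinj h
    have := abs_pos.mpr (sub_ne_zero.mpr h2)
    omega
  have hsame : ∀ n, j (n + 1 + 1) - j (n + 1) = j (n + 1) - j n := by
    intro n
    have h1 := hstep n
    have h2 := hstep (n + 1)
    have h3 : j (n + 1 + 1) ≠ j n := fun h => by have := hinj h; omega
    grind
  have hconst : ∀ n, j (n + 1) - j n = j 1 - j 0 := by
    intro n
    induction n with
    | zero => simp
    | succ n ih => rw [hsame, ih]
    | pred n ih => rw [← ih, ← hsame]; simp
  refine h.exists_common_root (hε := by simpa using hstep 0) hF (ε := j 1 - j 0) (j := j 0) ?_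
  intro n
  rw [hj]
  congr 1
  induction n with
  | zero => simp
  | succ n ih => linear_combination ih + hconst n
  | pred n ih =>
    have := hconst (-n - 1)
    rw [sub_add_cancel] at this
    linear_combination ih - this

end IsAxis

/-- The product of a list of letters taken from the two factors. -/
def letterProd (l : List (Σ i, factor A B i)) : A ∗ B := (l.map fun x => (x.2 : A ∗ B)).prod

@[simp] lemma letterProd_cons (x : Σ i, factor A B i) (l : List (Σ i, factor A B i)) :
    letterProd (x :: l) = x.2 * letterProd l := by simp [letterProd]

@[simp] lemma letterProd_nil : letterProd ([] : List (Σ i, factor A B i)) = 1 := rfl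

@[simp] lemma letterProd_append (l l' : List (Σ i, factor A B i)) :
    letterProd (l ++ l') = letterProd l * letterProd l' := by simp [letterProd]

lemma exists_letterProd_eq (g : A ∗ B) : ∃ l, letterProd l = g := by
  induction g using Coprod.induction_on with
  | inl a => exact ⟨[⟨true, _, inl_mem_factor a⟩], by simp⟩
  | inr b => exact ⟨[⟨false, _, inr_mem_factor b⟩], by simp⟩
  | mul x y hx hy =>
    obtain ⟨l, rfl⟩ := hx
    obtain ⟨l', rfl⟩ := hy
    exact ⟨l ++ l', by simp⟩

lemma isConj_letterProd_rotate (l : List (Σ i, factor A B i)) (k : ℕ) :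
    IsConj (letterProd l) (letterProd (l.rotate k)) := by
  induction k with
  | zero => rw [List.rotate_zero]
  | succ k ih =>
    refine ih.trans ?_
    rw [← List.rotate_rotate]
    generalize l.rotate k = l'
    cases l' with
    | nil => simp
    | cons x t =>
      rw [isConj_iff]
      exact ⟨(x.2 : A ∗ B)⁻¹, by simp⟩

lemma isAxis_of_alternating (l : List (Σ i, factor A B i)) (r : ℕ) (hr : 0 < r)
    (hl : l.length = 2 * r) (hne : ∀ i (hi : i < l.length), (l[i].2 : A ∗ B) ≠ 1)
    (halt : ∀ i (hi : i < l.length), l[i].1 = decide (Even i)) :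
    IsAxis (letterProd l) r
      fun m => letterProd l ^ (m / (2 * r : ℤ)) * letterProd (l.take (m % (2 * r : ℤ)).toNat) := by
  have hr' : (0 : ℤ) < 2 * r := by positivity
  have hstep : ∀ m : ℤ, ∃ j : ℕ, ∃ hj : j < l.length, (j : ℤ) = m % (2 * r) ∧
      letterProd l ^ ((m + 1) / (2 * r : ℤ)) *
        letterProd (l.take ((m + 1) % (2 * r : ℤ)).toNat) =
      letterProd l ^ (m / (2 * r : ℤ)) *
        letterProd (l.take (m % (2 * r : ℤ)).toNat) * l[j].2 := by
    intro m
    have h0 := Int.emod_nonneg m hr'.ne'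
    have h1 := Int.emod_lt_of_pos m hr'
    obtain ⟨j, hj⟩ := Int.eq_ofNat_of_zero_le h0
    have hjl : j < l.length := by omega
    have htake : letterProd (l.take (j + 1)) = letterProd (l.take j) * l[j].2 := by
      rw [List.take_succ_eq_append_getElem hjl, letterProd_append, letterProd_cons,
        letterProd_nil, mul_one]
    refine ⟨j, hjl, hj.symm, ?_⟩
    have hm := Int.emod_add_mul_ediv m (2 * r)
    rw [hj] at hm ⊢
    rw [Int.toNat_natCast, mul_assoc, ← htake]
    rcases Nat.lt_or_ge (j + 1) (2 * r) with hlt | hge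
    · have h2 : (m + 1) / (2 * r : ℤ) = m / (2 * r) ∧ (m + 1) % (2 * r : ℤ) = (j + 1 : ℕ) := by
        rw [Int.ediv_emod_unique hr']
        refine ⟨by push_cast; linarith, by positivity, by exact_mod_cast hlt⟩
      rw [h2.1, h2.2, Int.toNat_natCast]
    · have hje : j + 1 = 2 * r := by omega
      have h2 : (m + 1) / (2 * r : ℤ) = m / (2 * r) + 1 ∧ (m + 1) % (2 * r : ℤ) = 0 := by
        rw [Int.ediv_emod_unique hr']
        refine ⟨?_, le_rfl, hr'⟩
        have : (j : ℤ) + 1 = 2 * r := by exact_mod_cast hje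
        linear_combination hm - this
      rw [h2.1, h2.2, hje, ← hl, List.take_length]
      simp [zpow_add_one]
  have hpar : ∀ (m : ℤ) (j : ℕ), (j : ℤ) = m % (2 * r) → (Even j ↔ Even m) := by
    intro m j hj
    have hm := Int.emod_add_mul_ediv m (2 * r)
    rw [← Int.even_coe_nat, ← hm, ← hj, Int.even_add]
    simp [mul_assoc]
  refine ⟨hr, by simp, fun n => ?_, fun n => ?_, fun n => ?_⟩
  ·     rw [Int.add_emod_right, Int.add_ediv_of_dvd_right dvd_rfl, Int.ediv_self hr'.ne',
      add_comm, zpow_one_add, mul_assoc]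
  · obtain ⟨j, hj, hjn, he⟩ := hstep n
    rw [he, inv_mul_cancel_left]
    rw [← decide_eq_decide.mpr (hpar n j hjn), ← halt j hj]
    exact l[j].2.2
  · obtain ⟨j, hj, hjn, he⟩ := hstep n
    rw [he, Ne, mul_eq_left]
    exact hne j hj

/-- Every element of `A ∗ B` is conjugate into a factor or is conjugate to an element with an
axis through the base edge. -/
lemma elliptic_or_exists_isAxis (g : A ∗ B) :
    (∃ c i, c * g * c⁻¹ ∈ factor A B i) ∨ ∃ c r E, IsAxis (c * g * c⁻¹) r E := by
  classical
  have hex : ∃ n, ∃ l : List (Σ i, factor A B i), l.length = n ∧ IsConj g (letterProd l) := by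
    obtain ⟨l, hl⟩ := exists_letterProd_eq g
    exact ⟨_, l, rfl, by rw [hl]⟩
  obtain ⟨l, hlen, hconj⟩ := Nat.find_spec hex
  have hmin : ∀ l' : List (Σ i, factor A B i), IsConj g (letterProd l') →
      l.length ≤ l'.length := fun l' h => by
    rw [hlen]; exact Nat.find_min' hex ⟨l', rfl, h⟩
  clear hlen
  rcases Nat.lt_or_ge l.length 2 with hlt | hge
  · left
    obtain ⟨c, hc⟩ := isConj_iff.mp hconj
    match l, hlt with
    | [], _ => exact ⟨c, true, by rw [hc]; exact one_mem _⟩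
    | [x], _ => exact ⟨c, x.1, by rw [hc]; simp⟩
  right
  have hred : ∀ k (x y : Σ i, factor A B i) t, l.rotate k = x :: y :: t →
      (x.2 : A ∗ B) ≠ 1 ∧ x.1 ≠ y.1 := by
    intro k x y t hk
    have hc := hconj.trans (isConj_letterProd_rotate l k)
    have hle : l.length = t.length + 2 := by
      rw [← List.length_rotate (l := l) (n := k), hk]; rfl
    rw [hk] at hc
    constructor
    · intro h1
      have := hmin (y :: t) (by simpa [h1] using hc)
      simp at this; omega
    · obtain ⟨i, x, hx⟩ := x
      obtain ⟨j, y, hy⟩ := y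
      rintro rfl
      have := hmin (⟨i, x * y, mul_mem hx hy⟩ :: t) (by simpa [mul_assoc] using hc)
      simp at this; omega
  have hpos : 0 < l.length := by omega
  set L : ℕ → Σ i, factor A B i := fun i => l[i % l.length]'(Nat.mod_lt _ hpos) with hL
  have hrot : ∀ k i (hi : i < (l.rotate k).length), (l.rotate k)[i] = L (i + k) := by
    intro k i hi
    rw [List.getElem_rotate]
  have hLred : ∀ i, ((L i).2 : A ∗ B) ≠ 1 ∧ (L i).1 ≠ (L (i + 1)).1 := by
    intro i
    have hlr : (l.rotate i).length = l.length := List.length_rotate ..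
    have h0 := hrot i 0 (by omega)
    have h1 := hrot i 1 (by omega)
    match hli : l.rotate i with
    | [] => rw [hli] at hlr; simp at hlr; omega
    | [x] => rw [hli] at hlr; simp at hlr; omega
    | x :: y :: t =>
      have := hred i x y t hli
      simp only [hli, List.getElem_cons_zero, List.getElem_cons_succ] at h0 h1
      rw [zero_add] at h0
      rw [add_comm] at h1
      rwa [← h0, ← h1]
  have hLalt : ∀ k, (L k).1 = true → ∀ i, (L (i + k)).1 = decide (Even i) := by
    intro k hk i
    induction i with
    | zero => simpa using hk
    | succ i ih =>
      have := (hLred (i + k)).2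
      rw [ih, add_right_comm] at this
      have h2 : decide (Even (i + 1)) = !decide (Even i) := by
        rw [← decide_not, decide_eq_decide, Nat.even_add_one]
      rw [h2]
      grind
  obtain ⟨k, hk⟩ : ∃ k, (L k).1 = true := by
    by_cases h0 : (L 0).1 = true
    · exact ⟨0, h0⟩
    · refine ⟨1, ?_⟩
      have := (hLred 0).2
      grind
  have heven : Even l.length := by
    have h1 := hLalt k hk l.length
    have h2 : L (l.length + k) = L k := by simp [hL]
    rw [h2, hk] at h1
    simpa using h1.symm
  obtain ⟨r, hr⟩ := heven
  obtain ⟨c, hc⟩ := isConj_iff.mp (hconj.trans (isConj_letterProd_rotate l k))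
  refine ⟨c, r, _, hc ▸ isAxis_of_alternating (l.rotate k) r (by omega)
    (by rw [List.length_rotate]; omega) ?_ ?_⟩
  · intro i hi
    rw [hrot]
    exact (hLred _).1
  · intro i hi
    rw [hrot]
    exact hLalt k hk i

end Axis

section Separability

/-- The action of a group on a set, made trivial outside an invariant subset. -/
noncomputable def truncate {Γ X : Type*} [Group Γ] (α : Γ →* Equiv.Perm X) (S : Set X)
    (hS : ∀ a x, α a x ∈ S ↔ x ∈ S) : Γ →* Equiv.Perm X := by
  classical
  exact
  { toFun := fun a => Equiv.Perm.ofSubtype ((α a).subtypePerm (hS a))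
    map_one' := by
      rw [← map_one (Equiv.Perm.ofSubtype (p := fun x => x ∈ S))]
      congr 1
      ext x
      simp
    map_mul' := fun a b => by
      rw [← map_mul (Equiv.Perm.ofSubtype (p := fun x => x ∈ S))]
      congr 1
      ext x
      simp only [Equiv.Perm.subtypePerm_apply, Equiv.Perm.mul_apply, map_mul] }

lemma truncate_of_mem {Γ X : Type*} [Group Γ] (α : Γ →* Equiv.Perm X) {S : Set X}
    (hS : ∀ a x, α a x ∈ S ↔ x ∈ S) (a : Γ) {x : X} (hx : x ∈ S) :
    truncate α S hS a x = α a x := by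
  classical
  exact Equiv.Perm.ofSubtype_apply_of_mem (p := fun x => x ∈ S) _ hx

lemma truncate_of_notMem {Γ X : Type*} [Group Γ] (α : Γ →* Equiv.Perm X) {S : Set X}
    (hS : ∀ a x, α a x ∈ S ↔ x ∈ S) (a : Γ) {x : X} (hx : x ∉ S) :
    truncate α S hS a x = x := by
  classical
  exact Equiv.Perm.ofSubtype_apply_of_not_mem (p := fun x => x ∈ S) _ hx

lemma exists_invariant_superset {Γ X : Type*} [Group Γ] [Finite Γ] (α : Γ →* Equiv.Perm X)
    {Y : Set X} (hY : Y.Finite) :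
    ∃ S : Set X, S.Finite ∧ Y ⊆ S ∧ ∀ a x, α a x ∈ S ↔ x ∈ S := by
  refine ⟨⋃ a, α a ⁻¹' Y, Set.finite_iUnion fun a => hY.preimage (α a).injective.injOn,
    fun x hx => Set.mem_iUnion.mpr ⟨1, by simpa using hx⟩, fun a x => ?_⟩
  simp only [Set.mem_iUnion, Set.mem_preimage]
  constructor
  · rintro ⟨b, hb⟩
    exact ⟨b * a, by simpa using hb⟩
  · rintro ⟨b, hb⟩
    exact ⟨b * a⁻¹, by simpa using hb⟩

variable {A B : Type*} [Group A] [Group B] [Finite A] [Finite B]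

/-- An action of a free product of finite groups agrees at given points with an action with finite
support. -/
lemma exists_finite_action {X : Type*} [MulAction (A ∗ B) X] {Z : Set ((A ∗ B) × X)}
    (hZ : Z.Finite) :
    ∃ (σ : A ∗ B →* Equiv.Perm X) (S : Set X), S.Finite ∧ (∀ z ∈ Z, z.2 ∈ S) ∧
      (∀ g, ∀ x ∈ S, σ g x ∈ S) ∧ ∀ z ∈ Z, σ z.1 z.2 = z.1 • z.2 := by
  let ρ := MulAction.toPermHom (A ∗ B) X
  have key : ∀ (g : A ∗ B) (x : X), ∃ T : Set X, T.Finite ∧ x ∈ T ∧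
      ∀ (SA SB : Set X) (hA : ∀ a x, ρ.comp Coprod.inl a x ∈ SA ↔ x ∈ SA)
        (hB : ∀ b x, ρ.comp Coprod.inr b x ∈ SB ↔ x ∈ SB), T ⊆ SA → T ⊆ SB →
        Coprod.lift (truncate _ SA hA) (truncate _ SB hB) g x = g • x := by
    intro g
    induction g using Coprod.induction_on with
    | inl a =>
      refine fun x => ⟨{x}, Set.finite_singleton x, rfl, fun SA SB hA hB h _ => ?_⟩
      rw [Coprod.lift_apply_inl, truncate_of_mem _ _ _ (h rfl)]
      rfl
    | inr b =>
      refine fun x => ⟨{x}, Set.finite_singleton x, rfl, fun SA SB hA hB _ h => ?_⟩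
      rw [Coprod.lift_apply_inr, truncate_of_mem _ _ _ (h rfl)]
      rfl
    | mul g g' hg hg' =>
      intro x
      obtain ⟨T', hT', hx', h'⟩ := hg' x
      obtain ⟨T, hT, hx, h⟩ := hg (g' • x)
      refine ⟨T' ∪ T, hT'.union hT, Or.inl hx', fun SA SB hA hB h1 h2 => ?_⟩
      rw [map_mul, Equiv.Perm.mul_apply,
        h' SA SB hA hB (Set.subset_union_left.trans h1) (Set.subset_union_left.trans h2),
        h SA SB hA hB (Set.subset_union_right.trans h1) (Set.subset_union_right.trans h2), mul_smul]
  choose T hT hxT hTσ using key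
  have hY : (⋃ z ∈ Z, T z.1 z.2).Finite := hZ.biUnion fun z _ => hT _ _
  obtain ⟨SA, hSA, hYA, hA⟩ := exists_invariant_superset (ρ.comp Coprod.inl) hY
  obtain ⟨SB, hSB, hYB, hB⟩ := exists_invariant_superset (ρ.comp Coprod.inr) hY
  have hsub : ∀ z ∈ Z, T z.1 z.2 ⊆ ⋃ z ∈ Z, T z.1 z.2 := fun z hz =>
    Set.subset_biUnion_of_mem (u := fun z : (A ∗ B) × X => T z.1 z.2) hz
  refine ⟨Coprod.lift (truncate _ SA hA) (truncate _ SB hB), SA ∪ SB, hSA.union hSB,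
    fun z hz => Or.inl (hYA (hsub z hz (hxT _ _))), fun g => ?_,
    fun z hz => hTσ _ _ _ _ hA hB ((hsub z hz).trans hYA) ((hsub z hz).trans hYB)⟩
  induction g using Coprod.induction_on with
  | inl a =>
    intro x hx
    rw [Coprod.lift_apply_inl]
    by_cases h : x ∈ SA
    · rw [truncate_of_mem _ _ _ h]
      exact Or.inl ((hA a x).mpr h)
    · rwa [truncate_of_notMem _ _ _ h]
  | inr b =>
    intro x hx
    rw [Coprod.lift_apply_inr]
    by_cases h : x ∈ SB
    · rw [truncate_of_mem _ _ _ h]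
      exact Or.inr ((hB b x).mpr h)
    · rwa [truncate_of_notMem _ _ _ h]
  | mul g g' hg hg' =>
    intro x hx
    rw [map_mul, Equiv.Perm.mul_apply]
    exact hg _ (hg' _ hx)

/-- Cyclic subgroups of a free product of finite groups are separable. -/
lemma exists_normal_separating {u s : A ∗ B} (hs : s ∉ Subgroup.zpowers u) :
    ∃ N : Subgroup (A ∗ B), N.Normal ∧ N.FiniteIndex ∧ ∀ k : ℤ, (u ^ k)⁻¹ * s ∉ N := by
  let y : (A ∗ B) ⧸ Subgroup.zpowers u := (1 : A ∗ B)
  obtain ⟨σ, S, hS, hyS, hSσ, hσ⟩ :=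
    exists_finite_action (Z := {(u, y), (s, y)}) (by simp)
  have hu : u • y = y := by
    change ((u * 1 : A ∗ B) : (A ∗ B) ⧸ Subgroup.zpowers u) = (1 : A ∗ B)
    rw [eq_comm, QuotientGroup.eq]
    simp
  have hs' : s • y ≠ y := by
    change ((s * 1 : A ∗ B) : (A ∗ B) ⧸ Subgroup.zpowers u) ≠ (1 : A ∗ B)
    rw [Ne, eq_comm, QuotientGroup.eq]
    simpa using hs
  let K : Subgroup (A ∗ B) := (MulAction.stabilizer (Equiv.Perm _) y).comap σ
  have huK : u ∈ K := by
    change σ u y = y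
    rw [hσ (u, y) (by simp), hu]
  have hsK : s ∉ K := by
    change ¬ σ s y = y
    rwa [hσ (s, y) (by simp)]
  have hK : K.FiniteIndex := by
    have : Finite S := hS
    have hinj : Function.Injective fun q : (A ∗ B) ⧸ K =>
        (Quotient.liftOn' q (fun g => (⟨σ g y, hSσ g y (hyS (u, y) (by simp))⟩ : S)) (by
          intro a b hab
          rw [QuotientGroup.leftRel_apply] at hab
          have : σ (a⁻¹ * b) y = y := hab
          rw [map_mul, map_inv, Equiv.Perm.mul_apply, Equiv.Perm.inv_eq_iff_eq] at this
          simp [this])) := by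
      intro a b hab
      induction a using QuotientGroup.induction_on
      induction b using QuotientGroup.induction_on
      rename_i a b
      rw [QuotientGroup.eq]
      change σ (a⁻¹ * b) y = y
      have h : σ a y = σ b y := congrArg Subtype.val hab
      rw [map_mul, map_inv, Equiv.Perm.mul_apply, ← h, Equiv.Perm.inv_eq_iff_eq]
    have := Finite.of_injective _ hinj
    exact Subgroup.finiteIndex_of_finite_quotient
  refine ⟨K.normalCore, inferInstance, inferInstance, fun k hk => hsK ?_⟩
  have := mul_mem (zpow_mem huK k) (K.normalCore_le hk)
  rwa [mul_inv_cancel_left] at this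

lemma exists_normal_of_finite {G ι : Type*} [Group G] {S : Set ι} (hS : S.Finite)
    {P : ι → Subgroup G → Prop} (hP : ∀ i, Antitone (P i))
    (h : ∀ i ∈ S, ∃ N : Subgroup G, N.Normal ∧ N.FiniteIndex ∧ P i N) :
    ∃ N : Subgroup G, N.Normal ∧ N.FiniteIndex ∧ ∀ i ∈ S, P i N := by
  choose! N hN hfi hPN using h
  have : Finite S := hS
  exact ⟨⨅ i : S, N i, Subgroup.normal_iInf_normal fun i => hN i i.2,
    Subgroup.finiteIndex_iInf fun i => hfi i i.2,
    fun i hi => hP i (iInf_le (fun i : S => N i) ⟨i, hi⟩) (hPN i hi)⟩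

namespace IsAxis

variable {u v : A ∗ B} {r s : ℕ} {E F : ℤ → A ∗ B}

/-- Modulo small enough normal subgroups, the axis of `u` embeds modulo its period. -/
lemma exists_normal_embedding (h : IsAxis u r E) :
    ∃ N : Subgroup (A ∗ B), N.Normal ∧ N.FiniteIndex ∧
      ∀ i j, (E j)⁻¹ * E i ∈ N → (2 * r : ℤ) ∣ i - j := by
  have hpos := h.pos
  obtain ⟨N, hN, hfi, hP⟩ := exists_normal_of_finite
    (S := {z : ℤ × ℤ | z.1 ∈ Set.Ico (0 : ℤ) (2 * r) ∧ z.2 ∈ Set.Ico (0 : ℤ) (2 * r) ∧ z.1 ≠ z.2})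
    (P := fun z N => ∀ k : ℤ, (u ^ k)⁻¹ * (E z.1 * (E z.2)⁻¹) ∉ N)
    (((Set.finite_Ico (0 : ℤ) (2 * r)).prod (Set.finite_Ico (0 : ℤ) (2 * r))).subset
      fun z hz => ⟨hz.1, hz.2.1⟩) (fun z N N' hle h k hk => h k (hle hk)) (by
    rintro ⟨i, j⟩ ⟨hi, hj, hij⟩
    refine FreeProductOrder.exists_normal_separating (u := u) (s := E i * (E j)⁻¹) ?_
    · 
      rintro ⟨k, hk⟩
      have h1 : E i = E (j + k * (2 * r)) := by
        rw [h.add_mul_period, ← mul_inv_eq_iff_eq_mul]; exact hk.symm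
      have h2 := h.injective h1
      apply hij
      change i = j
      change i ∈ _ at hi
      change j ∈ _ at hj
      rw [← Int.emod_eq_of_lt hi.1 hi.2, h2, Int.add_mul_emod_self_right,
        Int.emod_eq_of_lt hj.1 hj.2])
  refine ⟨N, hN, hfi, fun i j hij => ?_⟩
  by_contra hdvd
  have hne : i % (2 * r) ≠ j % (2 * r) := fun h => hdvd (Int.ModEq.dvd h.symm)
  have hconj : E i * (E j)⁻¹ ∈ N := by
    simpa using hN.conj_mem _ hij (E j)
  refine hP (i % (2 * r), j % (2 * r)) ⟨h.emod_mem_Ico i, h.emod_mem_Ico j, hne⟩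
    (j / (2 * r) - i / (2 * r)) ?_
  convert hN.conj_mem _ hconj (u ^ (-(j / (2 * r : ℤ)))) using 1
  rw [h.eq_zpow_mul i, h.eq_zpow_mul j]
  simp only [zpow_sub, zpow_neg]
  group

/-- Elements off the axis of `u` can be separated from it. -/
lemma exists_normal_separating (h : IsAxis u r E) {x : A ∗ B} (hx : ∀ m, E m ≠ x) :
    ∃ N : Subgroup (A ∗ B), N.Normal ∧ N.FiniteIndex ∧ ∀ m, (E m)⁻¹ * x ∉ N := by
  obtain ⟨N, hN, hfi, hP⟩ := exists_normal_of_finite (Set.finite_Ico (0 : ℤ) (2 * r))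
    (P := fun j N => ∀ k : ℤ, (E j)⁻¹ * (u ^ k)⁻¹ * x ∉ N)
    (fun j N N' hle h k hk => h k (hle hk)) (by
    intro j hj
    obtain ⟨N, hN, hfi, hP⟩ := FreeProductOrder.exists_normal_separating (u := u)
      (s := x * (E j)⁻¹) (by
      rintro ⟨k, hk⟩
      apply hx (j + k * (2 * r))
      rw [h.add_mul_period]
      exact mul_eq_of_eq_mul_inv hk)
    refine ⟨N, hN, hfi, fun k hk => hP k ?_⟩
    convert hN.conj_mem _ hk (E j) using 1
    group)
  refine ⟨N, hN, hfi, fun m hm => hP _ (h.emod_mem_Ico m) (m / (2 * r)) ?_⟩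
  rwa [h.eq_zpow_mul m, mul_inv_rev] at hm

/-- If no translate of the axis of `v` lies in the axis of `u`, then the same holds modulo
small enough normal subgroups. -/
lemma exists_normal_not_subset (h : IsAxis u r E) (hF : IsAxis v s F)
    (hsub : ∀ g, ∃ n, ∀ m, g * F n ≠ E m) :
    ∃ N : Subgroup (A ∗ B), N.Normal ∧ N.FiniteIndex ∧
      ∀ g, ∃ n, ∀ m, (E m)⁻¹ * (g * F n) ∉ N := by
  choose n hn using hsub
  obtain ⟨N, hN, hfi, hP⟩ := exists_normal_of_finite (Set.finite_Ico (0 : ℤ) (2 * r))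
    (P := fun j N => ∀ m, (E m)⁻¹ * (E j * F (n (E j))) ∉ N)
    (fun j N N' hle h k hk => h k (hle hk))
    (fun j _ => h.exists_normal_separating fun m => (hn (E j) m).symm)
  refine ⟨N, hN, hfi, fun g => ?_⟩
  by_contra! hg
  obtain ⟨i, hi⟩ := hg 0
  set y := (E i)⁻¹ * (g * F 0) with hy
  set j := i % (2 * r) with hj
  obtain ⟨m, hm⟩ := hg (n (E j))
  have hmem : (F (n (E j)))⁻¹ * y⁻¹ * F (n (E j)) ∈ N := by
    simpa using hN.conj_mem _ (inv_mem hi) (F (n (E j)))⁻¹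
  refine hP j (h.emod_mem_Ico i) (m + -(i / (2 * r)) * (2 * r)) ?_
  convert mul_mem hm hmem using 1
  rw [hy, h.eq_zpow_mul i, h.add_mul_period, hF.zero, zpow_neg, ← hj]
  group

end IsAxis

end Separability

section Potential

variable {A B R : Type*} [Group A] [Group B]

/-- The action on `G × R` that moves the first coordinate by right translation and records in the
second one the increments of `w` along the factor `B`. -/
def potentialAction [AddCommGroup R] (w : A ∗ B → R) : A ∗ B →* Equiv.Perm ((A ∗ B) × R) :=
  Coprod.lift
    { toFun := fun a =>
        { toFun := fun x => (x.1 * (Coprod.inl a)⁻¹, x.2)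
          invFun := fun x => (x.1 * Coprod.inl a, x.2)
          left_inv := fun x => by simp
          right_inv := fun x => by simp }
      map_one' := by ext x <;> simp
      map_mul' := fun a b => by ext x <;> simp [mul_assoc] }
    { toFun := fun b =>
        { toFun := fun x => (x.1 * (Coprod.inr b)⁻¹, x.2 + w (x.1 * (Coprod.inr b)⁻¹) - w x.1)
          invFun := fun x => (x.1 * Coprod.inr b, x.2 + w (x.1 * Coprod.inr b) - w x.1)
          left_inv := fun x => by ext <;> simp
          right_inv := fun x => by ext <;> simp }
      map_one' := by ext x <;> simp
      map_mul' := fun a b => by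
        ext x
        · simp [mul_assoc]
        · simp only [Equiv.Perm.mul_apply, Equiv.coe_fn_mk, map_mul, mul_inv_rev, mul_assoc]
          abel }

lemma potentialAction_fst [AddCommGroup R] (w : A ∗ B → R) (g : A ∗ B) (x : (A ∗ B) × R) :
    (potentialAction w g x).1 = x.1 * g⁻¹ := by
  induction g using Coprod.induction_on generalizing x with
  | inl a => rw [potentialAction, Coprod.lift_apply_inl]; rfl
  | inr b => rw [potentialAction, Coprod.lift_apply_inr]; rfl
  | mul g h hg hh => rw [map_mul, Equiv.Perm.mul_apply, hg, hh, mul_inv_rev, mul_assoc]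

/-- The function on `A ∗ B` that vanishes at `1`, is invariant under right translation by `A`, and
has the same increments as `w` under right translation by `B`. -/
def potential [AddCommGroup R] (w : A ∗ B → R) (g : A ∗ B) : R :=
  (potentialAction w g⁻¹ (1, 0)).2

lemma potentialAction_inv_one [AddCommGroup R] (w : A ∗ B → R) (g : A ∗ B) :
    potentialAction w g⁻¹ (1, 0) = (g, potential w g) :=
  Prod.ext (by rw [potentialAction_fst, one_mul, inv_inv]) rfl

@[simp] lemma potential_one [AddCommGroup R] (w : A ∗ B → R) : potential w 1 = 0 := by
  simp [potential]

@[simp] lemma potential_mul_inl [AddCommGroup R] (w : A ∗ B → R) (g : A ∗ B) (a : A) :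
    potential w (g * Coprod.inl a) = potential w g := by
  rw [potential, mul_inv_rev, map_mul, Equiv.Perm.mul_apply, potentialAction_inv_one, ← map_inv,
    potentialAction, Coprod.lift_apply_inl]
  rfl

lemma potential_mul_inr [AddCommGroup R] (w : A ∗ B → R) (g : A ∗ B) (b : B) :
    potential w (g * Coprod.inr b) = potential w g + w (g * Coprod.inr b) - w g := by
  rw [potential, mul_inv_rev, map_mul, Equiv.Perm.mul_apply, potentialAction_inv_one, ← map_inv,
    potentialAction, Coprod.lift_apply_inr]
  simp

lemma potential_mul [CommRing R] {w : A ∗ B → R} {h : A ∗ B} {μ : R}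
    (hw : ∀ x, w (h * x) = μ * w x) (x : A ∗ B) :
    potential w (h * x) = potential w h + μ * potential w x := by
  have key : ∀ x y : A ∗ B, potential w (h * y) = potential w h + μ * potential w y →
      potential w (h * (y * x)) = potential w h + μ * potential w (y * x) := by
    intro x
    induction x using Coprod.induction_on with
    | inl a =>
      intro y hy
      rw [← mul_assoc, potential_mul_inl, potential_mul_inl, hy]
    | inr b =>
      intro y hy
      rw [← mul_assoc, potential_mul_inr, potential_mul_inr, hy, mul_assoc h, hw, hw]
      ring
    | mul x x' hx hx' =>
      intro y hy
      rw [← mul_assoc y]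
      exact hx' _ (hx _ hy)
  simpa using key x 1 (by simp)

lemma IsAxis.potential_mul_sub [AddCommGroup R] {v : A ∗ B} {s : ℕ} {F : ℤ → A ∗ B}
    (hF : IsAxis v s F) (w : A ∗ B → R) (g : A ∗ B) (n : ℕ) :
    potential w (g * F (2 * n)) - potential w g =
      ∑ t ∈ Finset.range n, (w (g * F (2 * t + 2)) - w (g * F (2 * t + 1))) := by
  induction n with
  | zero => simp [hF.zero]
  | succ n ih =>
    rw [Finset.sum_range_succ, ← ih]
    have h0 := hF.step_mem (2 * n)
    have h1 := hF.step_mem (2 * n + 1)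
    have e0 : decide (Even (2 * (n : ℤ))) = true := by simp
    have e1 : decide (Even (2 * (n : ℤ) + 1)) = false := by simp
    rw [e0] at h0
    rw [e1] at h1
    obtain ⟨a, ha⟩ := h0
    obtain ⟨b, hb⟩ := h1
    have ha' : F (2 * n + 1) = F (2 * n) * Coprod.inl a := by rw [ha]; group
    have hb' : F (2 * n + 2) = F (2 * n + 1) * Coprod.inr b := by
      rw [hb, show (2 * n + 2 : ℤ) = 2 * n + 1 + 1 by ring]; group
    have hn : (2 * ((n + 1 : ℕ) : ℤ)) = 2 * n + 2 := by push_cast; ring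
    rw [hn, hb', ← mul_assoc, potential_mul_inr, mul_assoc, ← hb', ha', ← mul_assoc,
      potential_mul_inl]
    abel

end Potential

section Weights

lemma exists_forall_apply_ne_zero {X τ : Type*} [AddCommGroup X] [Finite τ] (D : τ → X →+ ℤ)
    (h : ∀ s, ∃ x, D s x ≠ 0) : ∃ x, ∀ s, D s x ≠ 0 := by
  classical
  have := Fintype.ofFinite τ
  suffices ∀ S : Finset τ, ∃ x, ∀ s ∈ S, D s x ≠ 0 by simpa using this Finset.univ
  intro S
  induction S using Finset.induction_on with
  | empty => exact ⟨0, by simp⟩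
  | insert a S _ ih =>
    obtain ⟨y, hy⟩ := ih
    obtain ⟨x, hx⟩ := h a
    by_cases hay : D a y = 0
    · set T : ℤ := 1 + ∑ s ∈ S, |D s x| with hT
      refine ⟨T • y + x, fun s hs => ?_⟩
      rw [map_add, map_zsmul, smul_eq_mul]
      rcases Finset.mem_insert.1 hs with rfl | hs
      · simpa [hay] using hx
      · intro h0
        have h1 : |D s x| < T := by
          have := Finset.single_le_sum (f := fun s => |D s x|) (fun i _ => abs_nonneg _) hs
          omega
        have h2 : D s x = 0 := Int.eq_zero_of_abs_lt_dvd
          (Dvd.intro (-D s y) (by linear_combination -h0)) h1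
        rw [h2, add_zero] at h0
        rcases mul_eq_zero.1 h0 with h3 | h3
        · have := abs_nonneg (D s x)
          omega
        · exact hy s hs h3
    · exact ⟨y, fun s hs => (Finset.mem_insert.1 hs).elim (fun e => e ▸ hay) (hy s)⟩

variable {A B : Type*} [Group A] [Group B]

/-- The alternating sum of a function on a quotient of `A ∗ B` along `n` double steps of a
translated axis. -/
def axisSum {N : Subgroup (A ∗ B)} [N.Normal] (F : ℤ → A ∗ B) (n : ℕ) (q : (A ∗ B) ⧸ N) :
    ((A ∗ B) ⧸ N → ℤ) →+ ℤ :=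
  ∑ t ∈ Finset.range n, (Pi.evalAddMonoidHom (fun _ => ℤ) (q * (F (2 * t + 2) : (A ∗ B) ⧸ N)) -
    Pi.evalAddMonoidHom (fun _ => ℤ) (q * (F (2 * t + 1) : (A ∗ B) ⧸ N)))

lemma axisSum_apply {N : Subgroup (A ∗ B)} [N.Normal] (F : ℤ → A ∗ B) (n : ℕ) (q : (A ∗ B) ⧸ N)
    (w : (A ∗ B) ⧸ N → ℤ) :
    axisSum F n q w = ∑ t ∈ Finset.range n, (w (q * (F (2 * t + 2) : (A ∗ B) ⧸ N)) -
      w (q * (F (2 * t + 1) : (A ∗ B) ⧸ N))) := by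
  simp [axisSum]

lemma IsAxis.axisSum_single_ne_zero {v : A ∗ B} {s : ℕ} {F : ℤ → A ∗ B} (hF : IsAxis v s F)
    {N : Subgroup (A ∗ B)} [N.Normal] [N.FiniteIndex] [DecidableEq ((A ∗ B) ⧸ N)]
    (hemb : ∀ i j, (F j)⁻¹ * F i ∈ N → (2 * s : ℤ) ∣ i - j) (q : (A ∗ B) ⧸ N) (n : ℤ) :
    axisSum F (s * orderOf (v : (A ∗ B) ⧸ N)) q
      (Pi.single (q * (F n : (A ∗ B) ⧸ N)) 1) ≠ 0 := by
  set K := orderOf (v : (A ∗ B) ⧸ N) with hK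
  have hK0 : 0 < K := orderOf_pos _
  have hs := hF.pos
  have hpar : ∀ i j, (F i : (A ∗ B) ⧸ N) = F j → i % 2 = j % 2 := fun i j hij => by
    have := (Dvd.intro _ rfl).trans (hemb j i (QuotientGroup.eq.1 hij))
    omega
  obtain ⟨j, hj, hjn⟩ : ∃ j : ℕ, j < 2 * (s * K) ∧ (F n : (A ∗ B) ⧸ N) = F (j + 1) := by
    have hpos : (0 : ℤ) < 2 * (s * K) := by positivity
    have hlt := Int.emod_lt_of_pos (n - 1) hpos
    have hnn := Int.emod_nonneg (n - 1) hpos.ne'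
    refine ⟨((n - 1) % (2 * (s * K))).toNat, by omega, ?_⟩
    have h1 : n = ((((n - 1) % (2 * (s * K))).toNat : ℤ) + 1) +
        (K * ((n - 1) / (2 * (s * K)))) * (2 * s) := by
      have := Int.emod_add_mul_ediv (n - 1) (2 * (s * K))
      rw [Int.toNat_of_nonneg hnn]
      linear_combination -this
    conv_lhs => rw [h1, hF.add_mul_period]
    rw [QuotientGroup.mk_mul, QuotientGroup.mk_zpow, zpow_mul, zpow_natCast, hK,
      pow_orderOf_eq_one, one_zpow, one_mul]
  rw [axisSum_apply, hjn]
  have hval : ∀ i : ℤ, (Pi.single (q * (F (j + 1) : (A ∗ B) ⧸ N)) 1 : (A ∗ B) ⧸ N → ℤ)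
      (q * (F i : (A ∗ B) ⧸ N)) = if (F i : (A ∗ B) ⧸ N) = F (j + 1) then 1 else 0 := fun i => by
    simp [Pi.single_apply]
  simp_rw [hval]
  have hjmem : j / 2 ∈ Finset.range (s * K) := Finset.mem_range.2 (by omega)
  rcases Nat.even_or_odd j with he | ho
  · have hj2 : 2 * (j / 2) = j := by have := Nat.even_iff.1 he; omega
    refine ne_of_lt (Finset.sum_neg' (fun t _ => ?_) ⟨j / 2, hjmem, ?_⟩)
    · rw [if_neg fun h => by have := hpar _ _ h; omega]
      split_ifs <;> simp
    · rw [if_neg fun h => by have := hpar _ _ h; omega, if_pos (by congr 2; omega)]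
      simp
  · have hj2 : 2 * (j / 2) + 1 = j := by have := Nat.odd_iff.1 ho; omega
    refine ne_of_gt (Finset.sum_pos' (fun t _ => ?_) ⟨j / 2, hjmem, ?_⟩)
    · rw [if_neg (c := (F (2 * t + 1) : (A ∗ B) ⧸ N) = _) fun h => by
        have := hpar _ _ h; omega]
      split_ifs <;> simp
    · rw [if_neg (c := (F (2 * (j / 2 : ℕ) + 1) : (A ∗ B) ⧸ N) = _) fun h => by
        have := hpar _ _ h; omega, if_pos (by congr 2; omega)]
      simp

lemma exists_weight {ι : Type*} [Finite ι] {E : ℤ → A ∗ B} {v : ι → A ∗ B} {s : ι → ℕ}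
    {F : ι → ℤ → A ∗ B} (hF : ∀ i, IsAxis (v i) (s i) (F i))
    (N : Subgroup (A ∗ B)) [N.Normal] [N.FiniteIndex]
    (hemb : ∀ l i j, (F l j)⁻¹ * F l i ∈ N → (2 * s l : ℤ) ∣ i - j)
    (hsub : ∀ l g, ∃ n, ∀ m, (E m)⁻¹ * (g * F l n) ∉ N) :
    ∃ w : (A ∗ B) ⧸ N → ℤ, (∀ m, w (E m) = 0) ∧
      ∀ l q, axisSum (F l) (s l * orderOf (v l : (A ∗ B) ⧸ N)) q w ≠ 0 := by
  classical
  let X : AddSubgroup ((A ∗ B) ⧸ N → ℤ) :=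
    { carrier := {w | ∀ m, w (E m) = 0}
      zero_mem' := fun m => rfl
      add_mem' := fun {w w'} h h' m => by simp [h m, h' m]
      neg_mem' := fun {w} h m => by simp [h m] }
  obtain ⟨w, hw⟩ := exists_forall_apply_ne_zero
    (fun z : ι × ((A ∗ B) ⧸ N) =>
      (axisSum (F z.1) (s z.1 * orderOf (v z.1 : (A ∗ B) ⧸ N)) z.2).comp X.subtype) (by
    rintro ⟨l, q⟩
    obtain ⟨g, rfl⟩ := QuotientGroup.mk_surjective q
    obtain ⟨n, hn⟩ := hsub l g
    refine ⟨⟨Pi.single ((g : (A ∗ B) ⧸ N) * (F l n : (A ∗ B) ⧸ N)) 1, fun m => ?_⟩,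
      (hF l).axisSum_single_ne_zero (hemb l) _ n⟩
    rw [Pi.single_apply, if_neg]
    rw [← QuotientGroup.mk_mul, QuotientGroup.eq]
    exact hn m)
  exact ⟨w, w.2, fun l q => hw (l, q)⟩

end Weights

section Twisted

variable {A B : Type*} [Group A] [Group B]

lemma IsAxis.potential_conj {v : A ∗ B} {s : ℕ} {F : ℤ → A ∗ B}
    (hF : IsAxis v s F) {N : Subgroup (A ∗ B)} [N.Normal] (w : (A ∗ B) ⧸ N → ℤ) (g : A ∗ B)
    (k : ℕ) (hI : ∀ x, potential (fun y => w y) (g * v ^ k * g⁻¹ * x) =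
      potential (fun y => w y) (g * v ^ k * g⁻¹) + potential (fun y => w y) x) :
    potential (fun y => w y) (g * v ^ k * g⁻¹) = axisSum F (s * k) g w := by
  have h1 := hI g
  rw [inv_mul_cancel_right] at h1
  have h2 := hF.potential_mul_sub (fun y => w y) g (s * k)
  rw [show (2 * ((s * k : ℕ) : ℤ)) = k * (2 * s) by push_cast; ring, hF.mul_period,
    zpow_natCast, h1, add_sub_cancel_right] at h2
  rw [h2, axisSum_apply]
  rfl

lemma exists_not_dvd {τ : Type*} [Finite τ] (D : τ → ℤ) (h : ∀ i, D i ≠ 0) :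
    ∃ P : ℕ, 0 < P ∧ ∀ i, ¬ (P : ℤ) ∣ D i := by
  have := Fintype.ofFinite τ
  refine ⟨1 + ∑ i, (D i).natAbs, by omega, fun i hi => h i (Int.eq_zero_of_abs_lt_dvd hi ?_)⟩
  have := Finset.single_le_sum (f := fun i => (D i).natAbs) (fun _ _ => Nat.zero_le _)
    (Finset.mem_univ i)
  rw [Int.abs_eq_natAbs]
  omega

lemma exists_additive_of_separated {u : A ∗ B} {r : ℕ} {E : ℤ → A ∗ B} (hE : IsAxis u r E)
    {ι : Type*} [Finite ι] {v : ι → A ∗ B} {s : ι → ℕ} {F : ι → ℤ → A ∗ B}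
    (hF : ∀ i, IsAxis (v i) (s i) (F i)) (N : Subgroup (A ∗ B)) [hN : N.Normal] [N.FiniteIndex]
    (hembE : ∀ i j, (E j)⁻¹ * E i ∈ N → (2 * r : ℤ) ∣ i - j)
    (hembF : ∀ l i j, (F l j)⁻¹ * F l i ∈ N → (2 * s l : ℤ) ∣ i - j)
    (hsub : ∀ l g, ∃ n, ∀ m, (E m)⁻¹ * (g * F l n) ∉ N) :
    ∃ (M : Subgroup (A ∗ B)) (I : A ∗ B → ℂ), M.Normal ∧ M.FiniteIndex ∧
      (∀ h ∈ M, ∀ x, I (h * x) = I h + I x) ∧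
      (∀ k : ℕ, 0 < k → u ^ k ∈ M → I (u ^ k) ≠ 0) ∧
      ∀ i g, ∀ k : ℕ, g * v i ^ k * g⁻¹ ∈ M → I (g * v i ^ k * g⁻¹) = 0 := by
  classical
  obtain ⟨w₁, hwE, hwF⟩ := exists_weight hF N hembF hsub
  obtain ⟨P, hP, hPD⟩ := exists_not_dvd (fun z : ι × ((A ∗ B) ⧸ N) =>
    axisSum (F z.1) (s z.1 * orderOf (v z.1 : (A ∗ B) ⧸ N)) z.2 w₁) fun z => hwF z.1 z.2
  have : NeZero P := ⟨hP.ne'⟩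
  set I₁ : A ∗ B → ℤ := potential fun y => w₁ y with hI₁
  have hadd₁ : ∀ h ∈ N, ∀ x, I₁ (h * x) = I₁ h + I₁ x := fun h hh x => by
    have := potential_mul (w := fun y : A ∗ B => w₁ y) (h := h) (μ := 1) (fun x => by
      rw [one_mul, QuotientGroup.mk_mul, (QuotientGroup.eq_one_iff h).2 hh, one_mul]) x
    rwa [one_mul] at this
  have hI₁E : ∀ n : ℕ, I₁ (E (2 * n)) = 0 := fun n => by
    have := hE.potential_mul_sub (fun y => w₁ y) 1 n
    simpa [hwE] using this
  let ζ : ℂ := Complex.exp (2 * Real.pi * Complex.I / P)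
  have hζ : IsPrimitiveRoot ζ P := Complex.isPrimitiveRoot_exp P hP.ne'
  have hζ0 : ζ ≠ 0 := Complex.exp_ne_zero _
  let w : A ∗ B → ℂ := fun x => if x ∈ N then ζ ^ I₁ x else 0
  let I : A ∗ B → ℂ := potential w
  have hI : ∀ h ∈ N, ∀ x, I (h * x) = I h + ζ ^ I₁ h * I x := fun h hh x => by
    refine potential_mul (fun x => ?_) x
    simp only [w, N.mul_mem_cancel_left hh, hadd₁ h hh x, zpow_add₀ hζ0, mul_ite, mul_zero]
  let χ : N →* Multiplicative (ZMod P) :=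
    { toFun := fun h => Multiplicative.ofAdd (I₁ h : ZMod P)
      map_one' := by simp [hI₁]
      map_mul' := fun h k => by
        rw [Subgroup.coe_mul, hadd₁ h h.2, Int.cast_add, ofAdd_add] }
  let M : Subgroup (A ∗ B) := (χ.ker.map N.subtype).normalCore
  have hMfin : (χ.ker.map N.subtype).FiniteIndex := ⟨by
    rw [Subgroup.index_map_subtype]
    exact mul_ne_zero Subgroup.FiniteIndex.index_ne_zero Subgroup.FiniteIndex.index_ne_zero⟩
  have hM : ∀ h ∈ M, h ∈ N ∧ ζ ^ I₁ h = 1 := fun h hh => by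
    obtain ⟨k, hk, rfl⟩ := Subgroup.normalCore_le _ hh
    have hk' : ((I₁ k : ℤ) : ZMod P) = 0 := hk
    exact ⟨k.2, (hζ.zpow_eq_one_iff_dvd _).2 ((ZMod.intCast_zmod_eq_zero_iff_dvd _ _).1 hk')⟩
  refine ⟨M, I, inferInstance, inferInstance, fun h hh x => ?_, fun k hk hkM => ?_,
    fun i g k hkM => ?_⟩
  · rw [hI h (hM h hh).1, (hM h hh).2, one_mul]
  · have hEk : E (2 * (r * k : ℕ)) = u ^ k := by
      rw [show (2 * ((r * k : ℕ) : ℤ)) = k * (2 * r) by push_cast; ring, hE.mul_period,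
        zpow_natCast]
    have h1 := hE.potential_mul_sub w 1 (r * k)
    have hodd : ∀ t : ℕ, w (E (2 * t + 1)) = 0 := fun t => if_neg fun h => by
      have := (Dvd.intro _ rfl).trans (hembE (2 * t + 1) 0 (by simpa [hE.zero] using h))
      omega
    have heven : ∀ t : ℕ, w (E (2 * t + 2)) = if E (2 * t + 2) ∈ N then 1 else 0 := fun t => by
      have := hI₁E (t + 1)
      rw [Nat.cast_add, Nat.cast_one, mul_add, mul_one] at this
      simp only [w, this, zpow_zero]
    simp only [one_mul, hEk, potential_one, sub_zero, hodd, heven, Finset.sum_boole] at h1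
    change potential w _ ≠ 0
    rw [h1, Nat.cast_ne_zero]
    have hrk : 0 < r * k := Nat.mul_pos hE.pos hk
    refine Finset.card_ne_zero_of_mem (a := r * k - 1) (Finset.mem_filter.2
      ⟨Finset.mem_range.2 (by omega), ?_⟩)
    rw [show (2 * ((r * k - 1 : ℕ) : ℤ) + 2) = 2 * (r * k : ℕ) by omega, hEk]
    exact (hM _ hkM).1
  · set K := orderOf (v i : (A ∗ B) ⧸ N) with hK
    obtain ⟨hkN, hk1⟩ := hM _ hkM
    obtain ⟨q, rfl⟩ : K ∣ k := by
      rw [hK, orderOf_dvd_iff_pow_eq_one, ← QuotientGroup.mk_pow, QuotientGroup.eq_one_iff]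
      simpa [mul_assoc] using hN.conj_mem _ hkN g⁻¹
    have hKN : g * v i ^ K * g⁻¹ ∈ N := hN.conj_mem _ (by
      rw [← QuotientGroup.eq_one_iff, QuotientGroup.mk_pow, hK, pow_orderOf_eq_one]) g
    set h₀ := g * v i ^ K * g⁻¹ with hh₀
    have hpow : g * v i ^ (K * q) * g⁻¹ = h₀ ^ q := by rw [hh₀, conj_pow, pow_mul]
    have hμ : ζ ^ I₁ h₀ ≠ 1 := fun h => hPD (i, g) (by
      have := (hF i).potential_conj w₁ g K fun x => hadd₁ _ hKN x
      rw [← hK]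
      dsimp only
      rw [← this]
      exact (hζ.zpow_eq_one_iff_dvd _).1 h)
    have hq₁ : ∀ q : ℕ, ζ ^ I₁ (h₀ ^ q) = (ζ ^ I₁ h₀) ^ q := fun q => by
      induction q with
      | zero => simp [hI₁]
      | succ q ih => rw [pow_succ', hadd₁ _ hKN, zpow_add₀ hζ0, ih, pow_succ']
    have hq : ∀ q : ℕ, (ζ ^ I₁ h₀ - 1) * I (h₀ ^ q) = ((ζ ^ I₁ h₀) ^ q - 1) * I h₀ := fun q => by
      induction q with
      | zero => simp [I]
      | succ q ih =>
        rw [pow_succ', hI _ hKN]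
        linear_combination ζ ^ I₁ h₀ * ih
    have := hq q
    rw [← hq₁, ← hpow, hk1, sub_self, zero_mul] at this
    exact (mul_eq_zero.1 this).resolve_left (sub_ne_zero.2 hμ)

variable [Finite A] [Finite B]

lemma exists_additive {u : A ∗ B} {r : ℕ} {E : ℤ → A ∗ B} (hE : IsAxis u r E)
    {ι : Type*} [Finite ι] {v : ι → A ∗ B} {s : ι → ℕ} {F : ι → ℤ → A ∗ B}
    (hF : ∀ i, IsAxis (v i) (s i) (F i)) (hsub : ∀ i g, ∃ n, ∀ m, g * F i n ≠ E m) :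
    ∃ (M : Subgroup (A ∗ B)) (I : A ∗ B → ℂ), M.Normal ∧ M.FiniteIndex ∧
      (∀ h ∈ M, ∀ x, I (h * x) = I h + I x) ∧
      (∀ k : ℕ, 0 < k → u ^ k ∈ M → I (u ^ k) ≠ 0) ∧
      ∀ i g, ∀ k : ℕ, g * v i ^ k * g⁻¹ ∈ M → I (g * v i ^ k * g⁻¹) = 0 := by
  obtain ⟨N₁, hN₁, hN₁f, h₁⟩ := hE.exists_normal_embedding
  obtain ⟨N₂, hN₂, hN₂f, h₂⟩ := exists_normal_of_finite (Set.finite_univ (α := ι))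
    (P := fun l N => ∀ i j, (F l j)⁻¹ * F l i ∈ N → (2 * s l : ℤ) ∣ i - j)
    (fun l N N' hle h i j hij => h i j (hle hij)) fun l _ => (hF l).exists_normal_embedding
  obtain ⟨N₃, hN₃, hN₃f, h₃⟩ := exists_normal_of_finite (Set.finite_univ (α := ι))
    (P := fun l N => ∀ g, ∃ n, ∀ m, (E m)⁻¹ * (g * F l n) ∉ N)
    (fun l N N' hle h g => (h g).imp fun n hn m hm => hn m (hle hm))
    fun l _ => hE.exists_normal_not_subset (hF l) (hsub l)
  exact exists_additive_of_separated hE hF (N₁ ⊓ (N₂ ⊓ N₃)) (fun i j h => h₁ i j h.1)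
    (fun l i j h => h₂ l (Set.mem_univ l) i j h.2.1)
    fun l g => (h₃ l (Set.mem_univ l) g).imp fun n hn m hm => hn m hm.2.2

end Twisted

section FiniteQuotients

variable {G : Type*} [Group G]

/-- The conjugates of a function that is additive on a normal subgroup `N`, as a homomorphism. -/
def conjHom {R : Type*} [AddCommGroup R] (N : Subgroup G) [hN : N.Normal] (I : G → R)
    (hI : ∀ h ∈ N, ∀ x, I (h * x) = I h + I x) : Additive N →+ (G → R) where
  toFun h g := I (g * h.toMul * g⁻¹)
  map_zero' := by
    ext g
    have := hI 1 N.one_mem 1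
    simp_all
  map_add' h k := by
    ext g
    have := hI _ (hN.conj_mem _ h.toMul.2 g) (g * k.toMul * g⁻¹)
    simpa [mul_assoc] using this

lemma exists_hom_of_additive [Group.FG G] {R : Type*} [AddCommGroup R] [IsAddTorsionFree R]
    (N : Subgroup G) [N.Normal] [N.FiniteIndex] (I : G → R)
    (hI : ∀ h ∈ N, ∀ x, I (h * x) = I h + I x) :
    ∃ (d : ℕ) (F : Additive N →+ (Fin d → ℤ)), Function.Surjective F ∧
      ∀ h : N, F (Additive.ofMul h) = 0 ↔ ∀ g : G, I (g * h * g⁻¹) = 0 := by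
  let Θ := conjHom N I hI
  have : Group.FG N := inferInstance
  have : AddGroup.FG (Additive N) := inferInstance
  have : AddGroup.FG Θ.range := inferInstance
  have : Module.Finite ℤ Θ.range := Module.Finite.iff_addGroup_fg.mpr this
  have : Module.Free ℤ Θ.range := Module.free_of_finite_type_torsion_free'
  let b := Module.finBasis ℤ Θ.range
  refine ⟨_, b.equivFun.toLinearMap.toAddMonoidHom.comp Θ.rangeRestrict,
    b.equivFun.surjective.comp Θ.rangeRestrict_surjective, fun h => ?_⟩
  have : (b.equivFun (Θ.rangeRestrict (Additive.ofMul h)) = 0) ↔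
      Θ (Additive.ofMul h) = 0 := by
    rw [LinearEquiv.map_eq_zero_iff, Subtype.ext_iff]
    rfl
  exact this.trans funext_iff

lemma orderOf_eq_of_pow_eq_one_iff {H : Type*} [Group H] {x : H} {k : ℕ}
    (h : ∀ t : ℕ, x ^ t = 1 ↔ k ∣ t) : orderOf x = k :=
  Nat.dvd_antisymm (orderOf_dvd_of_pow_eq_one ((h k).2 dvd_rfl))
    ((h _).1 (pow_orderOf_eq_one x))

lemma exists_orderOf_quotient [Group.FG G] {R : Type*} [AddCommGroup R] [IsAddTorsionFree R]
    {ι : Type*} (u : G) (v : ι → G) (N : Subgroup G) [hN : N.Normal] [N.FiniteIndex] (I : G → R)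
    (hI : ∀ h ∈ N, ∀ x, I (h * x) = I h + I x)
    (hu : ∀ k : ℕ, 0 < k → u ^ k ∈ N → I (u ^ k) ≠ 0)
    (hv : ∀ i g, ∀ k : ℕ, g * v i ^ k * g⁻¹ ∈ N → I (g * v i ^ k * g⁻¹) = 0) :
    ∃ (L : ℕ) (K : ι → ℕ), 0 < L ∧ (∀ i, 0 < K i) ∧
      ∀ m : ℕ, 0 < m →
        ∃ (H : Type) (_ : Group H) (_ : Finite H) (φ : G →* H),
          Function.Surjective φ ∧ orderOf (φ u) = L * m ∧ ∀ i, orderOf (φ (v i)) = K i := by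
  obtain ⟨r, F, hF, hF0⟩ := exists_hom_of_additive N I hI
  have hmem : ∀ (x : G) (t : ℕ), x ^ t ∈ N ↔ orderOf (x : G ⧸ N) ∣ t := fun x t => by
    rw [orderOf_dvd_iff_pow_eq_one, ← QuotientGroup.mk_pow, QuotientGroup.eq_one_iff]
  have hL : 0 < orderOf (u : G ⧸ N) := orderOf_pos _
  have huL : u ^ orderOf (u : G ⧸ N) ∈ N := (hmem _ _).2 dvd_rfl
  set y := F (Additive.ofMul ⟨u ^ orderOf (u : G ⧸ N), huL⟩) with hy
  have hy0 : y ≠ 0 := fun h => hu _ hL huL (by simpa using (hF0 _).1 h 1)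
  set d := Finset.univ.gcd y with hd
  have hd0 : d ≠ 0 := fun h => hy0 (funext fun i => Finset.gcd_eq_zero_iff.1 h i (Finset.mem_univ i))
  refine ⟨orderOf (u : G ⧸ N), fun i => orderOf (v i : G ⧸ N), hL, fun i => orderOf_pos _,
    fun m hm => ?_⟩
  have hc : d.natAbs * m ≠ 0 := mul_ne_zero (Int.natAbs_ne_zero.2 hd0) hm.ne'
  set c := d.natAbs * m with hcdef
  have : NeZero c := ⟨hc⟩
  let q : N →* Multiplicative (Fin r → ZMod c) :=
    AddMonoidHom.toMultiplicativeRight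
      (((Int.castAddHom (ZMod c)).compLeft (Fin r)).comp F)
  have hq : ∀ h : N, q h = 1 ↔ ∀ i, (c : ℤ) ∣ F (Additive.ofMul h) i := fun h => by
    have : q h = 1 ↔ (fun i => ((F (Additive.ofMul h) i : ℤ) : ZMod c)) = 0 := Iff.rfl
    rw [this, funext_iff]
    simp [ZMod.intCast_zmod_eq_zero_iff_dvd]
  let M : Subgroup G := q.ker.map N.subtype
  have hM : ∀ x, x ∈ M ↔ ∃ h : x ∈ N, ∀ i, (c : ℤ) ∣ F (Additive.ofMul ⟨x, h⟩) i := fun x => by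
    simp only [M, Subgroup.mem_map, MonoidHom.mem_ker, hq]
    constructor
    · rintro ⟨h, h1, rfl⟩
      exact ⟨h.2, h1⟩
    · rintro ⟨h, h1⟩
      exact ⟨⟨x, h⟩, h1, rfl⟩
  have hMfin : M.FiniteIndex := ⟨by
    rw [Subgroup.index_map_subtype]
    exact mul_ne_zero Subgroup.FiniteIndex.index_ne_zero Subgroup.FiniteIndex.index_ne_zero⟩
  have hMnormal : M.Normal := ⟨fun x hx g => by
    obtain ⟨hxN, hx⟩ := (hM x).1 hx
    choose z hz using hx
    obtain ⟨k, hk⟩ := hF z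
    have h1 : F (Additive.ofMul (⟨x, hxN⟩ * (k.toMul ^ c)⁻¹)) = 0 := by
      rw [ofMul_mul, ofMul_inv, ofMul_pow, map_add, map_neg, map_nsmul, ofMul_toMul, hk]
      ext i
      simp [hz]
    rw [hF0] at h1
    have h2 : F (Additive.ofMul (⟨g * x * g⁻¹, hN.conj_mem _ hxN g⟩ *
        (⟨g * k.toMul * g⁻¹, hN.conj_mem _ k.toMul.2 g⟩ ^ c)⁻¹)) = 0 := by
      rw [hF0]
      intro g'
      convert h1 (g' * g) using 2
      simp only [Subgroup.coe_mul, Subgroup.coe_inv, Subgroup.coe_pow, conj_pow]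
      group
    rw [ofMul_mul, ofMul_inv, ofMul_pow, map_add, map_neg, map_nsmul, ← sub_eq_add_neg,
      sub_eq_zero] at h2
    refine (hM _).2 ⟨hN.conj_mem _ hxN g, fun i => ?_⟩
    rw [h2]
    simp⟩
  have hord : ∀ (x : G) (k : ℕ), (∀ t : ℕ, x ^ t ∈ M ↔ k ∣ t) → orderOf (x : G ⧸ M) = k :=
    fun x k h => orderOf_eq_of_pow_eq_one_iff fun t => by
      rw [← h t, ← QuotientGroup.mk_pow, QuotientGroup.eq_one_iff]
  have hfin : Finite (G ⧸ M) := inferInstance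
  obtain ⟨H, hHg, hHf, ⟨e⟩⟩ := Finite.exists_type_univ_nonempty_mulEquiv (G ⧸ M)
  refine ⟨H, hHg, inferInstance, (e : G ⧸ M →* H).comp (QuotientGroup.mk' M),
    e.surjective.comp (QuotientGroup.mk'_surjective M), ?_, fun i => ?_⟩
  · refine (MulEquiv.orderOf_eq e _).trans (hord u _ fun t => ?_)
    rw [hM]
    constructor
    · rintro ⟨h, h1⟩
      obtain ⟨s, rfl⟩ := (hmem _ _).1 h
      refine mul_dvd_mul_left _ ?_
      have h2 : F (Additive.ofMul ⟨u ^ (orderOf (u : G ⧸ N) * s), h⟩) = s • y := by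
        rw [hy, ← map_nsmul, ← ofMul_pow]
        congr 2
        ext
        simp [pow_mul]
      have h3 : (c : ℤ) ∣ Finset.univ.gcd fun i => (s : ℤ) * y i :=
        Finset.dvd_gcd fun i _ => by simpa [h2] using h1 i
      rw [Finset.gcd_mul_left, ← hd, Int.normalize_coe_nat, ← Int.natAbs_dvd_natAbs,
        Int.natAbs_mul, Int.natAbs_natCast, Int.natAbs_natCast, hcdef, mul_comm s] at h3
      exact Nat.dvd_of_mul_dvd_mul_left (Int.natAbs_pos.2 hd0) h3
    · rintro ⟨s, rfl⟩
      have h : u ^ (orderOf (u : G ⧸ N) * m * s) ∈ N := (hmem _ _).2 ⟨m * s, by ring⟩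
      refine ⟨h, fun i => ?_⟩
      have h2 : F (Additive.ofMul ⟨u ^ (orderOf (u : G ⧸ N) * m * s), h⟩) = (m * s) • y := by
        rw [hy, ← map_nsmul, ← ofMul_pow]
        congr 2
        ext
        simp [pow_mul, mul_assoc]
      rw [h2, hcdef]
      have h3 : d ∣ y i := Finset.gcd_dvd (Finset.mem_univ i)
      have h4 : ((d.natAbs : ℕ) : ℤ) ∣ y i := Int.natAbs_dvd.2 h3
      rw [Pi.smul_apply, nsmul_eq_mul]
      push_cast
      rw [mul_comm (m * s : ℤ), mul_comm (m : ℤ) s, ← mul_assoc]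
      push_cast at h4
      exact mul_dvd_mul (h4.mul_right _) dvd_rfl
  · refine (MulEquiv.orderOf_eq e _).trans (hord (v i) _ fun t => ?_)
    rw [← hmem, hM]
    refine ⟨fun h => h.1, fun h => ⟨h, fun j => ?_⟩⟩
    have : F (Additive.ofMul ⟨v i ^ t, h⟩) = 0 :=
      (hF0 _).2 fun g => hv i g t (hN.conj_mem _ h g)
    simp [this]

end FiniteQuotients

section Main

variable {A B : Type*} [Group A] [Group B] [Finite A] [Finite B]

lemma fg_coprod : Group.FG (A ∗ B) := by
  refine Group.fg_iff.2 ⟨Set.range (Coprod.inl : A →* A ∗ B) ∪ Set.range (Coprod.inr : B →* A ∗ B),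
    ?_, (Set.finite_range _).union (Set.finite_range _)⟩
  rw [Subgroup.closure_union, ← MonoidHom.coe_range, ← MonoidHom.coe_range, Subgroup.closure_eq,
    Subgroup.closure_eq, Coprod.range_inl_sup_range_inr]

lemma isOfFinOrder_of_mem_factor {i : Bool} {x : A ∗ B} (hx : x ∈ factor A B i) :
    IsOfFinOrder x := by
  cases i
  · obtain ⟨b, rfl⟩ := hx
    exact (Coprod.inr : B →* A ∗ B).isOfFinOrder (isOfFinOrder_of_finite b)
  · obtain ⟨a, rfl⟩ := hx
    exact (Coprod.inl : A →* A ∗ B).isOfFinOrder (isOfFinOrder_of_finite a)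

lemma additive_eq_zero_of_isOfFinOrder {G R : Type*} [Group G] [AddCommGroup R]
    [IsAddTorsionFree R] {M : Subgroup G} {I : G → R}
    (hI : ∀ h ∈ M, ∀ x, I (h * x) = I h + I x) {h : G} (hM : h ∈ M) (hh : IsOfFinOrder h) :
    I h = 0 := by
  have h1 : I 1 = 0 := by simpa using hI 1 M.one_mem 1
  have hpow : ∀ n : ℕ, I (h ^ n) = n • I h := fun n => by
    induction n with
    | zero => simp [h1]
    | succ n ih => rw [pow_succ', hI h hM, ih, succ_nsmul']
  have := hpow (orderOf h)
  rw [pow_orderOf_eq_one, h1] at this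
  exact (nsmul_eq_zero_iff_right hh.orderOf_pos.ne').1 this.symm

end Main

end FreeProductOrder

/-- Let `G = A ∗ B` be a free product of finite groups and
`u, v₁, …, vₙ ∈ G` with `u` in no conjugate of `A` or `B` and, for each `i`, `u` and `vᵢ`
not lying in conjugate cyclic subgroups. Then there are positive integers `L, K₁, …, Kₙ`
such that for every positive integer `m` there is a surjection `φ` of `G` onto a finite
group with `orderOf (φ u) = L * m` and `orderOf (φ vᵢ) = Kᵢ` for all `i`. -/
theorem freeProduct_of_finite_order_proposition
    {A B : Type*} [Group A] [Group B] [Finite A] [Finite B]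
    (n : ℕ) (u : A ∗ B) (v : Fin n → A ∗ B)
    (hu : ¬ ∃ g : A ∗ B,
        g * u * g⁻¹ ∈ (Monoid.Coprod.inl : A →* A ∗ B).range ∨
        g * u * g⁻¹ ∈ (Monoid.Coprod.inr : B →* A ∗ B).range)
    (hcyc : ∀ i, ¬ ∃ (g c : A ∗ B) (k l : ℤ), u = c ^ k ∧ g * v i * g⁻¹ = c ^ l) :
    ∃ (L : ℕ) (K : Fin n → ℕ), 0 < L ∧ (∀ i, 0 < K i) ∧
      ∀ m : ℕ, 0 < m →
        ∃ (H : Type) (_ : Group H) (_ : Finite H) (φ : A ∗ B →* H),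
          Function.Surjective φ ∧ orderOf (φ u) = L * m ∧
            ∀ i, orderOf (φ (v i)) = K i := by
  have : Group.FG (A ∗ B) := FreeProductOrder.fg_coprod
  have horder : ∀ (H : Type) [Group H] (φ : A ∗ B →* H) (c x : A ∗ B),
      orderOf (φ (c * x * c⁻¹)) = orderOf (φ x) := fun H _ φ c x =>
    (SemiconjBy.orderOf_eq (φ c) (x := φ x) (y := φ (c * x * c⁻¹)) (by
      simp [SemiconjBy])).symm
  obtain ⟨c, r, E, hE⟩ : ∃ c r E, FreeProductOrder.IsAxis (c * u * c⁻¹) r E := by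
    refine (FreeProductOrder.elliptic_or_exists_isAxis u).resolve_left ?_
    rintro ⟨c, i, hc⟩
    refine hu ⟨c, ?_⟩
    cases i
    · exact Or.inr hc
    · exact Or.inl hc
  let J := {i : Fin n // ∃ d s F, FreeProductOrder.IsAxis (d * v i * d⁻¹) s F}
  choose d s F hF using fun i : J => i.2
  have hsub : ∀ (i : J) g, ∃ k, ∀ m, g * F i k ≠ E m := by
    intro i g
    by_contra! hg
    obtain ⟨x, k, l, hx, hy⟩ := hE.exists_common_root_of_subset (hF i) hg
    refine hcyc i ⟨c⁻¹ * g * d i, c⁻¹ * x * c, k, l, ?_, ?_⟩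
    · have := conj_zpow (a := c⁻¹) (b := x) (i := k)
      rw [inv_inv] at this
      rw [this, ← hx]
      group
    · have := conj_zpow (a := c⁻¹) (b := x) (i := l)
      rw [inv_inv] at this
      rw [this, ← hy]
      group
  obtain ⟨M, I, hM, hMf, hI, hIu, hIv⟩ := FreeProductOrder.exists_additive hE hF hsub
  obtain ⟨L, K, hL, hK, h⟩ := FreeProductOrder.exists_orderOf_quotient (c * u * c⁻¹) v M I hI hIu
    fun i g k hk => by
      by_cases hi : ∃ d s F, FreeProductOrder.IsAxis (d * v i * d⁻¹) s F
      · have heq : g * v i ^ k * g⁻¹ = (g * (d ⟨i, hi⟩)⁻¹) *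
            (d ⟨i, hi⟩ * v i * (d ⟨i, hi⟩)⁻¹) ^ k * (g * (d ⟨i, hi⟩)⁻¹)⁻¹ := by
          rw [conj_pow]
          group
        rw [heq] at hk ⊢
        exact hIv ⟨i, hi⟩ _ k hk
      · obtain ⟨e, j, hej⟩ := (FreeProductOrder.elliptic_or_exists_isAxis (v i)).resolve_right hi
        refine FreeProductOrder.additive_eq_zero_of_isOfFinOrder hI hk ?_
        have heq : g * v i ^ k * g⁻¹ = MulAut.conj (g * e⁻¹) ((e * v i * e⁻¹) ^ k) := by
          rw [MulAut.conj_apply, conj_pow]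
          group
        rw [heq]
        exact (MulAut.conj (g * e⁻¹)).toMonoidHom.isOfFinOrder
          (FreeProductOrder.isOfFinOrder_of_mem_factor hej).pow
  refine ⟨L, K, hL, hK, fun m hm => ?_⟩
  obtain ⟨H, hH, hHf, φ, hφ, hφu, hφv⟩ := h m hm
  exact ⟨H, hH, hHf, φ, hφ, by rw [← hφu, horder], hφv⟩
end

section
/- Let F = ℤ ∗ ℤ be the free group of rank 2, realized as the free product of two copies of ℤ with canonical free factors ⟨a⟩ and ⟨b⟩ (the images of the two copies of ℤ). Let u₁, …, uₙ ∈ F be elements such that no uᵢ lies in any conjugate of ⟨a⟩ or of ⟨b⟩, and such that for all i ≠ j the elements uᵢ and uⱼ do not lie in conjugate cyclic subgroups (i.e., there exist no g, c ∈ F and integers k, l with uᵢ = c^k and g·uⱼ·g⁻¹ = c^l). Then there exists a positive integer K such that for every sequence of positive integers l₁, …, lₙ there exists a finite group H and a surjective group homomorphism φ : F → H such that the order of φ(uᵢ) equals K·lᵢ for every i. -/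
open scoped Monoid.Coprod

namespace FreeGroup

variable {ι : Type*}

theorem eq_one_of_commute_of_of {x y : ι} (hxy : x ≠ y) {u : FreeGroup ι}
    (hx : Commute u (of x)) (hy : Commute u (of y)) : u = 1 := by
  classical
  by_contra hu
  have hL : u.toWord ≠ [] := by simpa using hu
  have hred : IsReduced u.toWord := isReduced_toWord
  set L := u.toWord with hLdef
  have huL : u = mk L := mk_toWord.symm
  obtain ⟨p, L₁, hp⟩ := List.exists_cons_of_ne_nil hL
  obtain ⟨L₂, l, hl⟩ := (List.eq_nil_or_concat L).resolve_left hL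
  obtain ⟨z, hz, hz1, hz2⟩ : ∃ z : ι × Bool, Commute u (mk [z]) ∧ z.1 ≠ p.1 ∧
      (l.1 = z.1 → l.2 = z.2) := by
    have hx' : ∀ e, Commute u (mk [(x, e)]) := by
      rintro (_ | _)
      · simpa [of, inv_mk, invRev] using hx.inv_right
      · exact hx
    have hy' : ∀ e, Commute u (mk [(y, e)]) := by
      rintro (_ | _)
      · simpa [of, inv_mk, invRev] using hy.inv_right
      · exact hy
    by_cases h1 : p.1 = x
    · exact ⟨(y, l.2), hy' _, fun h ↦ hxy (h1.symm.trans h.symm), fun _ ↦ rfl⟩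
    · exact ⟨(x, l.2), hx' _, fun h ↦ h1 h.symm, fun _ ↦ rfl⟩
  have h1 : IsReduced (z :: L) := by
    rw [hp, isReduced_cons_cons, ← hp]
    exact ⟨fun h ↦ absurd h hz1, hred⟩
  have h2 : IsReduced (L ++ [z]) := by
    rw [hl, List.concat_eq_append] at hred ⊢
    refine IsReduced.append_overlap hred ?_ (by simp)
    simp only [List.cons_append, List.nil_append, isReduced_cons_cons, IsReduced.singleton, and_true]
    exact hz2
  have h3 : mk (z :: L) = mk (L ++ [z]) := by
    have := hz.eq
    rw [huL, mul_mk, mul_mk] at this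
    exact this.symm
  have h4 := reduce.sound h3
  rw [h1.reduce_eq, h2.reduce_eq, hp] at h4
  simp at h4
  exact hz1 (congrArg Prod.fst h4.1)

theorem exists_commute_mem_zpowers {u : FreeGroup ι} (hu : u ≠ 1) :
    ∃ c : FreeGroup ι, Commute c u ∧ ∀ x, Commute x u → x ∈ Subgroup.zpowers c := by
  let C := Subgroup.centralizer {u}
  have hmem : ∀ x, x ∈ C ↔ Commute x u := fun x ↦ by
    simp only [C, Subgroup.mem_centralizer_singleton_iff]; exact ⟨fun h ↦ h, fun h ↦ h⟩
  let e : FreeGroup (IsFreeGroup.Generators C) ≃* C := IsFreeGroup.mulEquiv C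
  let u' : C := ⟨u, (hmem u).2 (Commute.refl u)⟩
  have hcen : ∀ x, Commute (e.symm u') x := fun x ↦ by
    have : Commute u' (e x) := by
      apply Subtype.ext
      exact ((hmem _).1 (e x).2).symm.eq
    simpa using this.map e.symm
  have hsub : Subsingleton (IsFreeGroup.Generators C) := by
    by_contra h
    rw [not_subsingleton_iff_nontrivial] at h
    obtain ⟨x, y, hxy⟩ := h
    have := eq_one_of_commute_of_of hxy (hcen _) (hcen _)
    rw [map_eq_one_iff _ e.symm.injective] at this
    exact hu (congrArg Subtype.val this)
  have hcyc : ∃ c : FreeGroup (IsFreeGroup.Generators C), ∀ x, x ∈ Subgroup.zpowers c := by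
    rcases isEmpty_or_nonempty (IsFreeGroup.Generators C) with h | ⟨⟨x⟩⟩
    · exact ⟨1, fun x ↦ by rw [Subsingleton.elim x 1]; exact one_mem _⟩
    · refine ⟨of x, fun w ↦ ?_⟩
      induction w using FreeGroup.induction_on with
      | C1 => exact one_mem _
      | of y => rw [Subsingleton.elim y x]; exact Subgroup.mem_zpowers _
      | inv_of y ih => exact inv_mem ih
      | mul a b ha hb => exact mul_mem ha hb
  obtain ⟨c, hc⟩ := hcyc
  refine ⟨e c, (hmem _).1 (e c).2, fun x hx ↦ ?_⟩
  obtain ⟨k, hk⟩ := hc (e.symm ⟨x, (hmem x).2 hx⟩)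
  refine ⟨k, ?_⟩
  have := congrArg (fun z ↦ (e z : FreeGroup ι)) hk
  simpa using this

/-- An element is self-centralizing if it generates its own centralizer. In a free group these are
the nontrivial elements that are not proper powers. -/
def SelfCentralizing (c : FreeGroup ι) : Prop :=
  c ≠ 1 ∧ ∀ x, Commute x c → x ∈ Subgroup.zpowers c

theorem exists_selfCentralizing_root {u : FreeGroup ι} (hu : u ≠ 1) :
    ∃ (c : FreeGroup ι) (k : ℤ), c.SelfCentralizing ∧ k ≠ 0 ∧ u = c ^ k := by
  obtain ⟨c, hc, h⟩ := exists_commute_mem_zpowers hu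
  obtain ⟨k, hk⟩ := h u (Commute.refl u)
  simp only at hk
  refine ⟨c, k, ⟨?_, fun x hx ↦ h x ?_⟩, ?_, hk.symm⟩
  · rintro rfl
    exact hu (by simpa using hk.symm)
  · rw [← hk]
    exact hx.zpow_right k
  · rintro rfl
    exact hu (by simpa using hk.symm)

namespace SelfCentralizing

variable {c d : FreeGroup ι}

theorem conj (hc : c.SelfCentralizing) (g : FreeGroup ι) : (g * c * g⁻¹).SelfCentralizing := by
  refine ⟨fun h ↦ hc.1 (by simpa using h), fun x hx ↦ ?_⟩
  obtain ⟨k, hk⟩ := hc.2 (g⁻¹ * x * g) (by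
    have := hx.map (MulAut.conj g⁻¹).toMonoidHom
    simpa [mul_assoc] using this)
  refine ⟨k, ?_⟩
  simp only at hk ⊢
  rw [conj_zpow, hk]
  group

theorem inv (hc : c.SelfCentralizing) : (c⁻¹).SelfCentralizing := by
  refine ⟨by simpa using hc.1, fun x hx ↦ ?_⟩
  rw [Subgroup.zpowers_inv]
  exact hc.2 x (by simpa using hx.inv_right)

theorem mem_zpowers_of_commute_pow (hc : c.SelfCentralizing) {k : ℕ} (hk : k ≠ 0)
    {x : FreeGroup ι} (hx : Commute x (c ^ k)) : x ∈ Subgroup.zpowers c := by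
  apply hc.2
  have h : (x * c * x⁻¹) ^ k = c ^ k := by rw [conj_pow, hx.eq, mul_inv_cancel_right]
  have := IsMulTorsionFree.pow_left_injective hk h
  exact mul_inv_eq_iff_eq_mul.1 this

theorem eq_or_eq_inv (hc : c.SelfCentralizing) (hd : d.SelfCentralizing) {k : ℕ} (hk : k ≠ 0)
    (h : Commute c (d ^ k)) : c = d ∨ c = d⁻¹ := by
  obtain ⟨l, rfl⟩ := hd.mem_zpowers_of_commute_pow hk h
  simp only at hc
  obtain ⟨m, hm⟩ := hc.2 d (Commute.zpow_right (Commute.refl d) l)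
  simp only [← zpow_mul] at hm
  have : l * m = 1 := injective_zpow_iff_not_isOfFinOrder.2
    (fun h ↦ hd.1 ((isOfFinOrder_iff_eq_one d).1 h)) (by simpa using hm)
  rcases Int.eq_one_or_neg_one_of_mul_eq_one this with rfl | rfl <;> simp

end SelfCentralizing

theorem exists_finite_perm_action (L : List (ι × Bool)) (hL : mk L ≠ 1) :
    ∃ (S : Finset (FreeGroup ι)) (π : FreeGroup ι →* Equiv.Perm S), π (mk L) ≠ 1 := by
  classical
  let S : Finset (FreeGroup ι) := (L.tails.map mk).toFinset
  have hS : ∀ w, w <:+ L → mk w ∈ S := fun w hw ↦ by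
    simp only [S, List.mem_toFinset, List.mem_map, List.mem_tails]
    exact ⟨w, hw, rfl⟩
  let e : ∀ x : ι, {g : S // of x * g.1 ∈ S} ≃ {g : S // (of x)⁻¹ * g.1 ∈ S} := fun x ↦
    { toFun := fun g ↦ ⟨⟨of x * g.1.1, g.2⟩, by simp⟩
      invFun := fun g ↦ ⟨⟨(of x)⁻¹ * g.1.1, g.2⟩, by simp⟩
      left_inv := fun g ↦ by simp
      right_inv := fun g ↦ by simp }
  let π : FreeGroup ι →* Equiv.Perm S := lift fun x ↦ (e x).extendSubtype
  have hπ : ∀ (x : ι) (g : S) (h : of x * g.1 ∈ S), π (of x) g = ⟨of x * g.1, h⟩ := by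
    intro x g h
    simp only [π, lift_apply_of]
    rw [Equiv.extendSubtype_apply_of_mem (e x) g h]
    rfl
  have key : ∀ w, w <:+ L → (π (mk w) ⟨1, hS [] List.nil_suffix⟩ : FreeGroup ι) = mk w := by
    intro w
    induction w with
    | nil => intro hw; rw [← one_eq_mk, _root_.map_one]; rfl
    | cons l w ih =>
      intro hw
      have hw' : w <:+ L := (List.suffix_cons l w).trans hw
      obtain ⟨x, b⟩ := l
      have hmk : mk ((x, b) :: w) = mk [(x, b)] * mk w := by simp [mul_mk]
      have ih' : π (mk w) ⟨1, hS [] List.nil_suffix⟩ = ⟨mk w, hS w hw'⟩ := Subtype.ext (ih hw')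
      rw [hmk, _root_.map_mul, Equiv.Perm.mul_apply, ih']
      cases b with
      | true => 
        exact congrArg Subtype.val
          (hπ x ⟨mk w, hS w hw'⟩ (by have := hS _ hw; rwa [hmk] at this))
      | false =>
        have hinv : (mk [(x, false)] : FreeGroup ι) = (of x)⁻¹ := by simp [of, inv_mk, invRev]
        have hm := hS _ hw
        rw [hmk] at hm
        rw [hinv] at hm ⊢
        have : (π (of x))⁻¹ ⟨mk w, hS w hw'⟩ = ⟨(of x)⁻¹ * mk w, hm⟩ := by
          rw [Equiv.Perm.inv_eq_iff_eq, hπ x _ (by simpa using hS w hw')]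
          simp
        rw [_root_.map_inv, this]
  refine ⟨S, π, fun h ↦ hL ?_⟩
  have := key L List.suffix_rfl
  rw [h] at this
  exact this.symm

instance residuallyFinite : Group.ResiduallyFinite (FreeGroup ι) := by
  rw [Group.residuallyFinite_iff_exists_finiteIndexNormalSubgroup]
  intro g hg
  induction g using Quot.inductionOn with
  | h L =>
    obtain ⟨S, π, hπ⟩ := exists_finite_perm_action L hg
    exact ⟨FiniteIndexNormalSubgroup.ofSubgroup π.ker, hπ⟩

end FreeGroup

theorem Group.ResiduallyFinite.exists_forall_mem_eq_one {F : Type*} [Group F] [Group.ResiduallyFinite F]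
    {E : Set F} (hE : E.Finite) :
    ∃ N : FiniteIndexNormalSubgroup F, ∀ x ∈ E, x ∈ N → x = 1 := by
  induction E, hE using Set.Finite.induction_on with
  | empty => exact ⟨FiniteIndexNormalSubgroup.ofSubgroup ⊤, by simp⟩
  | @insert a s _ _ ih =>
    obtain ⟨N, hN⟩ := ih
    by_cases ha : a = 1
    · exact ⟨N, by rintro x (rfl | hx) h; exacts [ha, hN x hx h]⟩
    · obtain ⟨M, hM⟩ := Group.exists_finiteIndexNormalSubgroup_notMem a ha
      refine ⟨N ⊓ M, ?_⟩
      rintro x (rfl | hx) h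
      · exact absurd h.2 hM
      · exact hN x hx h.1

namespace FreeGroup

variable {ι : Type*}

theorem norm_mk_pow [DecidableEq ι] {L : List (ι × Bool)} (hL : IsCyclicallyReduced L) (n : ℕ) :
    (mk L ^ n).norm = n * L.length := by
  rw [pow_mk, norm, toWord_mk, (hL.flatten_replicate n).isReduced.reduce_eq]
  simp

theorem eq_of_mem_zpowers_of_suffix {L w : List (ι × Bool)} (hL : IsCyclicallyReduced L)
    (hw : w <:+ L) (h : mk w ∈ Subgroup.zpowers (mk L)) : w = [] ∨ w = L := by
  classical
  obtain ⟨k, hk⟩ := h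
  simp only at hk
  have hred : IsReduced w := hL.isReduced.infix hw.isInfix
  have hnorm : (mk w).norm = w.length := by rw [norm, toWord_mk, hred.reduce_eq]
  have hk' : (mk w).norm = k.natAbs * L.length := by
    rw [← hk]
    obtain ⟨m, rfl | rfl⟩ := k.eq_nat_or_neg
    · rw [zpow_natCast, norm_mk_pow hL]; simp
    · rw [zpow_neg, norm_inv_eq, zpow_natCast, norm_mk_pow hL]; simp
  rw [hnorm] at hk'
  have hle := hw.length_le
  rcases Nat.eq_zero_or_pos k.natAbs with h0 | h0
  · left; rw [h0, zero_mul] at hk'; exact List.eq_nil_of_length_eq_zero hk'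
  · right
    exact hw.eq_of_length (le_antisymm hle (by rw [hk']; exact Nat.le_mul_of_pos_left _ h0))

/-- A cyclically reduced word ending in the letter `a` and representing an element that is not a
proper power. -/
structure IsPrimitiveWord (a : ι) (X : List (ι × Bool)) : Prop where
  intro ::
  isCyclicallyReduced : IsCyclicallyReduced X
  selfCentralizing : (mk X).SelfCentralizing
  exists_eq_append : ∃ x, X = x ++ [(a, true)]

namespace IsPrimitiveWord

variable {a : ι} {X Y w : List (ι × Bool)}

theorem eq_of_commute_pow (hX : IsPrimitiveWord a X) (hY : IsPrimitiveWord a Y) {k : ℕ}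
    (hk : k ≠ 0) (h : Commute (mk X) (mk Y ^ k)) : X = Y := by
  classical
  rcases hX.selfCentralizing.eq_or_eq_inv hY.selfCentralizing hk h with h | h
  · have := reduce.sound h
    rwa [hX.isCyclicallyReduced.isReduced.reduce_eq,
      hY.isCyclicallyReduced.isReduced.reduce_eq] at this
  · exfalso
    rw [inv_mk] at h
    have := reduce.sound h
    rw [reduce_invRev, hX.isCyclicallyReduced.isReduced.reduce_eq,
      hY.isCyclicallyReduced.isReduced.reduce_eq] at this
    obtain ⟨x, hx⟩ := hX.exists_eq_append
    obtain ⟨y, hy⟩ := hY.exists_eq_append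
    have h1 := hX.isCyclicallyReduced.2 (a, true) (by rw [hx]; simp) (a, false)
      (by rw [this, hy]; simp [invRev])
    simp at h1

theorem not_commute_suffix (hX : IsPrimitiveWord a X) (hw : w <:+ X) (h0 : w ≠ [])
    (h1 : w ≠ X) : ¬ Commute (mk w) (mk X) := fun h ↦ by
  rcases eq_of_mem_zpowers_of_suffix hX.isCyclicallyReduced hw (hX.selfCentralizing.2 _ h) with h | h
  exacts [h0 h, h1 h]

theorem subsingleton_commute (hX : IsPrimitiveWord a X) (hY : IsPrimitiveWord a Y)
    (hXY : X ≠ Y) (g : FreeGroup ι) :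
    {M : ℕ | Commute (g⁻¹ * mk Y ^ M) (mk X)}.Subsingleton := by
  have key : ∀ m n : ℕ, m < n → Commute (g⁻¹ * mk Y ^ m) (mk X) →
      ¬ Commute (g⁻¹ * mk Y ^ n) (mk X) := by
    intro m n hmn hm hn
    obtain ⟨k, rfl⟩ := Nat.exists_eq_add_of_lt hmn
    refine hXY (hX.eq_of_commute_pow hY (k := k + 1) (by simp) ?_)
    have := hm.inv_left.mul_left hn
    rw [show (g⁻¹ * mk Y ^ m)⁻¹ * (g⁻¹ * mk Y ^ (m + k + 1)) = mk Y ^ (k + 1) by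
      rw [add_assoc, pow_add]; group] at this
    exact this.symm
  intro m hm n hn
  rcases lt_trichotomy m n with h | h | h
  exacts [(key m n h hm hn).elim, h, (key n m h hn hm).elim]

end IsPrimitiveWord

open scoped commutatorElement in
/-- In a suitable finite quotient, the axes of finitely many primitive words through the base
vertex avoid the base vertex and the `M`-th power vertices of the other words. -/
theorem exists_separating_quotient {ι : Type} (a : ι) {W : Set (List (ι × Bool))} (hW : W.Finite)
    (hprim : ∀ X ∈ W, IsPrimitiveWord a X) :
    ∃ (G : Type) (_ : Group G) (_ : Finite G) (q : FreeGroup ι →* G) (M : ℕ),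
      (∀ X ∈ W, q (mk X) ^ M ≠ 1) ∧
      (∀ X ∈ W, ∀ w, w <:+ X → w ≠ [] → w ≠ X → ∀ p : ℕ, q (mk w) * q (mk X) ^ p ≠ 1) ∧
      (∀ X ∈ W, ∀ Y ∈ W, ∀ w, w <:+ X → w ≠ X → (w ≠ [] ∨ X ≠ Y) →
        ∀ p : ℕ, q (mk w) * q (mk X) ^ p ≠ q (mk Y) ^ M) := by
  classical
  let V : Set (List (ι × Bool)) := ⋃ X ∈ W, {w | w <:+ X}
  have hV : V.Finite := hW.biUnion fun X _ ↦ by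
    refine (X.tails.toFinset.finite_toSet).subset fun w hw ↦ ?_
    simpa using hw
  let B : Set ℕ := {0} ∪ ⋃ X ∈ W, ⋃ Y ∈ W \ {X}, ⋃ w ∈ V,
    {M : ℕ | Commute ((mk w)⁻¹ * mk Y ^ M) (mk X)}
  have hB : B.Finite := by
    refine (Set.finite_singleton 0).union (hW.biUnion fun X hX ↦ hW.sdiff.biUnion fun Y hY ↦
      hV.biUnion fun w _ ↦ ?_)
    exact ((hprim X hX).subsingleton_commute (hprim Y hY.1) (fun h ↦ hY.2 h.symm) _).finite
  obtain ⟨M, hM⟩ := hB.exists_notMem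
  simp only [B, Set.mem_union, Set.mem_iUnion, not_or, not_exists, Set.mem_singleton_iff,
    Set.mem_ofPred_eq] at hM
  obtain ⟨hM0, hM⟩ := hM
  let E : Set (FreeGroup ι) := (fun X ↦ mk X ^ M) '' W ∪
    (fun p : List (ι × Bool) × List (ι × Bool) ↦ ⁅mk p.2, mk p.1⁆) '' (W ×ˢ V) ∪
    (fun p : List (ι × Bool) × List (ι × Bool) × List (ι × Bool) ↦
      ⁅(mk p.2.2)⁻¹ * mk p.2.1 ^ M, mk p.1⁆) '' (W ×ˢ W ×ˢ V)
  have hE : E.Finite := ((hW.image _).union ((hW.prod hV).image _)).union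
    ((hW.prod (hW.prod hV)).image _)
  obtain ⟨N, hN⟩ := Group.ResiduallyFinite.exists_forall_mem_eq_one hE
  have hq : ∀ x ∈ E, QuotientGroup.mk' N.toSubgroup x = 1 → x = 1 := fun x hx h ↦
    hN x hx ((QuotientGroup.eq_one_iff x).1 h)
  refine ⟨FreeGroup ι ⧸ N.toSubgroup, inferInstance, inferInstance, QuotientGroup.mk' N.toSubgroup,
    M, ?_⟩
  generalize QuotientGroup.mk' N.toSubgroup = q at hq
  have hVmem : ∀ X ∈ W, ∀ w, w <:+ X → w ∈ V := fun X hX w hw ↦ Set.mem_biUnion hX hw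
  refine ⟨fun X hX h ↦ ?_, fun X hX w hw h0 h1 p h ↦ ?_, fun X hX Y hY w hw h1 h0 p h ↦ ?_⟩
  · rw [← map_pow] at h
    have := hq _ (Or.inl (Or.inl ⟨X, hX, rfl⟩)) h
    exact (hprim X hX).selfCentralizing.1 (IsMulTorsionFree.pow_left_injective hM0 (by simpa using this))
  · have h2 : ⁅mk w, mk X⁆ = 1 := by
      refine hq _ (Or.inl (Or.inr ⟨(X, w), ⟨hX, hVmem X hX w hw⟩, rfl⟩)) ?_
      rw [map_commutatorElement, commutatorElement_eq_one_iff_commute, eq_inv_of_mul_eq_one_left h]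
      exact ((Commute.refl _).pow_left p).inv_left
    exact (hprim X hX).not_commute_suffix hw h0 h1 (commutatorElement_eq_one_iff_commute.1 h2)
  · have h2 : ⁅(mk w)⁻¹ * mk Y ^ M, mk X⁆ = 1 := by
      refine hq _ (Or.inr ⟨(X, Y, w), ⟨hX, hY, hVmem X hX w hw⟩, rfl⟩) ?_
      rw [map_commutatorElement, commutatorElement_eq_one_iff_commute, _root_.map_mul, _root_.map_inv,
        _root_.map_pow,
        ← h, inv_mul_cancel_left]
      exact (Commute.refl _).pow_left p
    rw [commutatorElement_eq_one_iff_commute] at h2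
    by_cases hXY : X = Y
    · subst hXY
      have h3 := (h2.mul_left ((Commute.refl (mk X)).pow_left M).inv_left).inv_left
      refine (hprim X hX).not_commute_suffix hw (h0.resolve_right (by simp)) h1 ?_
      rwa [mul_inv_rev, inv_inv, mul_inv_rev, inv_inv, mul_inv_cancel_left] at h3
    · exact hM X hX Y ⟨hY, fun h ↦ hXY h.symm⟩ w (hVmem X hX w hw) h2

section Words

theorem mk_cons_false (x : ι) (w : List (ι × Bool)) : mk ((x, false) :: w) = (of x)⁻¹ * mk w := by
  simp [of, inv_mk, invRev]

theorem mk_cons_true (x : ι) (w : List (ι × Bool)) : mk ((x, true) :: w) = of x * mk w := by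
  simp [of]

theorem isConj_mk_of_isRotated {X L : List (ι × Bool)} (h : X ~r L) : IsConj (mk X) (mk L) := by
  obtain ⟨n, -, rfl⟩ := List.isRotated_iff_mod.1 h
  rw [List.rotate_eq_drop_append_take_mod]
  nth_rw 1 [← List.take_append_drop (n % X.length) X]
  rw [← mul_mk, ← mul_mk]
  exact isConj_iff.2 ⟨(mk (X.take (n % X.length)))⁻¹, by group⟩

end Words

section Holonomy

variable {G T : Type*} [Group G]

/-- The element `w` acts on `G × T` over the left translation by `q w`, mapping the fibre over `g`
by the permutation `τ`. -/
def HasHolonomy (q : FreeGroup ι →* G) (Φ : FreeGroup ι →* Equiv.Perm (G × T)) (w : FreeGroup ι)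
    (g : G) (τ : Equiv.Perm T) : Prop :=
  ∀ t, Φ w (g, t) = (q w * g, τ t)

namespace HasHolonomy

variable {q : FreeGroup ι →* G} {Φ : FreeGroup ι →* Equiv.Perm (G × T)} {w w' y : FreeGroup ι}
  {g : G} {τ τ' : Equiv.Perm T}

theorem one (g : G) : HasHolonomy q Φ 1 g 1 := fun t ↦ by simp

theorem mul (h' : HasHolonomy q Φ w' (q w * g) τ') (h : HasHolonomy q Φ w g τ) :
    HasHolonomy q Φ (w' * w) g (τ' * τ) := fun t ↦ by
  rw [_root_.map_mul, Equiv.Perm.mul_apply, h t, h' (τ t), _root_.map_mul, mul_assoc]; rfl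

theorem inv (h : HasHolonomy q Φ w g τ) : HasHolonomy q Φ w⁻¹ (q w * g) τ⁻¹ := fun t ↦ by
  rw [_root_.map_inv, Equiv.Perm.inv_eq_iff_eq, _root_.map_inv, inv_mul_cancel_left, h]
  simp

theorem inv' (h : HasHolonomy q Φ w ((q w)⁻¹ * g) τ) : HasHolonomy q Φ w⁻¹ g τ⁻¹ := by
  simpa using h.inv

theorem exists_pow {P : Subgroup (Equiv.Perm T)} {n : ℕ}
    (h : ∀ k < n, ∃ τ ∈ P, HasHolonomy q Φ w (q w ^ k * g) τ) :
    ∃ τ ∈ P, HasHolonomy q Φ (w ^ n) g τ := by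
  induction n with
  | zero => exact ⟨1, P.one_mem, by simpa using one g⟩
  | succ n ih =>
    obtain ⟨τ, hτ, hw⟩ := ih fun k hk ↦ h k (by lia)
    obtain ⟨τ', hτ', hw'⟩ := h n n.lt_succ_self
    rw [← _root_.map_pow] at hw'
    exact ⟨τ' * τ, P.mul_mem hτ' hτ, by rw [pow_succ']; exact hw'.mul hw⟩

theorem pow_of_map_eq_one (h : HasHolonomy q Φ w g τ) (hw : q w = 1) (n : ℕ) :
    HasHolonomy q Φ (w ^ n) g (τ ^ n) := by
  induction n with
  | zero => simpa using one g
  | succ n ih =>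
    rw [pow_succ', pow_succ']
    exact mul (by simpa [hw] using h) ih

theorem pow_of_forall {k n : ℕ} (h : ∀ p, k ≤ p → p < k + n → HasHolonomy q Φ w (q w ^ p) 1) :
    HasHolonomy q Φ (w ^ n) (q w ^ k) 1 := by
  obtain ⟨_, rfl, h⟩ := exists_pow (P := ⊥) (n := n) (g := q w ^ k) fun i hi ↦
    ⟨1, rfl, by rw [← pow_add]; exact h _ (by lia) (by lia)⟩
  exact h

theorem pow_of_map_eq_one_of_forall {n : ℕ} (hn : 0 < n) {τ : Equiv.Perm T} (h0 : HasHolonomy q Φ w 1 τ)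
    (h : ∀ p, 0 < p → p < n → HasHolonomy q Φ w (q w ^ p) 1) :
    HasHolonomy q Φ (w ^ n) 1 τ := by
  have h1 : HasHolonomy q Φ (w ^ (n - 1)) (q w ^ 1) 1 :=
    pow_of_forall fun p _ _ ↦ h p (by lia) (by lia)
  rw [pow_one, ← mul_one (q w)] at h1
  have := h1.mul h0
  rwa [one_mul, ← pow_succ, Nat.sub_add_cancel hn] at this

theorem pow_of_forall_ne {m n : ℕ} (hm : 0 < m) (hmn : m < n) {σ τ : Equiv.Perm T}
    (h0 : HasHolonomy q Φ w 1 τ) (h1 : HasHolonomy q Φ w (q w ^ m) σ)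
    (h : ∀ p, 0 < p → p < n → p ≠ m → HasHolonomy q Φ w (q w ^ p) 1) :
    HasHolonomy q Φ (w ^ n) 1 (σ * τ) := by
  have h2 : HasHolonomy q Φ (w ^ m) 1 τ :=
    pow_of_map_eq_one_of_forall hm h0 fun p _ _ ↦ h p (by lia) (by lia) (by lia)
  have h3 : HasHolonomy q Φ (w ^ (n - m - 1)) (q w ^ (m + 1)) 1 :=
    pow_of_forall fun p _ _ ↦ h p (by lia) (by lia) (by lia)
  rw [pow_succ' (q w) m] at h3
  have h4 := h3.mul h1
  rw [one_mul, ← pow_succ, ← mul_one (q w ^ m), ← _root_.map_pow] at h4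
  have := h4.mul h2
  rwa [← pow_add, show n - m - 1 + 1 + m = n by lia] at this

theorem conj (hy : HasHolonomy q Φ y g τ') (hg : q y * g = 1) (h : HasHolonomy q Φ w 1 τ)
    (hw : q w = 1) : HasHolonomy q Φ (y⁻¹ * w * y) g (τ'⁻¹ * τ * τ') := by
  rw [mul_assoc, mul_assoc]
  refine mul ?_ (mul (by rwa [hg]) hy)
  rw [_root_.map_mul, hw, one_mul]
  exact hy.inv

end HasHolonomy

variable [DecidableEq ι]

/-- The permutation of `G × T` acting by left translation by `g₀` on `G` and by `f g` on the fibre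
over `g`. -/
def wreathPerm (g₀ : G) (f : G → Equiv.Perm T) : Equiv.Perm (G × T) where
  toFun p := (g₀ * p.1, f p.1 p.2)
  invFun p := (g₀⁻¹ * p.1, (f (g₀⁻¹ * p.1))⁻¹ p.2)
  left_inv p := by simp
  right_inv p := by simp

/-- The action on `G × T` in which each generator acts on `G` through `q`, and the generator `a`
moreover acts on the fibre over `g` by `f g`. -/
def wreathHom (a : ι) (q : FreeGroup ι →* G) (f : G → Equiv.Perm T) :
    FreeGroup ι →* Equiv.Perm (G × T) :=
  lift fun x ↦ wreathPerm (q (of x)) (if x = a then f else 1)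

variable {a : ι} {q : FreeGroup ι →* G} {f : G → Equiv.Perm T}

theorem hasHolonomy_of_self (g : G) : HasHolonomy q (wreathHom a q f) (of a) g (f g) := fun t ↦ by
  simp [wreathHom, wreathPerm]

theorem hasHolonomy_of_of_ne {x : ι} (hx : x ≠ a) (g : G) :
    HasHolonomy q (wreathHom a q f) (of x) g 1 := fun t ↦ by
  simp [wreathHom, wreathPerm, hx]

/-- For a word decomposed as `v ++ (a, e) :: w`, the suffix at which the edge labelled `(a, e)`,
oriented positively, starts. -/
def edgeBase (a : ι) (e : Bool) (w : List (ι × Bool)) : List (ι × Bool) :=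
  if e then w else (a, e) :: w

theorem exists_hasHolonomy_mk {P : Subgroup (Equiv.Perm T)} {L : List (ι × Bool)} {g : G}
    (h : ∀ v e w, L = v ++ (a, e) :: w → f (q (mk (edgeBase a e w)) * g) ∈ P) :
    ∃ τ ∈ P, HasHolonomy q (wreathHom a q f) (mk L) g τ := by
  induction L with
  | nil => exact ⟨1, P.one_mem, HasHolonomy.one g⟩
  | cons l L ih =>
    obtain ⟨τ, hτ, hL⟩ := ih fun v e w hvw ↦ h (l :: v) e w (by rw [hvw]; rfl)
    obtain ⟨x, e⟩ := l
    suffices ∃ τ' ∈ P, HasHolonomy q (wreathHom a q f) (mk [(x, e)]) (q (mk L) * g) τ' by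
      obtain ⟨τ', hτ', h'⟩ := this
      exact ⟨τ' * τ, P.mul_mem hτ' hτ, by simpa [mul_mk] using h'.mul hL⟩
    cases e with
    | true =>
      by_cases hx : x = a
      · subst hx
        exact ⟨_, by simpa [edgeBase] using h [] true L rfl, hasHolonomy_of_self _⟩
      · exact ⟨1, P.one_mem, hasHolonomy_of_of_ne hx _⟩
    | false =>
      rw [mk_cons_false, ← one_eq_mk, mul_one]
      by_cases hx : x = a
      · subst hx
        refine ⟨_, P.inv_mem ?_, (hasHolonomy_of_self _).inv'⟩
        simpa [edgeBase, mk_cons_false, mul_assoc] using h [] false L rfl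
      · exact ⟨_, P.inv_mem P.one_mem, (hasHolonomy_of_of_ne hx _).inv'⟩

theorem exists_hasHolonomy (w : FreeGroup ι) (g : G) :
    ∃ τ, HasHolonomy q (wreathHom a q f) w g τ := by
  obtain ⟨τ, -, h⟩ := exists_hasHolonomy_mk (P := ⊤) (L := w.toWord) (g := g) (q := q) (a := a)
    (f := f) fun _ _ _ _ ↦ Subgroup.mem_top _
  exact ⟨τ, by rwa [mk_toWord] at h⟩

theorem map_eq_one_of_wreathHom_eq_one [Nonempty T] {w : FreeGroup ι}
    (h : wreathHom a q f w = 1) : q w = 1 := by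
  obtain ⟨τ, hτ⟩ := exists_hasHolonomy (q := q) (a := a) (f := f) w 1
  obtain ⟨t⟩ := ‹Nonempty T›
  have := congrArg Prod.fst (hτ t)
  rw [h] at this
  simpa using this.symm

theorem orderOf_mul_orderOf_dvd [Nonempty T] {w : FreeGroup ι} {τ : Equiv.Perm T}
    (h : HasHolonomy q (wreathHom a q f) (w ^ orderOf (q w)) 1 τ) :
    orderOf (q w) * orderOf τ ∣ orderOf (wreathHom a q f w) := by
  have h1 : q (w ^ orderOf (wreathHom a q f w)) = 1 :=
    map_eq_one_of_wreathHom_eq_one (a := a) (f := f) (by rw [_root_.map_pow, pow_orderOf_eq_one])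
  rw [_root_.map_pow, ← orderOf_dvd_iff_pow_eq_one] at h1
  obtain ⟨k, hk⟩ := h1
  rw [hk]
  refine mul_dvd_mul_left _ (orderOf_dvd_of_pow_eq_one ?_)
  have h2 := h.pow_of_map_eq_one (by rw [_root_.map_pow, pow_orderOf_eq_one]) k
  ext t
  have := h2 t
  rw [← pow_mul, ← hk, _root_.map_pow, pow_orderOf_eq_one] at this
  exact (congrArg Prod.snd this).symm

end Holonomy

section Words

variable {a : ι} {X L : List (ι × Bool)}

theorem IsReduced.invRev (h : IsReduced L) : IsReduced (invRev L) := by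
  classical
  rw [isReduced_iff_reduce_eq, reduce_invRev, h.reduce_eq]

theorem isCyclicallyReduced_iff_append_self : IsCyclicallyReduced L ↔ IsReduced (L ++ L) := by
  rw [isCyclicallyReduced_iff, IsReduced, IsReduced, List.isChain_append]
  tauto

theorem IsCyclicallyReduced.of_isRotated (hL : IsCyclicallyReduced L) (h : X ~r L) :
    IsCyclicallyReduced X := by
  obtain ⟨n, -, rfl⟩ := List.isRotated_iff_mod.1 h.symm
  rw [List.rotate_eq_drop_append_take_mod, isCyclicallyReduced_iff_append_self]
  refine (hL.flatten_replicate 3).isReduced.infix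
    ⟨L.take (n % L.length), L.drop (n % L.length), ?_⟩
  have : L.take (n % L.length) ++ L.drop (n % L.length) = L := List.take_append_drop _ _
  generalize L.take (n % L.length) = x at *
  generalize L.drop (n % L.length) = y at *
  subst this
  simp [List.replicate]

theorem IsCyclicallyReduced.invRev (hL : IsCyclicallyReduced L) :
    IsCyclicallyReduced (invRev L) := by
  rw [isCyclicallyReduced_iff_append_self, ← invRev_append]
  exact (isCyclicallyReduced_iff_append_self.1 hL).invRev

/-- The words ending in the letter `a` that are cyclic permutations of `L` or of its inverse. -/
def cyclicWords (a : ι) (L : List (ι × Bool)) : Set (List (ι × Bool)) :=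
  {X | (X ~r L ∨ X ~r invRev L) ∧ ∃ x, X = x ++ [(a, true)]}

theorem finite_cyclicWords (a : ι) (L : List (ι × Bool)) : (cyclicWords a L).Finite := by
  have key : ∀ L : List (ι × Bool), {X | X ~r L}.Finite := fun L ↦ by
    refine (L.cyclicPermutations.finite_toSet).subset fun X hX ↦ ?_
    exact List.mem_cyclicPermutations_iff.2 hX
  exact ((key L).union (key (invRev L))).subset fun X hX ↦ hX.1

theorem isConj_of_mem_cyclicWords (h : X ∈ cyclicWords a L) :
    IsConj (mk X) (mk L) ∨ IsConj (mk X) (mk L)⁻¹ := by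
  rw [inv_mk]
  exact h.1.imp isConj_mk_of_isRotated isConj_mk_of_isRotated

theorem SelfCentralizing.of_isConj {c d : FreeGroup ι} (h : c.SelfCentralizing)
    (hcd : IsConj d c) : d.SelfCentralizing := by
  obtain ⟨g, rfl⟩ := isConj_iff.1 hcd.symm
  exact h.conj g

theorem isPrimitiveWord_of_mem_cyclicWords (hL : IsCyclicallyReduced L)
    (hc : (mk L).SelfCentralizing) (h : X ∈ cyclicWords a L) : IsPrimitiveWord a X := by
  refine ⟨?_, ?_, h.2⟩
  · rcases h.1 with h | h
    exacts [hL.of_isRotated h, hL.invRev.of_isRotated h]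
  · rcases isConj_of_mem_cyclicWords h with h | h
    exacts [hc.of_isConj h, hc.inv.of_isConj h]

/-- Conjugating the word `v ++ (a, e) :: w` by a final segment, and possibly inverting it, turns
it into a word ending in `a`. -/
theorem exists_conj_edgeBase {v w : List (ι × Bool)} {e : Bool} (hL : L = v ++ (a, e) :: w) :
    ∃ X ∈ cyclicWords a L, mk (edgeBase a e w) * mk L * (mk (edgeBase a e w))⁻¹ = mk X ∨
      mk (edgeBase a e w) * mk L * (mk (edgeBase a e w))⁻¹ = (mk X)⁻¹ := by
  subst hL
  cases e with
  | true =>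
    refine ⟨w ++ (v ++ [(a, true)]), ⟨Or.inl ?_, w ++ v, by simp⟩, Or.inl ?_⟩
    · have : v ++ (a, true) :: w = (v ++ [(a, true)]) ++ w := by simp
      rw [this]
      exact List.isRotated_append
    · simp only [edgeBase, if_true, ← mul_mk, mk_cons_true, ← one_eq_mk]
      group
  | false =>
    refine ⟨invRev v ++ (invRev w ++ [(a, true)]), ⟨Or.inr ?_, invRev v ++ invRev w, by simp⟩,
      Or.inr ?_⟩
    · have : invRev (v ++ (a, false) :: w) = (invRev w ++ [(a, true)]) ++ invRev v := by
        simp [invRev]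
      rw [this]
      exact List.isRotated_append
    · simp only [edgeBase, Bool.false_eq_true, if_false, ← mul_mk, mk_cons_false, mk_cons_true,
        ← inv_mk, ← one_eq_mk]
      group

theorem nonempty_cyclicWords (h : ∃ e, (a, e) ∈ L) : (cyclicWords a L).Nonempty := by
  obtain ⟨e, he⟩ := h
  obtain ⟨v, w, hL⟩ := List.append_of_mem he
  obtain ⟨X, hX, -⟩ := exists_conj_edgeBase hL
  exact ⟨X, hX⟩

theorem IsPrimitiveWord.edgeBase_append {x v w : List (ι × Bool)} {e : Bool}
    (hX : IsPrimitiveWord a X) (hx : X = x ++ [(a, true)]) (h : x = v ++ (a, e) :: w) :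
    edgeBase a e w ++ [(a, true)] <:+ X ∧ edgeBase a e w ++ [(a, true)] ≠ X := by
  subst h hx
  cases e with
  | true =>
    refine ⟨⟨v ++ [(a, true)], by simp [edgeBase]⟩, fun h ↦ ?_⟩
    have := congrArg List.length h
    simp [edgeBase] at this
    lia
  | false =>
    refine ⟨⟨v, by simp [edgeBase]⟩, fun h ↦ ?_⟩
    have := hX.isCyclicallyReduced.2 (a, true) (by rw [List.getLast?_concat]; rfl)
      (a, false)
      (by rw [← h]; simp [edgeBase])
    simp at this

theorem exists_isCyclicallyReduced_isConj (u : FreeGroup ι) :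
    ∃ L, IsCyclicallyReduced L ∧ IsConj (mk L) u := by
  classical
  refine ⟨_, reduceCyclically.isCyclicallyReduced (isReduced_toWord (x := u)), isConj_iff.2
    ⟨mk (reduceCyclically.conjugator u.toWord), ?_⟩⟩
  rw [inv_mk, mul_mk, mul_mk, reduceCyclically.conj_conjugator_reduceCyclically, mk_toWord]

theorem orderOf_map_eq_of_isConj {M N : Type*} [Group M] [Group N] {x y : M} (φ : M →* N)
    (h : IsConj x y) : orderOf (φ x) = orderOf (φ y) := by
  obtain ⟨c, rfl⟩ := isConj_iff.1 h
  rw [_root_.map_mul, _root_.map_mul, _root_.map_inv]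
  exact (MulAut.conj (φ c)).orderOf_eq (φ x) |>.symm

theorem orderOf_map_of_mem_cyclicWords {N : Type*} [Group N] (φ : FreeGroup ι →* N)
    (h : X ∈ cyclicWords a L) : orderOf (φ (mk X)) = orderOf (φ (mk L)) := by
  rcases isConj_of_mem_cyclicWords h with h | h
  · exact orderOf_map_eq_of_isConj φ h
  · rw [orderOf_map_eq_of_isConj φ h, _root_.map_inv, orderOf_inv]

end Words

section Holonomy

variable {G T : Type*} [Group G] [DecidableEq ι] {a : ι} {q : FreeGroup ι →* G}
  {f : G → Equiv.Perm T} {X L : List (ι × Bool)}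

theorem IsPrimitiveWord.hasHolonomy (hX : IsPrimitiveWord a X)
    (hf : ∀ w, w <:+ X → w ≠ [] → w ≠ X → ∀ p : ℕ, f (q (mk w) * q (mk X) ^ p) = 1) (p : ℕ) :
    HasHolonomy q (wreathHom a q f) (mk X) (q (mk X) ^ p) (f (q (mk X) ^ p)) := by
  obtain ⟨x, hx⟩ := hX.exists_eq_append
  have h1 : ∃ τ ∈ (⊥ : Subgroup (Equiv.Perm T)), HasHolonomy q (wreathHom a q f) (mk x)
      (q (of a) * q (mk X) ^ p) τ := by
    refine exists_hasHolonomy_mk fun v e w hw ↦ ?_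
    obtain ⟨h1, h2⟩ := hX.edgeBase_append hx hw
    rw [Subgroup.mem_bot, ← hf _ h1 (by simp) h2 p, ← mul_mk, _root_.map_mul, mul_assoc]
    rfl
  obtain ⟨_, rfl, h1⟩ := h1
  have h2 := h1.mul (hasHolonomy_of_self (f := f) (q ((mk X)) ^ p))
  have h3 : mk x * of a = mk X := by rw [hx, ← mul_mk]; rfl
  rwa [one_mul, h3] at h2

theorem wreathHom_pow_eq_one {P : Subgroup (Equiv.Perm T)} {n : ℕ} (hP : ∀ τ ∈ P, τ ^ n = 1)
    (hf : ∀ g, g ≠ 1 → f g ∈ P)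
    (hX : ∀ X ∈ cyclicWords a L, ∃ σ,
      HasHolonomy q (wreathHom a q f) (mk X ^ orderOf (q (mk X))) 1 σ ∧ σ ^ n = 1) :
    wreathHom a q f (mk L) ^ (orderOf (q (mk L)) * n) = 1 := by
  have hq : q (mk L ^ orderOf (q (mk L))) = 1 := by rw [_root_.map_pow, pow_orderOf_eq_one]
  suffices ∀ g, ∃ τ, HasHolonomy q (wreathHom a q f) (mk L ^ orderOf (q (mk L))) g τ ∧
      τ ^ n = 1 by
    ext1 ⟨g, t⟩
    obtain ⟨τ, h, hτ⟩ := this g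
    have := h.pow_of_map_eq_one hq n t
    rwa [hτ, _root_.map_pow q, hq, one_pow, one_mul, ← pow_mul, _root_.map_pow] at this
  intro g
  by_cases hcase : ∃ (k : ℕ) (v w : List (ι × Bool)) (e : Bool), L = v ++ (a, e) :: w ∧
      q (mk (edgeBase a e w)) * (q (mk L) ^ k * g) = 1
  · obtain ⟨k, v, w, e, hL, hk⟩ := hcase
    obtain ⟨X, hXL, hconj⟩ := exists_conj_edgeBase hL
    set y := mk (edgeBase a e w) * mk L ^ k with hy
    have hyg : q y * g = 1 := by rw [hy, _root_.map_mul, _root_.map_pow, mul_assoc, hk]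
    have hyc : mk (edgeBase a e w) * mk L * (mk (edgeBase a e w))⁻¹ = y * mk L * y⁻¹ := by
      rw [hy]
      group
    rw [hyc] at hconj
    obtain ⟨τ, hτ⟩ := exists_hasHolonomy (q := q) (a := a) (f := f) y g
    obtain ⟨σ, hσ, hσn⟩ := hX X hXL
    rw [orderOf_map_of_mem_cyclicWords q hXL] at hσ
    generalize hO : orderOf (q (mk L)) = o at *
    obtain ⟨ρ, hρ, hρn⟩ : ∃ ρ, HasHolonomy q (wreathHom a q f) ((y * mk L * y⁻¹) ^ o) 1 ρ ∧
        ρ ^ n = 1 := by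
      rcases hconj with h | h
      · exact ⟨σ, by rwa [h], hσn⟩
      · refine ⟨σ⁻¹, ?_, by rw [inv_pow, hσn, inv_one]⟩
        rw [h, inv_pow]
        refine HasHolonomy.inv' ?_
        have : q (mk X ^ o) = 1 := by
          rw [← inv_inv (mk X), ← h, inv_pow, conj_pow, _root_.map_inv, _root_.map_mul,
            _root_.map_mul, hq]
          simp
        rwa [this, inv_one, one_mul]
    have hq' : q ((y * mk L * y⁻¹) ^ o) = 1 := by
      rw [conj_pow, _root_.map_mul, _root_.map_mul, hq]
      simp
    have h := hτ.conj hyg hρ hq'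
    have hyo : y⁻¹ * (y * mk L * y⁻¹) ^ o * y = mk L ^ o := by
      rw [conj_pow]
      group
    rw [hyo] at h
    refine ⟨_, h, ?_⟩
    have := conj_pow (a := τ⁻¹) (b := ρ) (i := n)
    rw [inv_inv] at this
    rw [this, hρn]
    group
  · push Not at hcase
    obtain ⟨τ, hτ, h⟩ := HasHolonomy.exists_pow (q := q) (Φ := wreathHom a q f) (w := mk L)
      (g := g) (P := P) (n := orderOf (q (mk L))) fun k _ ↦
        exists_hasHolonomy_mk fun v e w hL ↦ hf _ (hcase k v w e hL)
    exact ⟨τ, h, hP τ hτ⟩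

end Holonomy

end FreeGroup

theorem IsConj.inv {G : Type*} [Group G] {x y : G} (h : IsConj x y) : IsConj x⁻¹ y⁻¹ := by
  obtain ⟨c, rfl⟩ := isConj_iff.1 h
  exact isConj_iff.2 ⟨c, by group⟩

namespace FreeGroup

theorem orderOf_addRight_one (n : ℕ) : orderOf (Equiv.addRight (1 : ZMod n)) = n := by
  refine Nat.dvd_right_iff_eq.1 fun k ↦ ?_
  rw [orderOf_dvd_iff_pow_eq_one, ← ZMod.natCast_eq_zero_iff, Equiv.ext_iff]
  simp

theorem exists_monoidHom_orderOf_eq {ι J : Type} [Finite J] (a : ι) (u : J → FreeGroup ι) (i : J)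
    (hu : ∀ j, (u j).SelfCentralizing)
    (hconj : ∀ j, j ≠ i → ¬ IsConj (u j) (u i) ∧ ¬ IsConj (u j) (u i)⁻¹)
    (ha : ∀ L, IsConj (mk L) (u i) → ∃ e, (a, e) ∈ L) :
    ∃ m k : ℕ, 0 < m ∧ 0 < k ∧ ∀ N : ℕ, 0 < N →
      ∃ (H : Type) (_ : Group H) (_ : Finite H) (φ : FreeGroup ι →* H),
        orderOf (φ (u i)) = m * N ∧ ∀ j, j ≠ i → φ (u j) ^ k = 1 := by
  classical
  choose L hL hLu using fun j ↦ exists_isCyclicallyReduced_isConj (u j)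
  let R : Set (List (ι × Bool)) := ⋃ j ∈ {j | j ≠ i}, cyclicWords a (L j)
  have hprim : ∀ j, ∀ X ∈ cyclicWords a (L j), IsPrimitiveWord a X := fun j X hX ↦
    isPrimitiveWord_of_mem_cyclicWords (hL j) ((hu j).of_isConj (hLu j)) hX
  have hR : ∀ X ∈ R, ∃ j, j ≠ i ∧ X ∈ cyclicWords a (L j) := fun X hX ↦ by
    simpa [R] using hX
  have hR' : ∀ j, j ≠ i → ∀ X ∈ cyclicWords a (L j), X ∈ R := fun j hj X hX ↦
    Set.mem_biUnion (show j ∈ {j | j ≠ i} from hj) hX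
  have hdisj : ∀ X ∈ cyclicWords a (L i), X ∉ R := by
    intro X hX hXR
    obtain ⟨j, hj, hXj⟩ := hR X hXR
    obtain ⟨h1, h2⟩ := hconj j hj
    rcases isConj_of_mem_cyclicWords hX with h | h <;>
      rcases isConj_of_mem_cyclicWords hXj with h' | h'
    · exact h1 ((hLu j).symm.trans (h'.symm.trans (h.trans (hLu i))))
    · refine h2 ?_
      have := (hLu j).inv.symm.trans (h'.symm.trans (h.trans (hLu i)))
      simpa using this.inv
    · exact h2 ((hLu j).symm.trans (h'.symm.trans (h.trans (hLu i).inv)))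
    · refine h1 ?_
      have := (hLu j).inv.symm.trans (h'.symm.trans (h.trans (hLu i).inv))
      simpa using this.inv
  obtain ⟨G, _, _, q, M, hM1, hM2, hM3⟩ := exists_separating_quotient a
    (W := cyclicWords a (L i) ∪ R)
    ((finite_cyclicWords a _).union
      ((Set.toFinite _).biUnion fun j _ ↦ finite_cyclicWords a (L j))) (by
        rintro X (hX | hX)
        · exact hprim i X hX
        · obtain ⟨j, -, hX⟩ := hR X hX
          exact hprim j X hX)
  refine ⟨orderOf (q (u i)) * 2, Nat.card G * 2, by positivity [orderOf_pos (q (u i))],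
    Nat.mul_pos Nat.card_pos two_pos, fun N hN ↦ ?_⟩
  have : NeZero (2 * N) := ⟨by lia⟩
  let r : Equiv.Perm (ZMod (2 * N)) := Equiv.addRight 1
  let s : Equiv.Perm (ZMod (2 * N)) := Equiv.neg _
  have hr : orderOf r = 2 * N := orderOf_addRight_one _
  have hs : s ^ 2 = 1 := by ext; simp [s, pow_two]
  have hsr : (s * r) ^ 2 = 1 := by ext; simp [s, r, pow_two]
  let f : G → Equiv.Perm (ZMod (2 * N)) := fun g ↦
    if g = 1 then r else if ∃ Y ∈ R, g = q (mk Y) ^ M then s else 1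
  have hf1 : f 1 = r := if_pos rfl
  have hfs : ∀ g, g ≠ 1 → (∃ Y ∈ R, g = q (mk Y) ^ M) → f g = s := fun g h h' ↦ by
    simp only [f, if_neg h, if_pos h']
  have hf : ∀ g, g ≠ 1 → (∀ Y ∈ R, g ≠ q (mk Y) ^ M) → f g = 1 := fun g h h' ↦ by
    have : ¬ ∃ Y ∈ R, g = q (mk Y) ^ M := by simpa using h'
    simp only [f, if_neg h, if_neg this]
  have hfP : ∀ g, g ≠ 1 → f g ∈ Subgroup.zpowers s := fun g hg ↦ by
    simp only [f, if_neg hg]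
    split_ifs
    exacts [Subgroup.mem_zpowers s, Subgroup.one_mem _]
  have hsP : ∀ n, Even n → ∀ τ ∈ Subgroup.zpowers s, τ ^ n = 1 := by
    rintro n ⟨n, rfl⟩ τ ⟨k, rfl⟩
    simp only
    rw [← two_mul n, pow_mul, ← zpow_natCast (s ^ k), ← zpow_mul, mul_comm k, zpow_mul,
      zpow_natCast, hs, one_zpow, one_pow]
  have hol : ∀ X ∈ cyclicWords a (L i) ∪ R, ∀ p : ℕ,
      HasHolonomy q (wreathHom a q f) (mk X) (q (mk X) ^ p) (f (q (mk X) ^ p)) := by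
    intro X hX p
    have hXp : IsPrimitiveWord a X := by
      rcases hX with hX | hX
      · exact hprim i X hX
      · obtain ⟨j, -, hX⟩ := hR X hX
        exact hprim j X hX
    exact hXp.hasHolonomy (fun w hw h0 h1 p ↦ hf _ (hM2 X hX w hw h0 h1 p)
      fun Y hY ↦ hM3 X hX Y (Or.inr hY) w hw h1 (Or.inl h0) p) p
  have hne : ∀ X p, 0 < p → p < orderOf (q (mk X)) → q (mk X) ^ p ≠ 1 := fun X p h0 h1 ↦
    pow_ne_one_of_lt_orderOf h0.ne' h1
  have hXnil : ∀ j, ∀ X ∈ cyclicWords a (L j), [] ≠ X := by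
    rintro j X ⟨-, x, rfl⟩
    simp
  have holi : ∀ X ∈ cyclicWords a (L i),
      HasHolonomy q (wreathHom a q f) (mk X ^ orderOf (q (mk X))) 1 r := by
    intro X hX
    refine HasHolonomy.pow_of_map_eq_one_of_forall (orderOf_pos _) ?_ fun p h0 h1 ↦ ?_
    · simpa [hf1] using hol X (Or.inl hX) 0
    · have := hol X (Or.inl hX) p
      rwa [hf _ (hne X p h0 h1) fun Y hY ↦ ?_] at this
      have hXY : X ≠ Y := by rintro rfl; exact hdisj X hX hY
      simpa [← one_eq_mk] using hM3 X (Or.inl hX) Y (Or.inr hY) [] List.nil_suffix (hXnil i X hX)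
        (Or.inr hXY) p
  have holR : ∀ X ∈ R,
      HasHolonomy q (wreathHom a q f) (mk X ^ orderOf (q (mk X))) 1 (s * r) := by
    intro X hX
    have hm := Nat.mod_lt M (orderOf_pos (q (mk X)))
    have hmod : q (mk X) ^ (M % orderOf (q (mk X))) = q (mk X) ^ M := pow_mod_orderOf _ _
    have hm1 : q (mk X) ^ (M % orderOf (q (mk X))) ≠ 1 := by
      rw [hmod]
      exact hM1 X (Or.inr hX)
    refine HasHolonomy.pow_of_forall_ne (Nat.pos_of_ne_zero fun h ↦ hm1 (by rw [h, pow_zero])) hm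
      ?_ ?_ fun p h0 h1 hp ↦ ?_
    · simpa [hf1] using hol X (Or.inr hX) 0
    · have := hol X (Or.inr hX) (M % orderOf (q (mk X)))
      rwa [hfs _ hm1 ⟨X, hX, hmod⟩] at this
    · have := hol X (Or.inr hX) p
      rwa [hf _ (hne X p h0 h1) fun Y hY ↦ ?_] at this
      by_cases hXY : X = Y
      · subst hXY
        rw [← hmod]
        exact fun h ↦ hp (pow_injOn_Iio_orderOf h1 hm h)
      · obtain ⟨j, -, hXj⟩ := hR X hX
        simpa [← one_eq_mk] using hM3 X (Or.inr hX) Y (Or.inr hY) [] List.nil_suffix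
          (hXnil j X hXj) (Or.inr hXY) p
  refine ⟨Equiv.Perm (G × ZMod (2 * N)), inferInstance, inferInstance, wreathHom a q f, ?_, ?_⟩
  · obtain ⟨X, hX⟩ := nonempty_cyclicWords (ha (L i) (hLu i))
    have h1 := orderOf_mul_orderOf_dvd (holi X hX)
    rw [hr, orderOf_map_of_mem_cyclicWords q hX, orderOf_map_of_mem_cyclicWords _ hX] at h1
    have h2 := orderOf_dvd_of_pow_eq_one (wreathHom_pow_eq_one (L := L i) (n := 2 * N)
      (hsP _ (even_two_mul N)) hfP fun X hX ↦ ⟨r, holi X hX, orderOf_dvd_iff_pow_eq_one.1 hr.dvd⟩)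
    rw [← orderOf_map_eq_of_isConj _ (hLu i), ← orderOf_map_eq_of_isConj q (hLu i), mul_assoc]
    exact Nat.dvd_antisymm h2 h1
  · intro j hj
    have h2 := wreathHom_pow_eq_one (L := L j) (n := 2) (hsP _ even_two) hfP fun X hX ↦
      ⟨s * r, holR X (hR' j hj X hX), hsr⟩
    rw [← orderOf_dvd_iff_pow_eq_one, ← orderOf_map_eq_of_isConj _ (hLu j)]
    exact (orderOf_dvd_of_pow_eq_one h2).trans (mul_dvd_mul_right (orderOf_dvd_natCard _) 2)

theorem exists_forall_orderOf_eq_mul {ι J : Type} [Finite J] (a : ι) (u : J → FreeGroup ι)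
    (hu : ∀ j, (u j).SelfCentralizing)
    (hconj : ∀ i j, i ≠ j → ¬ IsConj (u i) (u j) ∧ ¬ IsConj (u i) (u j)⁻¹)
    (ha : ∀ i L, IsConj (mk L) (u i) → ∃ e, (a, e) ∈ L) :
    ∃ K : ℕ, 0 < K ∧ ∀ l : J → ℕ, (∀ i, 0 < l i) →
      ∃ (H : Type) (_ : Group H) (_ : Finite H) (φ : FreeGroup ι →* H),
        ∀ i, orderOf (φ (u i)) = K * l i := by
  have := Fintype.ofFinite J
  choose m k hm hk h using fun i ↦ exists_monoidHom_orderOf_eq a u i hu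
    (fun j hj ↦ hconj j i hj) (ha i)
  have hdvd : ∀ (f : J → ℕ) i, f i ∣ ∏ j, f j := fun f i ↦
    Finset.dvd_prod_of_mem f (Finset.mem_univ i)
  set K := (∏ i, m i) * ∏ i, k i with hK
  have hKpos : 0 < K := Nat.mul_pos (Finset.prod_pos fun i _ ↦ hm i)
    (Finset.prod_pos fun i _ ↦ hk i)
  refine ⟨K, hKpos, fun l hl ↦ ?_⟩
  have hmK : ∀ i, m i ∣ K := fun i ↦ (hdvd m i).mul_right _
  choose H hG hF φ hφ hφ' using fun i ↦ h i (K / m i * l i)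
    (Nat.mul_pos (Nat.div_pos (Nat.le_of_dvd hKpos (hmK i)) (hm i)) (hl i))
  refine ⟨∀ i, H i, inferInstance, inferInstance, MonoidHom.mk' (fun x i ↦ φ i x) ?_, fun i ↦ ?_⟩
  · exact fun x y ↦ funext fun i ↦ (φ i).map_mul x y
  refine Nat.dvd_right_iff_eq.1 fun n ↦ ?_
  have hi : orderOf (φ i (u i)) = K * l i := by
    rw [hφ, ← mul_assoc, Nat.mul_div_cancel' (hmK i)]
  rw [orderOf_dvd_iff_pow_eq_one, funext_iff, ← hi]
  refine ⟨fun h ↦ orderOf_dvd_of_pow_eq_one (h i), fun h j ↦ orderOf_dvd_iff_pow_eq_one.1 ?_⟩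
  obtain rfl | hij := eq_or_ne i j
  · exact h
  · rw [hi] at h
    exact (orderOf_dvd_of_pow_eq_one (hφ' j i hij)).trans
      (((hdvd k j).mul_left _).trans ((Dvd.intro _ rfl).trans h))

theorem mk_mem_zpowers_of_forall {L : List (Bool × Bool)} (h : ¬ ∃ e, (true, e) ∈ L) :
    mk L ∈ Subgroup.zpowers (of false) := by
  induction L with
  | nil => exact Subgroup.one_mem _
  | cons l L ih =>
    have hL := ih fun ⟨e, he⟩ ↦ h ⟨e, List.mem_cons_of_mem _ he⟩
    match l, h with
    | (true, e), h => exact (h ⟨e, List.mem_cons_self⟩).elim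
    | (false, true), _ =>
      rw [mk_cons_true]
      exact Subgroup.mul_mem _ (Subgroup.mem_zpowers _) hL
    | (false, false), _ =>
      rw [mk_cons_false]
      exact Subgroup.mul_mem _ (Subgroup.inv_mem _ (Subgroup.mem_zpowers _)) hL

theorem exists_forall_orderOf_eq_mul_of_not_conj {J : Type} [Finite J] (u : J → FreeGroup Bool)
    (hu : ∀ i g, g * u i * g⁻¹ ∉ Subgroup.zpowers (of false))
    (hcyc : ∀ i j, i ≠ j → ¬ ∃ (g c : FreeGroup Bool) (k l : ℤ),
      u i = c ^ k ∧ g * u j * g⁻¹ = c ^ l) :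
    ∃ K : ℕ, 0 < K ∧ ∀ l : J → ℕ, (∀ i, 0 < l i) →
      ∃ (H : Type) (_ : Group H) (_ : Finite H) (φ : FreeGroup Bool →* H),
        ∀ i, orderOf (φ (u i)) = K * l i := by
  have hu1 : ∀ i, u i ≠ 1 := fun i h ↦ hu i 1 (by simp [h])
  choose c k hc hk huc using fun i ↦ exists_selfCentralizing_root (hu1 i)
  have hconj : ∀ i j, i ≠ j → ¬ IsConj (c i) (c j) ∧ ¬ IsConj (c i) (c j)⁻¹ := by
    refine fun i j hij ↦ ⟨fun h ↦ ?_, fun h ↦ ?_⟩ <;> obtain ⟨g, hg⟩ := isConj_iff.1 h.symm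
    · exact hcyc i j hij ⟨g, c i, k i, k j, huc i, by rw [huc j, ← conj_zpow, hg]⟩
    · refine hcyc i j hij ⟨g, c i, k i, -k j, huc i, ?_⟩
      rw [huc j, ← conj_zpow, ← hg, ← inv_zpow']
      congr 1
      group
  have ha : ∀ i L, IsConj (mk L) (c i) → ∃ e, (true, e) ∈ L := by
    intro i L hL
    by_contra hL'
    obtain ⟨g, hg⟩ := isConj_iff.1 hL.symm
    refine hu i g ?_
    rw [huc i, ← conj_zpow, hg]
    exact Subgroup.zpow_mem _ (mk_mem_zpowers_of_forall hL') _
  obtain ⟨K, hK, h⟩ := exists_forall_orderOf_eq_mul true c hc hconj ha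
  refine ⟨K, hK, fun l hl ↦ ?_⟩
  obtain ⟨H, hG, hF, φ, hφ⟩ := h (fun i ↦ l i * (k i).natAbs)
    fun i ↦ Nat.mul_pos (hl i) (Int.natAbs_pos.2 (hk i))
  refine ⟨H, hG, hF, φ, fun i ↦ ?_⟩
  have hki : (k i).natAbs ≠ 0 := Int.natAbs_ne_zero.2 (hk i)
  have h1 : orderOf (φ (u i)) = orderOf (φ (c i) ^ (k i).natAbs) := by
    rw [huc i, _root_.map_zpow]
    rcases Int.natAbs_eq (k i) with h | h
    · conv_lhs => rw [h, zpow_natCast]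
    · conv_lhs => rw [h, zpow_neg, zpow_natCast, orderOf_inv]
  rw [h1, orderOf_pow_of_dvd hki (hφ i ▸ ⟨K * l i, by ring⟩), hφ i, ← mul_assoc,
    Nat.mul_div_cancel _ (Nat.pos_of_ne_zero hki)]

/-- The free product of two infinite cyclic groups is free of rank two. -/
def coprodIntEquiv : Multiplicative ℤ ∗ Multiplicative ℤ ≃* FreeGroup Bool :=
  MonoidHom.toMulEquiv
    (Monoid.Coprod.lift (zpowersHom _ (of true)) (zpowersHom _ (of false)))
    (lift fun b ↦ if b then Monoid.Coprod.inl (Multiplicative.ofAdd (1 : ℤ))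
      else Monoid.Coprod.inr (Multiplicative.ofAdd (1 : ℤ)))
    (by ext <;> simp) (by ext b; cases b <;> simp)

theorem coprodIntEquiv_inr :
    coprodIntEquiv (Monoid.Coprod.inr (Multiplicative.ofAdd (1 : ℤ))) = of false := by
  simp [coprodIntEquiv]

end FreeGroup

/-- omnipotence of the free group of rank 2, realized as `ℤ ∗ ℤ`.
Let `F = ℤ ∗ ℤ` with canonical free generators `a = inl 1` and `b = inr 1`.
If `u₁, …, uₙ ∈ F` are such that no `uᵢ` lies in a conjugate of `⟨a⟩` or `⟨b⟩`, and no two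
distinct `uᵢ, uⱼ` lie in conjugate cyclic subgroups, then there is `K > 0` such that for
every sequence of positive integers `l₁, …, lₙ` there is a surjection `φ` of `F` onto a
finite group with `orderOf (φ uᵢ) = K * lᵢ` for all `i`. -/
theorem freeGroupRankTwo_omnipotence
    (n : ℕ) (u : Fin n → Multiplicative ℤ ∗ Multiplicative ℤ)
    (a b : Multiplicative ℤ ∗ Multiplicative ℤ)
    (ha : a = Monoid.Coprod.inl (Multiplicative.ofAdd (1 : ℤ)))
    (hb : b = Monoid.Coprod.inr (Multiplicative.ofAdd (1 : ℤ)))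
    (hu : ∀ i, ¬ ∃ (g : Multiplicative ℤ ∗ Multiplicative ℤ) (k : ℤ),
        g * u i * g⁻¹ = a ^ k ∨ g * u i * g⁻¹ = b ^ k)
    (hcyc : ∀ i j, i ≠ j →
        ¬ ∃ (g c : Multiplicative ℤ ∗ Multiplicative ℤ) (k l : ℤ),
          u i = c ^ k ∧ g * u j * g⁻¹ = c ^ l) :
    ∃ K : ℕ, 0 < K ∧ ∀ l : Fin n → ℕ, (∀ i, 0 < l i) →
      ∃ (H : Type) (_ : Group H) (_ : Finite H)
        (φ : Multiplicative ℤ ∗ Multiplicative ℤ →* H),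
        Function.Surjective φ ∧ ∀ i, orderOf (φ (u i)) = K * l i := by
  have hu' : ∀ i g, g * FreeGroup.coprodIntEquiv (u i) * g⁻¹ ∉
      Subgroup.zpowers (FreeGroup.of false) := by
    rintro i g ⟨k, hk⟩
    refine hu i ⟨FreeGroup.coprodIntEquiv.symm g, k, Or.inr ?_⟩
    apply FreeGroup.coprodIntEquiv.injective
    rw [hb, map_zpow, FreeGroup.coprodIntEquiv_inr]
    simpa using hk.symm
  have hcyc' : ∀ i j, i ≠ j → ¬ ∃ (g c : FreeGroup Bool) (k l : ℤ),
      FreeGroup.coprodIntEquiv (u i) = c ^ k ∧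
        g * FreeGroup.coprodIntEquiv (u j) * g⁻¹ = c ^ l := by
    rintro i j hij ⟨g, c, k, l, h1, h2⟩
    refine hcyc i j hij ⟨FreeGroup.coprodIntEquiv.symm g, FreeGroup.coprodIntEquiv.symm c, k, l,
      ?_, ?_⟩ <;> apply FreeGroup.coprodIntEquiv.injective
    · simpa using h1
    · simpa using h2
  obtain ⟨K, hK, h⟩ := FreeGroup.exists_forall_orderOf_eq_mul_of_not_conj _ hu' hcyc'
  refine ⟨K, hK, fun l hl ↦ ?_⟩
  obtain ⟨H, _, _, φ, hφ⟩ := h l hl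
  let ψ := φ.comp FreeGroup.coprodIntEquiv.toMonoidHom
  refine ⟨ψ.range, inferInstance, inferInstance, ψ.rangeRestrict, ψ.rangeRestrict_surjective,
    fun i ↦ ?_⟩
  rw [← Subgroup.orderOf_coe]
  exact hφ i
end
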